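/- arXiv:q-alg/9509003 — 2 statements merged into one kernel-verified Lean document; each statement's English description precedes it below -/
import Mathlib

section
/- For every partition λ = (λ_1 ≥ λ_2 ≥ … ≥ λ_{N−1} ≥ 0) (set λ_N = 0), the Jack polynomial satisfies the Rodrigues-type formula J_λ(z;1/β) = c_λ^{−1} (B⁺_{N−1})^{λ_{N−1}} (B⁺_{N−2})^{λ_{N−2}−λ_{N−1}} ⋯ (B⁺_2)^{λ_2−λ_3} (B⁺_1)^{λ_1−λ_2} · 1, where c_λ = Π_{k=1}^{N−1} Π_{m=1}^{k} (mβ + λ_{k+1−m} − λ_k)_{λ_k−λ_{k+1}} and (x)_n = x(x+1)⋯(x+n−1) denotes the Pochhammer symbol with (x)_0 = 1. -/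
open MvPolynomial Finset

section CSDefs

variable {F : Type*} [Field F] [CharZero F]

/-- Exact division in a polynomial ring: `divExact d f = f / d` when `d ∣ f`, junk otherwise. -/
noncomputable def divExact {σ : Type*} (d f : MvPolynomial σ F) : MvPolynomial σ F := by
  classical exact if h : ∃ c, f = d * c then h.choose else 0

/-- The exchange operator `K_{ij}` permuting the variables `z_i` and `z_j`. -/
noncomputable def Kswap {N : ℕ} (i j : Fin N) (f : MvPolynomial (Fin N) F) :
    MvPolynomial (Fin N) F :=
  rename (Equiv.swap i j) f

/-- The Dunkl operator `∇_i = ∂_i + β ∑_{j ≠ i} (z_i - z_j)⁻¹ (1 - K_{ij})`. -/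
noncomputable def nabla {N : ℕ} (β : F) (i : Fin N) (f : MvPolynomial (Fin N) F) :
    MvPolynomial (Fin N) F :=
  pderiv i f + β • ∑ j ∈ Finset.univ.erase i, divExact (X i - X j) (f - Kswap i j f)

/-- `D_i = z_i ∇_i`. -/
noncomputable def Dop {N : ℕ} (β : F) (i : Fin N) (f : MvPolynomial (Fin N) F) :
    MvPolynomial (Fin N) F :=
  X i * nabla β i f

/-- `(D_{j₁} + kβ)(D_{j₂} + (k+1)β) ⋯` applied along a list of indices. -/
noncomputable def Dlist {N : ℕ} (β : F) :
    ℕ → List (Fin N) → MvPolynomial (Fin N) F → MvPolynomial (Fin N) F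
  | _, [], f => f
  | k, j :: rest, f => Dop β j (Dlist β (k + 1) rest f) + ((k : F) * β) • Dlist β (k + 1) rest f

/-- `D_{k,J} = (D_{j₁} + kβ)(D_{j₂} + (k+1)β) ⋯ (D_{j_ℓ} + (k+ℓ-1)β)` for
`J = {j₁ < j₂ < … < j_ℓ}`. -/
noncomputable def DJ {N : ℕ} (β : F) (k : ℕ) (J : Finset (Fin N))
    (f : MvPolynomial (Fin N) F) : MvPolynomial (Fin N) F :=
  Dlist β k (J.sort (· ≤ ·)) f

/-- `z_J = ∏_{i ∈ J} z_i`. -/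
noncomputable def zJ {N : ℕ} (J : Finset (Fin N)) : MvPolynomial (Fin N) F := ∏ i ∈ J, X i

/-- The creation operator `B⁺_{i,J} = ∑_{J' ⊆ J, |J'| = i} z_{J'} D_{1,J'}`. -/
noncomputable def Bplus {N : ℕ} (β : F) (i : ℕ) (J : Finset (Fin N))
    (f : MvPolynomial (Fin N) F) : MvPolynomial (Fin N) F :=
  ∑ J' ∈ J.powersetCard i, zJ J' * DJ β 1 J' f

/-- `A_{ij} = ((z_i+z_j)/(z_i-z_j))(z_i ∂_i - z_j ∂_j)`. -/
noncomputable def Aop {N : ℕ} (i j : Fin N) (f : MvPolynomial (Fin N) F) :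
    MvPolynomial (Fin N) F :=
  divExact (X i - X j) ((X i + X j) * (X i * pderiv i f - X j * pderiv j f))

/-- `H^{(S)} = ∑_{i ∈ S} (z_i ∂_i)² + β ∑_{i<j, i,j ∈ S} A_{ij}`. -/
noncomputable def Hop {N : ℕ} (β : F) (S : Finset (Fin N)) (f : MvPolynomial (Fin N) F) :
    MvPolynomial (Fin N) F :=
  ∑ i ∈ S, X i * pderiv i (X i * pderiv i f)
    + β • ∑ i ∈ S, ∑ j ∈ S.filter (fun j => i < j), Aop i j f

/-- A polynomial is symmetric in the variables indexed by `S`. -/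
def SymmOn {N : ℕ} (S : Finset (Fin N)) (f : MvPolynomial (Fin N) F) : Prop :=
  ∀ i ∈ S, ∀ j ∈ S, rename (Equiv.swap i j) f = f

/-- `phiCS β N lam i = (B⁺_i)^{λ_i - λ_{i+1}} ⋯ (B⁺_1)^{λ_1 - λ_2} · 1`,
where `lam` is 0-indexed: `lam (j-1) = λ_j`. -/
noncomputable def phiCS (β : F) (N : ℕ) (lam : ℕ → ℕ) : ℕ → MvPolynomial (Fin N) F
  | 0 => 1
  | i + 1 => (fun f => Bplus β (i + 1) Finset.univ f)^[lam i - lam (i + 1)] (phiCS β N lam i)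

/-- The monomial symmetric polynomial attached to an exponent vector. -/
noncomputable def msym (N : ℕ) (lam : Fin N → ℕ) : MvPolynomial (Fin N) F := by
  classical
  exact ∑ v ∈ (Finset.univ : Finset (Equiv.Perm (Fin N))).image
      (fun σ => fun i => lam (σ i)), ∏ i, X i ^ v i

/-- `𝐷̂_i = D_i + β(i-1) - β ∑_{j<i} (1 - K_{ij})` (0-indexed: `i-1` becomes `i`). -/
noncomputable def Dhat {N : ℕ} (β : F) (i : Fin N) (f : MvPolynomial (Fin N) F) :
    MvPolynomial (Fin N) F :=
  Dop β i f + (β * ((i : ℕ) : F)) • f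
    - β • ∑ j ∈ Finset.univ.filter (fun j => j < i), (f - Kswap i j f)

end CSDefs

namespace RodriguesJack

variable {F : Type*} [Field F] {N : ℕ}

lemma divExact_eq {σ : Type*} {d f c : MvPolynomial σ F} (hd : d ≠ 0) (h : f = d * c) :
    divExact d f = c := by
  have hex : ∃ c, f = d * c := ⟨c, h⟩
  unfold divExact
  rw [dif_pos hex]
  exact mul_left_cancel₀ hd (hex.choose_spec.symm.trans h)

lemma X_sub_X_ne_zero {i j : Fin N} (h : i ≠ j) : (X i - X j : MvPolynomial (Fin N) F) ≠ 0 :=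
  sub_ne_zero.2 fun h' => h (X_injective h')

/-- The algebra automorphism permuting the variables. -/
noncomputable def perm (σ : Equiv.Perm (Fin N)) : Module.End F (MvPolynomial (Fin N) F) :=
  (rename σ).toLinearMap

lemma perm_apply (σ : Equiv.Perm (Fin N)) (f : MvPolynomial (Fin N) F) :
    perm σ f = rename σ f := rfl

lemma perm_mul (σ : Equiv.Perm (Fin N)) (f g : MvPolynomial (Fin N) F) :
    perm σ (f * g) = perm σ f * perm σ g := map_mul (rename σ) f g

lemma perm_X (σ : Equiv.Perm (Fin N)) (i : Fin N) :
    perm σ (X i : MvPolynomial (Fin N) F) = X (σ i) := rename_X _ _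

lemma perm_perm (σ τ : Equiv.Perm (Fin N)) (f : MvPolynomial (Fin N) F) :
    perm σ (perm τ f) = perm (σ * τ) f := rename_rename _ _ _

lemma perm_swap_swap (i j : Fin N) (f : MvPolynomial (Fin N) F) :
    perm (Equiv.swap i j) (perm (Equiv.swap i j) f) = f := by
  rw [perm_perm, Equiv.swap_mul_self, perm_apply, Equiv.Perm.coe_one, rename_id_apply]

lemma exists_sub_swap_eq (i j : Fin N) (f : MvPolynomial (Fin N) F) :
    ∃ c, f - perm (Equiv.swap i j) f = (X i - X j) * c := by
  induction f using MvPolynomial.induction_on with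
  | C a => exact ⟨0, by simp [perm_apply]⟩
  | add p q hp hq =>
    obtain ⟨c, hc⟩ := hp
    obtain ⟨d, hd⟩ := hq
    exact ⟨c + d, by rw [map_add, mul_add, ← hc, ← hd]; ring⟩
  | mul_X p k hp =>
    obtain ⟨c, hc⟩ := hp
    rw [perm_mul, perm_X]
    rcases eq_or_ne k i with rfl | hi
    · exact ⟨c * X j + p, by rw [Equiv.swap_apply_left]; linear_combination X j * hc⟩
    rcases eq_or_ne k j with rfl | hj
    · exact ⟨c * X i - p, by rw [Equiv.swap_apply_right]; linear_combination X i * hc⟩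
    · exact ⟨c * X k, by rw [Equiv.swap_apply_of_ne_of_ne hi hj]; linear_combination X k * hc⟩

lemma divExact_swap (i j : Fin N) (f : MvPolynomial (Fin N) F) (h : i ≠ j) :
    (X i - X j) * divExact (X i - X j) (f - perm (Equiv.swap i j) f)
      = f - perm (Equiv.swap i j) f := by
  obtain ⟨c, hc⟩ := exists_sub_swap_eq i j f
  rw [divExact_eq (X_sub_X_ne_zero h) hc, hc]

/-- The divided difference `(1 - K_{ij}) / (z_i - z_j)`, taken to be zero when `i = j`. -/
noncomputable def divDiff (i j : Fin N) : Module.End F (MvPolynomial (Fin N) F) where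
  toFun f := if i = j then 0 else divExact (X i - X j) (f - perm (Equiv.swap i j) f)
  map_add' f g := by
    split_ifs with h
    · simp
    · apply divExact_eq (X_sub_X_ne_zero h)
      rw [mul_add, divExact_swap _ _ _ h, divExact_swap _ _ _ h, map_add]; ring
  map_smul' a f := by
    split_ifs with h
    · simp
    · apply divExact_eq (X_sub_X_ne_zero h)
      rw [RingHom.id_apply, mul_smul_comm, divExact_swap _ _ _ h, map_smul, smul_sub]

lemma divDiff_apply {i j : Fin N} (h : i ≠ j) (f : MvPolynomial (Fin N) F) :
    divDiff i j f = divExact (X i - X j) (f - perm (Equiv.swap i j) f) := if_neg h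

lemma mul_divDiff (i j : Fin N) (f : MvPolynomial (Fin N) F) :
    (X i - X j) * divDiff i j f = f - perm (Equiv.swap i j) f := by
  rcases eq_or_ne i j with rfl | h
  · rw [Equiv.swap_self, perm_apply]; simp
  · rw [divDiff_apply h, divExact_swap _ _ _ h]

lemma divDiff_eq {i j : Fin N} (h : i ≠ j) {f c : MvPolynomial (Fin N) F}
    (hc : f - perm (Equiv.swap i j) f = (X i - X j) * c) : divDiff i j f = c := by
  rw [divDiff_apply h, divExact_eq (X_sub_X_ne_zero h) hc]

lemma divDiff_self (i : Fin N) (f : MvPolynomial (Fin N) F) : divDiff i i f = 0 := if_pos rfl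

lemma divDiff_eq_zero {i j : Fin N} {f : MvPolynomial (Fin N) F}
    (h : perm (Equiv.swap i j) f = f) : divDiff i j f = 0 := by
  rcases eq_or_ne i j with rfl | hij
  · exact divDiff_self _ _
  · exact divDiff_eq hij (by rw [h]; simp)

lemma divDiff_mul {i j : Fin N} {p : MvPolynomial (Fin N) F}
    (h : perm (Equiv.swap i j) p = p) (f : MvPolynomial (Fin N) F) :
    divDiff i j (p * f) = p * divDiff i j f := by
  rcases eq_or_ne i j with rfl | hij
  · simp [divDiff_self]
  · exact divDiff_eq hij (by rw [perm_mul, h]; linear_combination -p * mul_divDiff i j f)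

lemma divDiff_X_left {i j : Fin N} (hij : i ≠ j) (f : MvPolynomial (Fin N) F) :
    divDiff i j (X i * f) = X i * divDiff i j f + perm (Equiv.swap i j) f := by
  refine divDiff_eq hij ?_
  rw [perm_mul, perm_X, Equiv.swap_apply_left]
  linear_combination - X i * mul_divDiff i j f

lemma divDiff_X_right {i j : Fin N} (hij : i ≠ j) (f : MvPolynomial (Fin N) F) :
    divDiff i j (X j * f) = X j * divDiff i j f - perm (Equiv.swap i j) f := by
  refine divDiff_eq hij ?_
  rw [perm_mul, perm_X, Equiv.swap_apply_right]
  linear_combination - X j * mul_divDiff i j f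

lemma perm_divDiff (σ : Equiv.Perm (Fin N)) (i j : Fin N) (f : MvPolynomial (Fin N) F) :
    perm σ (divDiff i j f) = divDiff (σ i) (σ j) (perm σ f) := by
  rcases eq_or_ne i j with rfl | hij
  · simp [divDiff_self]
  · refine (divDiff_eq (σ.injective.ne hij) ?_).symm
    have h := congrArg (perm σ) (mul_divDiff i j f)
    rw [perm_mul, map_sub, map_sub, perm_X, perm_X] at h
    rw [h, perm_perm, perm_perm, Equiv.swap_apply_apply, inv_mul_cancel_right]

lemma perm_pderiv (σ : Equiv.Perm (Fin N)) (i : Fin N) (f : MvPolynomial (Fin N) F) :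
    perm σ (pderiv i f) = pderiv (σ i) (perm σ f) :=
  (pderiv_rename σ.injective i f).symm

/-- The Dunkl operator as a linear map. -/
noncomputable def dunkl (β : F) (i : Fin N) : Module.End F (MvPolynomial (Fin N) F) :=
  (pderiv i).toLinearMap + β • ∑ j, divDiff i j

lemma dunkl_apply (β : F) (i : Fin N) (f : MvPolynomial (Fin N) F) :
    dunkl β i f = pderiv i f + β • ∑ j, divDiff i j f := by
  simp [dunkl]

lemma perm_dunkl (β : F) (σ : Equiv.Perm (Fin N)) (i : Fin N) (f : MvPolynomial (Fin N) F) :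
    perm σ (dunkl β i f) = dunkl β (σ i) (perm σ f) := by
  simp only [dunkl_apply, map_add, map_smul, map_sum, perm_divDiff, perm_pderiv]
  rw [Equiv.sum_comp σ (fun j => divDiff (σ i) j (perm σ f))]

lemma dunkl_X_of_ne (β : F) {i k : Fin N} (h : i ≠ k) (f : MvPolynomial (Fin N) F) :
    dunkl β i (X k * f) = X k * dunkl β i f - β • perm (Equiv.swap i k) f := by
  have hs : ∑ j, divDiff i j (X k * f) = X k * ∑ j, divDiff i j f - perm (Equiv.swap i k) f := by
    rw [← Finset.add_sum_erase _ _ (Finset.mem_univ k), mul_sum,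
      ← Finset.add_sum_erase _ _ (Finset.mem_univ k), divDiff_X_right h,
      Finset.sum_congr rfl (fun j hj => divDiff_mul (p := X k) ?_ f)]
    · ring
    · rw [perm_X, Equiv.swap_apply_of_ne_of_ne h.symm (Finset.ne_of_mem_erase hj).symm]
  rw [dunkl_apply, dunkl_apply, hs, Derivation.leibniz, pderiv_X_of_ne h.symm, smul_sub,
    smul_zero, add_zero, smul_eq_mul, mul_add, mul_smul_comm]
  ring

lemma dunkl_X_self (β : F) (i : Fin N) (f : MvPolynomial (Fin N) F) :
    dunkl β i (X i * f) = X i * dunkl β i f + f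
      + β • ∑ j ∈ univ.erase i, perm (Equiv.swap i j) f := by
  have hs : ∑ j, divDiff i j (X i * f)
      = X i * ∑ j, divDiff i j f + ∑ j ∈ univ.erase i, perm (Equiv.swap i j) f := by
    rw [← Finset.add_sum_erase _ _ (Finset.mem_univ i), mul_sum,
      ← Finset.add_sum_erase _ _ (Finset.mem_univ i), divDiff_self, divDiff_self,
      Finset.sum_congr rfl (fun j hj => divDiff_X_left (Finset.ne_of_mem_erase hj).symm f),
      Finset.sum_add_distrib]
    ring
  rw [dunkl_apply, dunkl_apply, hs, Derivation.leibniz, pderiv_X_self, smul_add,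
    smul_eq_mul, smul_eq_mul, mul_add, mul_smul_comm]
  ring

lemma dunkl_swap_of_ne (β : F) {i j k : Fin N} (hj : i ≠ j) (hk : i ≠ k)
    (f : MvPolynomial (Fin N) F) :
    dunkl β i (perm (Equiv.swap j k) f) = perm (Equiv.swap j k) (dunkl β i f) := by
  rw [perm_dunkl, Equiv.swap_apply_of_ne_of_ne hj hk]

lemma dunkl_comm_X_right (β : F) {i j : Fin N} (hij : i ≠ j) (f : MvPolynomial (Fin N) F)
    (hf : dunkl β i (dunkl β j f) = dunkl β j (dunkl β i f)) :
    dunkl β i (dunkl β j (X i * f)) = dunkl β j (dunkl β i (X i * f)) := by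
  rw [dunkl_X_of_ne β hij.symm, dunkl_X_self, map_sub, map_add, map_add, dunkl_X_self,
    dunkl_X_of_ne β hij.symm, map_smul, map_smul, map_sum, hf,
    ← Finset.add_sum_erase _ _ (Finset.mem_erase.2 ⟨hij.symm, Finset.mem_univ j⟩),
    ← Finset.add_sum_erase _ _ (Finset.mem_erase.2 ⟨hij.symm, Finset.mem_univ j⟩)]
  have h1 : ∑ k ∈ (univ.erase i).erase j, dunkl β j (perm (Equiv.swap i k) f)
      = ∑ k ∈ (univ.erase i).erase j, perm (Equiv.swap i k) (dunkl β j f) :=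
    Finset.sum_congr rfl fun k hk =>
      dunkl_swap_of_ne β hij.symm (Finset.ne_of_mem_erase hk).symm f
  have h2 : perm (Equiv.swap i j) (dunkl β j f) = dunkl β i (perm (Equiv.swap i j) f) := by
    rw [perm_dunkl, Equiv.swap_apply_right]
  have h3 : perm (Equiv.swap j i) (dunkl β i f) = dunkl β j (perm (Equiv.swap i j) f) := by
    rw [perm_dunkl, Equiv.swap_apply_right, Equiv.swap_comm]
  rw [h1, h2, h3, Equiv.swap_comm j i]
  simp only [smul_add]
  ring

/-- The Dunkl operators commute. -/
lemma dunkl_comm (β : F) (i j : Fin N) (f : MvPolynomial (Fin N) F) :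
    dunkl β i (dunkl β j f) = dunkl β j (dunkl β i f) := by
  rcases eq_or_ne i j with rfl | hij
  · rfl
  induction f using MvPolynomial.induction_on with
  | C a =>
    have h : ∀ k : Fin N, dunkl β k (C a) = 0 := fun k => by
      rw [dunkl_apply, pderiv_C, Finset.sum_eq_zero fun j _ => ?_, smul_zero, add_zero]
      exact divDiff_eq_zero (rename_C _ _)
    rw [h, h, map_zero, map_zero]
  | add p q hp hq => simp only [map_add, hp, hq]
  | mul_X p k hp =>
    rw [mul_comm]
    rcases eq_or_ne k i with rfl | hi
    · exact dunkl_comm_X_right β hij p hp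
    rcases eq_or_ne k j with rfl | hj
    · exact (dunkl_comm_X_right β hij.symm p hp.symm).symm
    rw [dunkl_X_of_ne β hj.symm, dunkl_X_of_ne β hi.symm, map_sub, map_sub,
      dunkl_X_of_ne β hi.symm, dunkl_X_of_ne β hj.symm, map_smul, map_smul,
      dunkl_swap_of_ne β hij hi.symm, dunkl_swap_of_ne β hij.symm hj.symm, hp]
    ring

/-- The operator `D_i = z_i ∇_i` as a linear map. -/
noncomputable def dop (β : F) (i : Fin N) : Module.End F (MvPolynomial (Fin N) F) :=
  LinearMap.mulLeft F (X i) * dunkl β i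

lemma dop_apply (β : F) (i : Fin N) (f : MvPolynomial (Fin N) F) :
    dop β i f = X i * dunkl β i f := rfl

lemma Dop_eq (β : F) (i : Fin N) (f : MvPolynomial (Fin N) F) : Dop β i f = dop β i f := by
  rw [Dop, nabla, dop_apply, dunkl_apply, ← Finset.add_sum_erase _ _ (Finset.mem_univ i),
    divDiff_self, zero_add]
  congr 3
  exact Finset.sum_congr rfl fun j hj => (divDiff_apply (Finset.ne_of_mem_erase hj).symm f).symm

lemma perm_dop (β : F) (σ : Equiv.Perm (Fin N)) (i : Fin N) (f : MvPolynomial (Fin N) F) :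
    perm σ (dop β i f) = dop β (σ i) (perm σ f) := by
  rw [dop_apply, dop_apply, perm_mul, perm_X, perm_dunkl]

lemma dop_swap_of_ne (β : F) {i j k : Fin N} (hj : i ≠ j) (hk : i ≠ k)
    (f : MvPolynomial (Fin N) F) :
    perm (Equiv.swap j k) (dop β i f) = dop β i (perm (Equiv.swap j k) f) := by
  rw [perm_dop, Equiv.swap_apply_of_ne_of_ne hj hk]

lemma dop_dop (β : F) {i j : Fin N} (hij : i ≠ j) (f : MvPolynomial (Fin N) F) :
    dop β i (dop β j f) = dop β j (dop β i f)
      + β • (dop β j (perm (Equiv.swap i j) f) - dop β i (perm (Equiv.swap i j) f)) := by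
  simp only [dop_apply, dunkl_X_of_ne β hij, dunkl_X_of_ne β hij.symm, perm_dunkl,
    Equiv.swap_apply_right, dunkl_comm β j i, Equiv.swap_comm j i, Equiv.swap_apply_left,
    smul_eq_C_mul]
  ring

lemma dop_of_swap_fixed (β : F) (i : Fin N) {f : MvPolynomial (Fin N) F}
    (hf : ∀ j, perm (Equiv.swap i j) f = f) : dop β i f = X i * pderiv i f := by
  rw [dop_apply, dunkl_apply, Finset.sum_eq_zero fun j _ => divDiff_eq_zero (hf j), smul_zero,
    add_zero]

lemma Dlist_nil (β : F) (k : ℕ) (f : MvPolynomial (Fin N) F) : Dlist β k [] f = f := by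
  rw [Dlist]

lemma Dlist_cons (β : F) (k : ℕ) (i : Fin N) (L : List (Fin N)) (f : MvPolynomial (Fin N) F) :
    Dlist β k (i :: L) f
      = dop β i (Dlist β (k + 1) L f) + ((k : F) * β) • Dlist β (k + 1) L f := by
  rw [Dlist, Dop_eq]

lemma perm_Dlist (β : F) (σ : Equiv.Perm (Fin N)) {f : MvPolynomial (Fin N) F}
    (hf : perm σ f = f) (L : List (Fin N)) (k : ℕ) :
    perm σ (Dlist β k L f) = Dlist β k (L.map σ) f := by
  induction L generalizing k with
  | nil => simpa only [List.map_nil, Dlist_nil] using hf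
  | cons i L ih => rw [List.map_cons, Dlist_cons, Dlist_cons, map_add, map_smul, perm_dop, ih]

lemma swap_Dlist_of_notMem (β : F) {i j : Fin N} {f : MvPolynomial (Fin N) F}
    (hf : ∀ σ, perm σ f = f) {L : List (Fin N)} (hi : i ∉ L) (hj : j ∉ L) (k : ℕ) :
    perm (Equiv.swap i j) (Dlist β k L f) = Dlist β k L f := by
  rw [perm_Dlist β _ (hf _)]
  congr 1
  conv_rhs => rw [← List.map_id L]
  refine List.map_congr_left fun a ha => Equiv.swap_apply_of_ne_of_ne ?_ ?_
  · rintro rfl; exact hi ha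
  · rintro rfl; exact hj ha

lemma Dlist_eq_of_perm (β : F) {f : MvPolynomial (Fin N) F} (hf : ∀ σ, perm σ f = f)
    {L M : List (Fin N)} (h : L.Perm M) (hL : L.Nodup) (k : ℕ) :
    Dlist β k L f = Dlist β k M f := by
  induction h generalizing k with
  | nil => rfl
  | cons a _ ih => rw [Dlist_cons, Dlist_cons, ih (List.nodup_cons.1 hL).2]
  | swap i j L =>
    simp only [List.nodup_cons, List.mem_cons, not_or] at hL
    obtain ⟨⟨hji, hj⟩, hi, -⟩ := hL
    have hu := swap_Dlist_of_notMem β hf hj hi (k + 1 + 1)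
    simp only [Dlist_cons, map_add, map_smul, dop_dop β hji, hu]
    push_cast
    simp only [smul_eq_C_mul, map_add, map_mul, map_one]
    ring
  | trans h₁ _ ih₁ ih₂ => rw [ih₁ hL, ih₂ (h₁.nodup_iff.1 hL)]

lemma DJ_eq_Dlist (β : F) {f : MvPolynomial (Fin N) F} (hf : ∀ σ, perm σ f = f)
    (k : ℕ) {L : List (Fin N)} (hL : L.Nodup) {J : Finset (Fin N)} (h : L.toFinset = J) :
    DJ β k J f = Dlist β k L f := by
  subst h
  refine Dlist_eq_of_perm β hf ?_ (Finset.sort_nodup _ _) k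
  exact (List.perm_ext_iff_of_nodup (Finset.sort_nodup _ _) hL).2 fun a => by simp

lemma perm_DJ (β : F) (σ : Equiv.Perm (Fin N)) {f : MvPolynomial (Fin N) F}
    (hf : ∀ σ, perm σ f = f) (k : ℕ) (J : Finset (Fin N)) :
    perm σ (DJ β k J f) = DJ β k (J.image σ) f := by
  rw [DJ, perm_Dlist β σ (hf σ), DJ_eq_Dlist β hf k]
  · exact (Finset.sort_nodup _ _).map σ.injective
  · ext a; simp

lemma swap_DJ_of_notMem (β : F) {i j : Fin N} {f : MvPolynomial (Fin N) F}
    (hf : ∀ σ, perm σ f = f) {J : Finset (Fin N)} (hi : i ∉ J) (hj : j ∉ J) (k : ℕ) :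
    perm (Equiv.swap i j) (DJ β k J f) = DJ β k J f :=
  swap_Dlist_of_notMem β hf (by simpa using hi) (by simpa using hj) k

/-- The Cherednik operator attached to the ordering of the variables given by `r`. -/
noncomputable def cherednik (β : F) (r : Fin N → ℕ) (i : Fin N) :
    Module.End F (MvPolynomial (Fin N) F) :=
  dop β i + β • ∑ j with r j < r i, perm (Equiv.swap i j)

lemma cherednik_apply (β : F) (r : Fin N → ℕ) (i : Fin N) (f : MvPolynomial (Fin N) F) :
    cherednik β r i f = dop β i f + β • ∑ j with r j < r i, perm (Equiv.swap i j) f := by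
  simp [cherednik]

lemma perm_sum_swap (σ : Equiv.Perm (Fin N)) {i : Fin N} (hi : σ i = i) {S : Finset (Fin N)}
    (hS : ∀ k, σ k ∈ S ↔ k ∈ S) (f : MvPolynomial (Fin N) F) :
    perm σ (∑ k ∈ S, perm (Equiv.swap i k) f) = ∑ k ∈ S, perm (Equiv.swap i k) (perm σ f) := by
  rw [map_sum]
  refine Finset.sum_equiv σ (fun k => (hS k).symm) fun k _ => ?_
  rw [perm_perm, perm_perm]
  nth_rewrite 2 [← hi]
  rw [Equiv.swap_apply_apply, inv_mul_cancel_right]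

lemma cherednik_comm_of_lt (β : F) {r : Fin N → ℕ} {i j : Fin N} (h : r j < r i)
    (f : MvPolynomial (Fin N) F) :
    cherednik β r i (cherednik β r j f) = cherednik β r j (cherednik β r i f) := by
  have hij : i ≠ j := by rintro rfl; exact lt_irrefl _ h
  set S : Finset (Fin N) := univ.filter fun k => r k < r i with hS
  set T : Finset (Fin N) := univ.filter fun k => r k < r j with hT
  have hjS : j ∈ S := by simpa [hS] using h
  have h1 : ∑ m ∈ T, dop β i (perm (Equiv.swap j m) f)
      = ∑ m ∈ T, perm (Equiv.swap j m) (dop β i f) := by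
    refine Finset.sum_congr rfl fun m hm => (dop_swap_of_ne β hij ?_ f).symm
    rintro rfl
    simp only [hT, Finset.mem_filter] at hm
    omega
  have h2 : ∑ k ∈ S, perm (Equiv.swap i k) (dop β j f)
      = dop β i (perm (Equiv.swap i j) f)
        + ∑ k ∈ S.erase j, dop β j (perm (Equiv.swap i k) f) := by
    rw [← Finset.add_sum_erase _ _ hjS, perm_dop, Equiv.swap_apply_right]
    congr 1
    exact Finset.sum_congr rfl fun k hk =>
      dop_swap_of_ne β hij.symm (Finset.ne_of_mem_erase hk).symm f
  have h3 : ∑ m ∈ T, perm (Equiv.swap j m) (∑ k ∈ S, perm (Equiv.swap i k) f)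
      = ∑ m ∈ T, ∑ k ∈ S, perm (Equiv.swap i k) (perm (Equiv.swap j m) f) := by
    refine Finset.sum_congr rfl fun m hm => ?_
    have hmj : r m < r j := by simpa [hT] using hm
    refine perm_sum_swap _ (Equiv.swap_apply_of_ne_of_ne hij ?_) (fun k => ?_) f
    · rintro rfl; omega
    · simp only [hS, Finset.mem_filter, Finset.mem_univ, true_and]
      rcases eq_or_ne k j with rfl | hkj
      · rw [Equiv.swap_apply_left]; omega
      rcases eq_or_ne k m with rfl | hkm
      · rw [Equiv.swap_apply_right]; omega
      rw [Equiv.swap_apply_of_ne_of_ne hkj hkm]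
  simp only [cherednik_apply, map_add, map_smul, map_sum, ← hS, ← hT,
    Finset.sum_add_distrib, ← Finset.smul_sum]
  simp only [map_sum] at h3
  rw [h1, h2, Finset.sum_comm (s := S), h3, dop_dop β hij,
    ← Finset.add_sum_erase S (fun k => dop β j (perm (Equiv.swap i k) f)) hjS]
  simp only [smul_eq_C_mul]
  ring

lemma cherednik_comm (β : F) {r : Fin N → ℕ} (i j : Fin N) (h : r i = r j → i = j)
    (f : MvPolynomial (Fin N) F) :
    cherednik β r i (cherednik β r j f) = cherednik β r j (cherednik β r i f) := by
  rcases lt_trichotomy (r i) (r j) with hlt | heq | hlt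
  · exact (cherednik_comm_of_lt β hlt f).symm
  · rw [h heq]
  · exact cherednik_comm_of_lt β hlt f

lemma filter_idxOf_lt {A B : List (Fin N)} {j : Fin N} (h : (A ++ j :: B).Nodup) :
    (univ.filter fun m => (A ++ j :: B).idxOf m < (A ++ j :: B).idxOf j) = A.toFinset := by
  have hj : j ∉ A := fun hj => (List.nodup_append.1 h).2.2 j hj j List.mem_cons_self rfl
  ext m
  simp only [Finset.mem_filter, Finset.mem_univ, true_and, List.mem_toFinset]
  rw [List.idxOf_append_of_notMem hj, List.idxOf_cons_self, List.idxOf_append]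
  split_ifs with hm
  · simpa [hm] using List.idxOf_lt_length_of_mem hm
  · simp [hm]

lemma Dlist_eq_prod (β : F) {f : MvPolynomial (Fin N) F} (hf : ∀ σ, perm σ f = f)
    {L : List (Fin N)} (hL : L.Nodup) (C B A : List (Fin N)) (h : L = A ++ (B ++ C)) :
    Dlist β A.length B f = (B.map (cherednik β fun k => L.idxOf k)).prod f := by
  induction B generalizing A with
  | nil => simp [Dlist_nil]
  | cons j B ih =>
    have h' : L = (A ++ [j]) ++ (B ++ C) := by simpa using h
    have ih' := ih (A ++ [j]) h'
    rw [List.length_append, List.length_singleton] at ih'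
    rw [Dlist_cons, List.map_cons, List.prod_cons, Module.End.mul_apply, ← ih', cherednik_apply]
    subst h
    have hL' := hL
    rw [List.cons_append] at hL
    rw [List.cons_append, filter_idxOf_lt hL]
    have hA : A.Nodup := (List.nodup_append.1 hL).1
    have hd := (List.nodup_append.1 hL).2.2
    rw [Finset.sum_congr rfl fun m hm => swap_Dlist_of_notMem β hf (i := j) (j := m) (L := B)
        ?_ ?_ (A.length + 1), Finset.sum_const, List.toFinset_card_of_nodup hA,
        ← Nat.cast_smul_eq_nsmul F, smul_smul, mul_comm]
    · have := (List.nodup_cons.1 (List.nodup_append.1 hL).2.1).1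
      exact fun hj => this (List.mem_append_left _ hj)
    · intro hB
      exact hd m (List.mem_toFinset.1 hm) m
        (List.mem_cons_of_mem _ (List.mem_append_left _ hB)) rfl

lemma commute_cherednik (β : F) {r : Fin N → ℕ} (i j : Fin N) (h : r i = r j → i = j) :
    Commute (cherednik β r i) (cherednik β r j) :=
  LinearMap.ext fun f => cherednik_comm β i j h f

lemma commute_cherednik_prod (β : F) {L B : List (Fin N)} (hB : ∀ b ∈ B, b ∈ L) (i : Fin N) :
    Commute (cherednik β (fun k => L.idxOf k) i)
      (B.map (cherednik β fun k => L.idxOf k)).prod := by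
  refine Commute.list_prod_right _ _ fun y hy => ?_
  obtain ⟨b, hb, rfl⟩ := List.mem_map.1 hy
  exact commute_cherednik β _ _ fun h => ((List.idxOf_inj (hB b hb)).1 h.symm).symm

/-- `f` is annihilated by all `D_{0,J}` with `|J| = l + 1`. -/
def Vanish (β : F) (l : ℕ) (f : MvPolynomial (Fin N) F) : Prop :=
  ∀ L : List (Fin N), L.Nodup → L.length = l + 1 → Dlist β 0 L f = 0

lemma Vanish.succ {β : F} {l : ℕ} {f : MvPolynomial (Fin N) F} (hf : ∀ σ, perm σ f = f)
    (h : Vanish β l f) : Vanish β (l + 1) f := by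
  intro L hL hl
  obtain rfl | ⟨M, j, rfl⟩ := List.eq_nil_or_concat L
  · simp at hl
  rw [List.concat_eq_append] at hL hl ⊢
  have h1 := Dlist_eq_prod β hf hL [] (M ++ [j]) [] (by simp)
  have h2 := Dlist_eq_prod β hf hL [j] M [] (by simp)
  rw [List.length_nil] at h1 h2
  have hM : Dlist β 0 M f = 0 :=
    h M (List.nodup_append.1 hL).1 (by simpa using hl)
  rw [h1, List.map_append, List.prod_append, List.map_singleton, List.prod_singleton,
    ← (commute_cherednik_prod β (fun b hb => List.mem_append_left _ hb) j).eq,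
    Module.End.mul_apply, ← h2, hM, map_zero]

lemma vanish_one (β : F) : Vanish β 0 (1 : MvPolynomial (Fin N) F) := by
  intro L _ hl
  obtain ⟨i, rfl⟩ := List.length_eq_one_iff.1 (by simpa using hl)
  have h1 : ∀ j, perm (Equiv.swap i j) (1 : MvPolynomial (Fin N) F) = 1 :=
    fun j => map_one (rename _)
  rw [Dlist_cons, Dlist_nil, dop_of_swap_fixed β i h1]
  simp

lemma Vanish.dop_DJ {β : F} {l : ℕ} {f : MvPolynomial (Fin N) F} (h : Vanish β l f)
    {J : Finset (Fin N)} (hJ : J.card = l) {i : Fin N} (hi : i ∉ J) :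
    dop β i (DJ β 1 J f) = 0 := by
  have := h (i :: J.sort (· ≤ ·))
    (List.nodup_cons.2 ⟨by simpa using hi, Finset.sort_nodup _ _⟩) (by simp [hJ])
  rw [Dlist_cons] at this
  simpa [DJ] using this

lemma perm_zJ (σ : Equiv.Perm (Fin N)) (J : Finset (Fin N)) :
    perm σ (zJ J : MvPolynomial (Fin N) F) = zJ (J.image σ) := by
  rw [zJ, zJ, perm_apply, map_prod, Finset.prod_image σ.injective.injOn]
  exact Finset.prod_congr rfl fun i _ => rename_X _ _

lemma perm_swap_prod {i j : Fin N} {J : Finset (Fin N)} (hi : i ∉ J) (hj : j ∉ J) :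
    perm (Equiv.swap i j) (∏ k ∈ J, X k : MvPolynomial (Fin N) F) = ∏ k ∈ J, X k := by
  rw [perm_apply, map_prod]
  refine Finset.prod_congr rfl fun k hk => ?_
  rw [rename_X, Equiv.swap_apply_of_ne_of_ne]
  · rintro rfl; exact hi hk
  · rintro rfl; exact hj hk

lemma perm_swap_zJ_of_mem {i j : Fin N} {J : Finset (Fin N)} (hi : i ∈ J) (hj : j ∈ J) :
    perm (Equiv.swap i j) (zJ J : MvPolynomial (Fin N) F) = zJ J := by
  rw [perm_zJ]
  congr 1
  refine Finset.eq_of_subset_of_card_le (fun k hk => ?_)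
    (Finset.card_image_of_injective _ (Equiv.injective _)).ge
  obtain ⟨m, hm, rfl⟩ := Finset.mem_image.1 hk
  rw [Equiv.swap_apply_def]
  split_ifs
  exacts [hj, hi, hm]

lemma X_mul_divDiff_zJ_of_mem {i j : Fin N} {J : Finset (Fin N)} (hi : i ∈ J) (hj : j ∉ J)
    (g : MvPolynomial (Fin N) F) :
    divDiff i j (zJ J * g) = zJ (J.erase i) * (X i * divDiff i j g + perm (Equiv.swap i j) g) := by
  have hij : i ≠ j := by rintro rfl; exact hj hi
  have hz : (zJ J : MvPolynomial (Fin N) F) = zJ (J.erase i) * X i :=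
    (Finset.prod_erase_mul J _ hi).symm
  rw [hz, mul_assoc, divDiff_mul, divDiff_X_left hij]
  exact perm_swap_prod (Finset.notMem_erase _ _) fun h => hj (Finset.mem_of_mem_erase h)

lemma X_mul_divDiff_zJ_of_notMem {i j : Fin N} {J : Finset (Fin N)} (hi : i ∉ J) (hj : j ∈ J)
    (g : MvPolynomial (Fin N) F) :
    X i * divDiff i j (zJ J * g)
      = zJ J * (X i * divDiff i j g) - perm (Equiv.swap i j) (zJ J * g) := by
  have hij : i ≠ j := by rintro rfl; exact hi hj
  have hz : (zJ J : MvPolynomial (Fin N) F) = zJ (J.erase j) * X j :=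
    (Finset.prod_erase_mul J _ hj).symm
  have hp : perm (Equiv.swap i j) (zJ (J.erase j) : MvPolynomial (Fin N) F) = zJ (J.erase j) :=
    perm_swap_prod (fun h => hi (Finset.mem_of_mem_erase h)) (Finset.notMem_erase _ _)
  rw [hz, mul_assoc, divDiff_mul hp, divDiff_X_right hij, perm_mul, perm_mul, hp, perm_X,
    Equiv.swap_apply_right]
  ring

lemma pderiv_zJ_of_notMem {i : Fin N} {J : Finset (Fin N)} (hi : i ∉ J) :
    pderiv i (zJ J : MvPolynomial (Fin N) F) = 0 := by
  refine Finset.prod_induction _ (fun p => pderiv i p = 0) (fun p q hp hq => ?_) pderiv_one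
    fun k hk => pderiv_X_of_ne ?_
  · rw [Derivation.leibniz, hp, hq, smul_zero, smul_zero, add_zero]
  · rintro rfl; exact hi hk

lemma X_mul_pderiv_zJ_of_mem {i : Fin N} {J : Finset (Fin N)} (hi : i ∈ J) :
    X i * pderiv i (zJ J : MvPolynomial (Fin N) F) = zJ J := by
  have hz : (zJ J : MvPolynomial (Fin N) F) = zJ (J.erase i) * X i :=
    (Finset.prod_erase_mul J _ hi).symm
  rw [hz, Derivation.leibniz, pderiv_X_self, pderiv_zJ_of_notMem (Finset.notMem_erase _ _)]
  simp [mul_comm]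

lemma dop_zJ_of_notMem (β : F) {i : Fin N} {J : Finset (Fin N)} (hi : i ∉ J)
    (g : MvPolynomial (Fin N) F) :
    dop β i (zJ J * g) = zJ J * dop β i g
      - β • ∑ j ∈ J, perm (Equiv.swap i j) (zJ J * g) := by
  have h : ∀ j, X i * divDiff i j (zJ J * g) = zJ J * (X i * divDiff i j g)
      - if j ∈ J then perm (Equiv.swap i j) (zJ J * g) else 0 := by
    intro j
    split_ifs with hj
    · exact X_mul_divDiff_zJ_of_notMem hi hj g
    · have hz : perm (Equiv.swap i j) (zJ J : MvPolynomial (Fin N) F) = zJ J :=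
        perm_swap_prod hi hj
      rw [divDiff_mul hz]; ring
  rw [dop_apply, dop_apply, dunkl_apply, dunkl_apply, Derivation.leibniz, pderiv_zJ_of_notMem hi,
    mul_add, mul_smul_comm, mul_sum, Finset.sum_congr rfl fun j _ => h j, Finset.sum_sub_distrib,
    Finset.sum_ite_mem, Finset.univ_inter, ← mul_sum, ← mul_sum]
  simp only [smul_eq_C_mul, smul_eq_mul]
  ring

lemma dop_zJ_of_mem (β : F) {i : Fin N} {J : Finset (Fin N)} (hi : i ∈ J)
    (g : MvPolynomial (Fin N) F) :
    dop β i (zJ J * g) = zJ J * (dop β i g + g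
      + β • ∑ j ∈ Jᶜ, perm (Equiv.swap i j) g) := by
  have h : ∀ j, X i * divDiff i j (zJ J * g) = zJ J * (X i * divDiff i j g
      + if j ∈ Jᶜ then perm (Equiv.swap i j) g else 0) := by
    intro j
    have hz : (zJ J : MvPolynomial (Fin N) F) = X i * zJ (J.erase i) :=
      (Finset.mul_prod_erase J _ hi).symm
    split_ifs with hj
    · rw [X_mul_divDiff_zJ_of_mem hi (Finset.mem_compl.1 hj), hz]
      ring
    · rw [divDiff_mul (perm_swap_zJ_of_mem hi (by simpa using hj))]; ring
  have hd := X_mul_pderiv_zJ_of_mem (F := F) hi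
  rw [dop_apply, dop_apply, dunkl_apply, dunkl_apply, Derivation.leibniz,
    mul_add, mul_smul_comm, mul_sum, Finset.sum_congr rfl fun j _ => h j, ← mul_sum,
    Finset.sum_add_distrib, Finset.sum_ite_mem, Finset.univ_inter, ← mul_sum]
  simp only [smul_eq_C_mul, smul_eq_mul]
  linear_combination g * hd

/-- The summand `z_J D_{1,J} f` of the creation operator. -/
noncomputable def term (β : F) (f : MvPolynomial (Fin N) F) (J : Finset (Fin N)) :
    MvPolynomial (Fin N) F := zJ J * DJ β 1 J f

lemma perm_term (β : F) (σ : Equiv.Perm (Fin N)) {f : MvPolynomial (Fin N) F}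
    (hf : ∀ σ, perm σ f = f) (J : Finset (Fin N)) :
    perm σ (term β f J) = term β f (J.image σ) := by
  rw [term, term, perm_mul, perm_zJ, perm_DJ β σ hf]

lemma Bplus_eq_sum (β : F) (l : ℕ) (f : MvPolynomial (Fin N) F) :
    Bplus β l univ f = ∑ J ∈ powersetCard l univ, term β f J := rfl

lemma perm_Bplus (β : F) (l : ℕ) {f : MvPolynomial (Fin N) F} (hf : ∀ σ, perm σ f = f)
    (σ : Equiv.Perm (Fin N)) : perm σ (Bplus β l univ f) = Bplus β l univ f := by
  rw [Bplus_eq_sum, map_sum]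
  refine Finset.sum_bij' (fun J _ => J.image σ) (fun J _ => J.image σ.symm) ?_ ?_ ?_ ?_ ?_
  · intro J hJ
    simpa [Finset.mem_powersetCard, Finset.card_image_of_injective _ σ.injective] using hJ
  · intro J hJ
    simpa [Finset.mem_powersetCard, Finset.card_image_of_injective _ σ.symm.injective] using hJ
  · intro J _; simp [Finset.image_image]
  · intro J _; simp [Finset.image_image]
  · intro J _; exact perm_term β σ hf J

lemma Vanish.dop_term {β : F} {l : ℕ} {f : MvPolynomial (Fin N) F} (h : Vanish β l f)
    {J : Finset (Fin N)} (hJ : J.card = l) {i : Fin N} (hi : i ∉ J) :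
    dop β i (term β f J) = - β • ∑ j ∈ J, perm (Equiv.swap i j) (term β f J) := by
  rw [term, dop_zJ_of_notMem β hi, h.dop_DJ hJ hi, mul_zero, zero_sub, neg_smul]

lemma Vanish.prod_term {β : F} {l : ℕ} {f : MvPolynomial (Fin N) F} (hf : ∀ σ, perm σ f = f)
    (h : Vanish β l f) {L : List (Fin N)} (hL : L.Nodup) (hl : L.length = l + 1)
    (B A : List (Fin N)) (hAB : L = A ++ B) (J : Finset (Fin N)) (hJ : J.card = l)
    (hA : ∀ a ∈ A, a ∈ J) :
    (B.map (cherednik β fun k => L.idxOf k)).prod (term β f J) = 0 := by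
  induction B generalizing A J with
  | nil =>
    exfalso
    have h1 : L.toFinset ⊆ J := fun a ha => hA a (by simpa [hAB] using ha)
    have h2 := Finset.card_le_card h1
    rw [List.toFinset_card_of_nodup hL] at h2
    omega
  | cons b B ih =>
    have hAB' : L = (A ++ [b]) ++ B := by simpa using hAB
    rw [List.map_cons, List.prod_cons]
    by_cases hb : b ∈ J
    · rw [Module.End.mul_apply, ih _ hAB' J hJ, map_zero]
      intro a ha
      rcases List.mem_append.1 ha with ha | ha
      · exact hA a ha
      · rwa [List.mem_singleton.1 ha]
    have hc : Commute (cherednik β (fun k => L.idxOf k) b)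
        (B.map (cherednik β fun k => L.idxOf k)).prod :=
      commute_cherednik_prod β (fun c hc => by simp [hAB, hc]) b
    have hN := hL
    rw [hAB] at hN
    have hbA : b ∉ A := fun hb => (List.nodup_append.1 hN).2.2 b hb b List.mem_cons_self rfl
    have hY : cherednik β (fun k => L.idxOf k) b (term β f J)
        = - β • ∑ j ∈ J \ A.toFinset, term β f (J.image (Equiv.swap b j)) := by
      have hs : A.toFinset ⊆ J := fun a ha => hA a (List.mem_toFinset.1 ha)
      subst hAB
      rw [cherednik_apply, filter_idxOf_lt hN, h.dop_term hJ hb, ← Finset.sum_sdiff hs, smul_add,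
        neg_smul, neg_smul, neg_add_cancel_right, neg_smul]
      simp only [perm_term β _ hf]
    rw [hc.eq, Module.End.mul_apply, hY, map_smul, map_sum, Finset.sum_eq_zero, smul_zero]
    intro j hj
    rw [Finset.mem_sdiff, List.mem_toFinset] at hj
    refine ih _ hAB' _ ?_ fun a ha => ?_
    · rw [Finset.card_image_of_injective _ (Equiv.injective _), hJ]
    · rw [Finset.mem_image]
      rcases List.mem_append.1 ha with ha | ha
      · exact ⟨a, hA a ha, Equiv.swap_apply_of_ne_of_ne (fun h => hbA (h ▸ ha))
          fun h => hj.2 (h ▸ ha)⟩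
      · exact ⟨j, hj.1, by rw [List.mem_singleton.1 ha, Equiv.swap_apply_right]⟩

lemma Vanish.bplus {β : F} {l : ℕ} {f : MvPolynomial (Fin N) F} (hf : ∀ σ, perm σ f = f)
    (h : Vanish β l f) : Vanish β l (Bplus β l univ f) := by
  intro L hL hl
  have := Dlist_eq_prod β (perm_Bplus β l hf) hL [] L [] (by simp)
  rw [List.length_nil] at this
  rw [this, Bplus_eq_sum, map_sum]
  refine Finset.sum_eq_zero fun J hJ => ?_
  exact h.prod_term hf hL hl L [] rfl J (Finset.mem_powersetCard.1 hJ).2 (by simp)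

lemma two_nsmul_sum_lt {M : Type*} [AddCommGroup M] {r : Fin N → ℕ} (hr : Function.Injective r)
    (φ : Fin N → Fin N → M) (hφ : ∀ i j, φ i j = φ j i) :
    2 • ∑ i, ∑ j with r j < r i, φ i j = ∑ i, ∑ j with j ≠ i, φ i j := by
  have h : ∑ i, ∑ j with r j < r i, φ i j = ∑ i, ∑ j with r i < r j, φ i j := by
    simp only [Finset.sum_filter]
    rw [Finset.sum_comm]
    exact Finset.sum_congr rfl fun i _ => Finset.sum_congr rfl fun j _ => by rw [hφ]
  rw [two_nsmul]
  nth_rewrite 2 [h]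
  rw [← Finset.sum_add_distrib]
  simp only [Finset.sum_filter, ← Finset.sum_add_distrib]
  refine Finset.sum_congr rfl fun i _ => Finset.sum_congr rfl fun j _ => ?_
  rcases lt_trichotomy (r i) (r j) with h | h | h
  · rw [if_neg (by omega), if_pos h, zero_add, if_pos]
    rintro rfl; omega
  · rw [if_neg (by omega), if_neg (by omega), if_neg (not_not.2 (hr h).symm), add_zero]
  · rw [if_pos h, if_neg (by omega), add_zero, if_pos]
    rintro rfl; omega

lemma three_nsmul_sum_lt {M : Type*} [AddCommGroup M] {r : Fin N → ℕ}
    (hr : Function.Injective r) (φ : Fin N → Fin N → Fin N → M)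
    (hφ : ∀ i j k, φ i j k = φ j k i) :
    3 • ∑ i, ∑ j, ∑ k, (if r j < r i ∧ r k < r i ∧ j ≠ k then φ i j k else 0)
      = ∑ i, ∑ j, ∑ k, (if i ≠ j ∧ i ≠ k ∧ j ≠ k then φ i j k else 0) := by
  have hcyc : ∀ ψ : Fin N → Fin N → Fin N → M,
      ∑ i, ∑ j, ∑ k, ψ i j k = ∑ i, ∑ j, ∑ k, ψ j k i := fun ψ => by
    rw [Finset.sum_comm' (t' := univ) (s' := fun _ => univ) (by simp)]
    conv_rhs => rw [Finset.sum_comm]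
    rw [Finset.sum_comm]
    refine Finset.sum_congr rfl fun i _ => ?_
    exact Finset.sum_comm
  have h1 : ∑ i, ∑ j, ∑ k, (if r j < r i ∧ r k < r i ∧ j ≠ k then φ i j k else 0)
      = ∑ i, ∑ j, ∑ k, (if r k < r j ∧ r i < r j ∧ k ≠ i then φ i j k else 0) := by
    rw [hcyc]; simp only [← hφ]
  have h2 : ∑ i, ∑ j, ∑ k, (if r j < r i ∧ r k < r i ∧ j ≠ k then φ i j k else 0)
      = ∑ i, ∑ j, ∑ k, (if r i < r k ∧ r j < r k ∧ i ≠ j then φ i j k else 0) := by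
    rw [h1, hcyc]; simp only [← hφ]
  set S := ∑ i, ∑ j, ∑ k, (if r j < r i ∧ r k < r i ∧ j ≠ k then φ i j k else 0) with hS
  have h3 : 3 • S = S + S + S := by rw [succ_nsmul, two_nsmul]
  rw [h3]
  nth_rewrite 3 [h2]
  nth_rewrite 2 [h1]
  rw [hS]
  simp only [← Finset.sum_add_distrib]
  refine Finset.sum_congr rfl fun i _ => Finset.sum_congr rfl fun j _ =>
    Finset.sum_congr rfl fun k _ => ?_
  by_cases h : i ≠ j ∧ i ≠ k ∧ j ≠ k
  · obtain ⟨hij, hik, hjk⟩ := h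
    have hij' := hr.ne hij
    have hik' := hr.ne hik
    have hjk' := hr.ne hjk
    rw [if_pos (c := i ≠ j ∧ i ≠ k ∧ j ≠ k) ⟨hij, hik, hjk⟩]
    simp only [ne_eq, hij, hik.symm, hjk, not_false_eq_true, and_true]
    split_ifs <;> first | omega | simp
  · rw [if_neg h, if_neg, if_neg, if_neg, add_zero, add_zero]
    all_goals
      rintro ⟨h1, h2, h3⟩
      refine h ⟨?_, ?_, ?_⟩ <;> rintro rfl <;> omega

/-- The sum of the Cherednik operators. -/
noncomputable def casimirOne (β : F) : Module.End F (MvPolynomial (Fin N) F) :=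
  ∑ i, cherednik β (fun k => (k : ℕ)) i

/-- The sum of the squares of the Cherednik operators. -/
noncomputable def casimirTwo (β : F) : Module.End F (MvPolynomial (Fin N) F) :=
  ∑ i, cherednik β (fun k => (k : ℕ)) i * cherednik β (fun k => (k : ℕ)) i

lemma sum_cherednik_sq (β : F) (r : Fin N → ℕ) (f : MvPolynomial (Fin N) F) :
    ∑ i, cherednik β r i (cherednik β r i f) = ∑ i, dop β i (dop β i f)
      + β • ∑ i, ∑ j with r j < r i, (dop β i (perm (Equiv.swap i j) f)
          + dop β j (perm (Equiv.swap i j) f))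
      + β ^ 2 • ∑ i, ∑ j with r j < r i, ∑ k with r k < r i,
          perm (Equiv.swap i j) (perm (Equiv.swap i k) f) := by
  rw [smul_sum, smul_sum, ← Finset.sum_add_distrib, ← Finset.sum_add_distrib]
  refine Finset.sum_congr rfl fun i _ => ?_
  have hK : ∑ j with r j < r i, perm (Equiv.swap i j)
        (dop β i f + β • ∑ k with r k < r i, perm (Equiv.swap i k) f)
      = ∑ j with r j < r i, dop β j (perm (Equiv.swap i j) f)
        + β • ∑ j with r j < r i, ∑ k with r k < r i,
          perm (Equiv.swap i j) (perm (Equiv.swap i k) f) := by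
    simp only [map_add, perm_dop, Equiv.swap_apply_left, map_smul, map_sum,
      Finset.sum_add_distrib, ← smul_sum]
  rw [cherednik_apply, cherednik_apply, hK, map_add, map_smul, map_sum, Finset.sum_add_distrib,
    smul_add, smul_add, smul_smul, pow_two]
  simp only [add_assoc]

lemma sum_cherednik_eq [CharZero F] (β : F) {r : Fin N → ℕ} (hr : Function.Injective r)
    (f : MvPolynomial (Fin N) F) : ∑ i, cherednik β r i f = casimirOne β f := by
  rw [casimirOne, LinearMap.sum_apply]
  simp only [cherednik_apply, Finset.sum_add_distrib, ← smul_sum]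
  congr 2
  have h : ∀ i j, perm (Equiv.swap i j) f = perm (Equiv.swap j i) f :=
    fun i j => by rw [Equiv.swap_comm]
  exact nsmul_right_injective two_ne_zero
    ((two_nsmul_sum_lt hr _ h).trans (two_nsmul_sum_lt Fin.val_injective _ h).symm)

lemma swap_mul_swap_cyclic {i j k : Fin N} (hik : i ≠ k) (hjk : j ≠ k) :
    Equiv.swap i j * Equiv.swap i k = Equiv.swap j k * Equiv.swap j i := by
  rw [Equiv.mul_swap_eq_swap_mul, Equiv.swap_apply_left,
    Equiv.swap_apply_of_ne_of_ne hik.symm hjk.symm, Equiv.swap_comm i j]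

lemma sum_sum_lt_eq {M : Type*} [AddCommGroup M] {r : Fin N → ℕ}
    (φ : Fin N → Fin N → Fin N → M) (i : Fin N) :
    ∑ j with r j < r i, ∑ k with r k < r i, φ i j k
      = ∑ j with r j < r i, φ i j j
        + ∑ j, ∑ k, (if r j < r i ∧ r k < r i ∧ j ≠ k then φ i j k else 0) := by
  rw [Finset.sum_filter, Finset.sum_filter, ← Finset.sum_add_distrib]
  refine Finset.sum_congr rfl fun j _ => ?_
  split_ifs with h
  · have h1 : φ i j j = ∑ k, if k = j then φ i j j else 0 := by simp
    rw [Finset.sum_filter, h1, ← Finset.sum_add_distrib]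
    refine Finset.sum_congr rfl fun k _ => ?_
    by_cases hk : k = j
    · subst hk; simp [h]
    · simp [hk, Ne.symm hk, h]
  · simp [h]

lemma sum_cherednik_sq_eq [CharZero F] (β : F) {r : Fin N → ℕ} (hr : Function.Injective r)
    (f : MvPolynomial (Fin N) F) :
    ∑ i, cherednik β r i (cherednik β r i f) = casimirTwo β f := by
  rw [casimirTwo, LinearMap.sum_apply]
  simp only [Module.End.mul_apply]
  rw [sum_cherednik_sq, sum_cherednik_sq]
  simp only [sum_sum_lt_eq (fun i j k => perm (Equiv.swap i j) (perm (Equiv.swap i k) f)),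
    Finset.sum_add_distrib (f := fun i => ∑ j with _, _), perm_swap_swap]
  have h1 : ∀ i j, dop β i (perm (Equiv.swap i j) f) + dop β j (perm (Equiv.swap i j) f)
      = dop β j (perm (Equiv.swap j i) f) + dop β i (perm (Equiv.swap j i) f) :=
    fun i j => by rw [Equiv.swap_comm, add_comm]
  have e1 := nsmul_right_injective two_ne_zero
    ((two_nsmul_sum_lt hr _ h1).trans (two_nsmul_sum_lt Fin.val_injective _ h1).symm)
  have e2 := nsmul_right_injective two_ne_zero
    ((two_nsmul_sum_lt hr (fun _ _ => f) fun _ _ => rfl).trans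
      (two_nsmul_sum_lt Fin.val_injective (fun _ _ => f) fun _ _ => rfl).symm)
  have e3 : ∑ i, ∑ j, ∑ k, (if r j < r i ∧ r k < r i ∧ j ≠ k then
        perm (Equiv.swap i j) (perm (Equiv.swap i k) f) else 0)
      = ∑ i : Fin N, ∑ j : Fin N, ∑ k : Fin N, (if (j : ℕ) < i ∧ (k : ℕ) < i ∧ j ≠ k then
        perm (Equiv.swap i j) (perm (Equiv.swap i k) f) else 0) := by
    set φ : Fin N → Fin N → Fin N → MvPolynomial (Fin N) F := fun i j k =>
      if i ≠ j ∧ i ≠ k ∧ j ≠ k then perm (Equiv.swap i j) (perm (Equiv.swap i k) f) else 0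
    have hφ : ∀ i j k, φ i j k = φ j k i := by
      intro i j k
      by_cases h : i ≠ j ∧ i ≠ k ∧ j ≠ k
      · rw [show φ i j k = _ from if_pos h, show φ j k i = _ from
          if_pos ⟨h.2.2, h.1.symm, h.2.1.symm⟩, perm_perm, perm_perm,
          swap_mul_swap_cyclic h.2.1 h.2.2]
      · rw [show φ i j k = _ from if_neg h, show φ j k i = _ from if_neg ?_]
        exact fun h' => h ⟨h'.2.1.symm, h'.2.2.symm, h'.1⟩
    have key : ∀ s : Fin N → ℕ, Function.Injective s → ∑ i, ∑ j, ∑ k,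
        (if s j < s i ∧ s k < s i ∧ j ≠ k then
          perm (Equiv.swap i j) (perm (Equiv.swap i k) f) else 0)
        = ∑ i, ∑ j, ∑ k, (if s j < s i ∧ s k < s i ∧ j ≠ k then φ i j k else 0) := by
      intro s hs
      refine Finset.sum_congr rfl fun i _ => Finset.sum_congr rfl fun j _ =>
        Finset.sum_congr rfl fun k _ => ?_
      split_ifs with h
      · refine (if_pos ⟨?_, ?_, h.2.2⟩).symm
        · rintro rfl; exact lt_irrefl _ h.1
        · rintro rfl; exact lt_irrefl _ h.2.1
      · rfl
    rw [key r hr, key _ Fin.val_injective]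
    exact nsmul_right_injective three_ne_zero
      ((three_nsmul_sum_lt hr φ hφ).trans (three_nsmul_sum_lt Fin.val_injective φ hφ).symm)
  rw [e1, e2, e3]

/-- A ranking of the variables in which `i` comes first. -/
def rankFirst (i k : Fin N) : ℕ := if k = i then 0 else k + 1

lemma rankFirst_injective (i : Fin N) : Function.Injective (rankFirst i) := by
  intro a b h
  unfold rankFirst at h
  split_ifs at h with ha hb hb
  · rw [ha, hb]
  · exact Fin.ext (by omega)

lemma cherednik_rankFirst (β : F) (i : Fin N) : cherednik β (rankFirst i) i = dop β i := by
  rw [cherednik, Finset.filter_false_of_mem, Finset.sum_empty, smul_zero, add_zero]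
  intro j _
  simp [rankFirst]

lemma casimirOne_dop [CharZero F] (β : F) (i : Fin N) (f : MvPolynomial (Fin N) F) :
    casimirOne β (dop β i f) = dop β i (casimirOne β f) := by
  have hr := rankFirst_injective i
  rw [← sum_cherednik_eq β hr, ← sum_cherednik_eq β hr, map_sum, ← cherednik_rankFirst]
  exact Finset.sum_congr rfl fun j _ => cherednik_comm β j i (fun h => hr h) f

lemma casimirTwo_dop [CharZero F] (β : F) (i : Fin N) (f : MvPolynomial (Fin N) F) :
    casimirTwo β (dop β i f) = dop β i (casimirTwo β f) := by
  have hr := rankFirst_injective i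
  rw [← sum_cherednik_sq_eq β hr, ← sum_cherednik_sq_eq β hr, map_sum, ← cherednik_rankFirst]
  refine Finset.sum_congr rfl fun j _ => ?_
  rw [cherednik_comm β j i (fun h => hr h) f, cherednik_comm β j i fun h => hr h]

lemma Dlist_of_commute {T : Module.End F (MvPolynomial (Fin N) F)} {β c : F}
    (hT : ∀ i f, T (dop β i f) = dop β i (T f)) {f : MvPolynomial (Fin N) F} (hf : T f = c • f)
    (L : List (Fin N)) (k : ℕ) : T (Dlist β k L f) = c • Dlist β k L f := by
  induction L generalizing k with
  | nil => rw [Dlist_nil, hf]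
  | cons i L ih =>
    rw [Dlist_cons, map_add, hT, map_smul, ih, map_smul, smul_add, smul_comm c]

lemma sum_card_lt_eq_choose (S : Finset (Fin N)) :
    ∑ i ∈ S, (S.filter fun j => j < i).card = S.card.choose 2 := by
  induction S using Finset.induction_on_max with
  | empty => simp
  | insert a S ha ih =>
    have haS : a ∉ S := fun h => lt_irrefl _ (ha a h)
    have h1 : (insert a S).filter (fun j => j < a) = S := by
      rw [Finset.filter_insert, if_neg (lt_irrefl _), Finset.filter_true_of_mem ha]
    have h2 : ∀ i ∈ S, (insert a S).filter (fun j => j < i) = S.filter fun j => j < i := by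
      intro i hi
      rw [Finset.filter_insert, if_neg (ha i hi).not_gt]
    rw [Finset.sum_insert haS, h1, Finset.sum_congr rfl fun i hi => by rw [h2 i hi], ih,
      Finset.card_insert_of_notMem haS, Nat.choose_succ_succ' S.card 1, Nat.choose_one_right]

/-- A ranking of the variables in which the members of `J` come first. -/
def rankBefore (J : Finset (Fin N)) (k : Fin N) : ℕ := if k ∈ J then k else N + k

/-- A ranking of the variables in which the members of `J` come last. -/
def rankAfter (J : Finset (Fin N)) (k : Fin N) : ℕ := if k ∈ J then N + k else k

lemma rankBefore_injective (J : Finset (Fin N)) : Function.Injective (rankBefore J) := by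
  intro a b h
  unfold rankBefore at h
  split_ifs at h <;> exact Fin.ext (by omega)

lemma rankAfter_injective (J : Finset (Fin N)) : Function.Injective (rankAfter J) := by
  intro a b h
  unfold rankAfter at h
  split_ifs at h <;> exact Fin.ext (by omega)

lemma filter_rankBefore_of_mem {J : Finset (Fin N)} {i : Fin N} (hi : i ∈ J) :
    (univ.filter fun j => rankBefore J j < rankBefore J i) = J.filter fun j => j < i := by
  ext j
  simp only [rankBefore, hi, if_true, Finset.mem_filter, Finset.mem_univ, true_and]
  split_ifs with h
  · simp [h]
  · simp only [h, false_and, iff_false]; omega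

lemma filter_rankBefore_of_notMem {J : Finset (Fin N)} {i : Fin N} (hi : i ∉ J) :
    (univ.filter fun j => rankBefore J j < rankBefore J i)
      = J.disjUnion (Jᶜ.filter fun j => j < i)
        (disjoint_compl_right.mono_right (Finset.filter_subset _ _)) := by
  ext j
  simp only [rankBefore, hi, if_false, Finset.mem_filter, Finset.mem_univ, true_and,
    Finset.mem_disjUnion, Finset.mem_compl]
  split_ifs with h
  · simp only [h, true_or, iff_true]; omega
  · simp [h]

lemma filter_rankAfter_of_mem {J : Finset (Fin N)} {i : Fin N} (hi : i ∈ J) :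
    (univ.filter fun j => rankAfter J j < rankAfter J i)
      = Jᶜ.disjUnion (J.filter fun j => j < i)
        (disjoint_compl_left.mono_right (Finset.filter_subset _ _)) := by
  ext j
  simp only [rankAfter, hi, if_true, Finset.mem_filter, Finset.mem_univ, true_and,
    Finset.mem_disjUnion, Finset.mem_compl]
  split_ifs with h
  · simp [h]
  · simp only [h, not_false_eq_true, true_or, iff_true]; omega

lemma filter_rankAfter_of_notMem {J : Finset (Fin N)} {i : Fin N} (hi : i ∉ J) :
    (univ.filter fun j => rankAfter J j < rankAfter J i) = Jᶜ.filter fun j => j < i := by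
  ext j
  simp only [rankAfter, hi, if_false, Finset.mem_filter, Finset.mem_univ, true_and,
    Finset.mem_compl]
  split_ifs with h
  · simp only [h, not_true_eq_false, false_and, iff_false]; omega
  · simp [h]

lemma cherednik_zJ_of_mem (β : F) {J : Finset (Fin N)} {i : Fin N} (hi : i ∈ J)
    (p : MvPolynomial (Fin N) F) :
    cherednik β (rankBefore J) i (zJ J * p) = zJ J * (cherednik β (rankAfter J) i p + p) := by
  rw [cherednik_apply, cherednik_apply, filter_rankBefore_of_mem hi, filter_rankAfter_of_mem hi,
    Finset.sum_disjUnion, dop_zJ_of_mem β hi]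
  have h : ∑ j ∈ J.filter (fun j => j < i), perm (Equiv.swap i j) (zJ J * p)
      = zJ J * ∑ j ∈ J.filter (fun j => j < i), perm (Equiv.swap i j) p := by
    rw [mul_sum]
    refine Finset.sum_congr rfl fun j hj => ?_
    rw [perm_mul, perm_swap_zJ_of_mem hi (Finset.mem_filter.1 hj).1]
  rw [h]
  simp only [smul_eq_C_mul]
  ring

lemma swap_term_of_notMem (β : F) {f : MvPolynomial (Fin N) F} (hf : ∀ σ, perm σ f = f)
    {J : Finset (Fin N)} {i j : Fin N} (hi : i ∉ J) (hj : j ∉ J) :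
    perm (Equiv.swap i j) (term β f J) = term β f J := by
  rw [term, perm_mul, swap_DJ_of_notMem β hf hi hj]
  congr 1
  exact perm_swap_prod hi hj

lemma Vanish.cherednik_term {β : F} {l : ℕ} {f : MvPolynomial (Fin N) F}
    (hf : ∀ σ, perm σ f = f) (h : Vanish β l f) {J : Finset (Fin N)} (hJ : J.card = l)
    {i : Fin N} (hi : i ∉ J) :
    cherednik β (rankBefore J) i (term β f J)
      = (β * ((Jᶜ.filter fun j => j < i).card : F)) • term β f J := by
  rw [cherednik_apply, filter_rankBefore_of_notMem hi, Finset.sum_disjUnion, h.dop_term hJ hi,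
    Finset.sum_congr (s₁ := Jᶜ.filter fun j => j < i) rfl fun j hj => swap_term_of_notMem β hf hi
      (Finset.mem_compl.1 (Finset.mem_filter.1 hj).1), Finset.sum_const, smul_add, neg_smul,
    neg_add_cancel_left, ← Nat.cast_smul_eq_nsmul F, smul_smul]

lemma Vanish.cherednik_DJ {β : F} {l : ℕ} {f : MvPolynomial (Fin N) F}
    (hf : ∀ σ, perm σ f = f) (h : Vanish β l f) {J : Finset (Fin N)} (hJ : J.card = l)
    {i : Fin N} (hi : i ∉ J) :
    cherednik β (rankAfter J) i (DJ β 1 J f)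
      = (β * ((Jᶜ.filter fun j => j < i).card : F)) • DJ β 1 J f := by
  rw [cherednik_apply, filter_rankAfter_of_notMem hi, h.dop_DJ hJ hi,
    Finset.sum_congr rfl fun j hj => swap_DJ_of_notMem β hf hi
      (Finset.mem_compl.1 (Finset.mem_filter.1 hj).1) 1, Finset.sum_const, zero_add,
    ← Nat.cast_smul_eq_nsmul F, smul_smul]

/-- `f` is a simultaneous eigenvector of the first two power sums of the Cherednik operators. -/
def IsEigen (β : F) (f : MvPolynomial (Fin N) F) : Prop :=
  ∃ d c : F, casimirOne β f = d • f ∧ casimirTwo β f = c • f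

lemma Vanish.casimirOne_term [CharZero F] {β d : F} {l : ℕ} {f : MvPolynomial (Fin N) F}
    (hf : ∀ σ, perm σ f = f) (h : Vanish β l f) (hd : casimirOne β f = d • f)
    {J : Finset (Fin N)} (hJ : J.card = l) :
    casimirOne β (term β f J) = (d + l) • term β f J := by
  have hg : casimirOne β (DJ β 1 J f) = d • DJ β 1 J f :=
    Dlist_of_commute (casimirOne_dop β) hd _ _
  rw [← sum_cherednik_eq β (rankAfter_injective J), ← Finset.sum_add_sum_compl J,
    Finset.sum_congr (s₁ := Jᶜ) rfl fun i hi => h.cherednik_DJ hf hJ (Finset.mem_compl.1 hi)] at hg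
  rw [← sum_cherednik_eq β (rankBefore_injective J), ← Finset.sum_add_sum_compl J,
    Finset.sum_congr (s₁ := Jᶜ) rfl fun i hi => h.cherednik_term hf hJ (Finset.mem_compl.1 hi),
    term, Finset.sum_congr rfl fun i hi => cherednik_zJ_of_mem β hi _]
  simp only [← mul_smul_comm, ← mul_sum, ← mul_add, Finset.sum_add_distrib]
  rw [Finset.sum_const, hJ, add_right_comm, hg, ← Nat.cast_smul_eq_nsmul F, add_smul]

lemma Vanish.casimirTwo_term [CharZero F] {β d c : F} {l : ℕ} {f : MvPolynomial (Fin N) F}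
    (hf : ∀ σ, perm σ f = f) (h : Vanish β l f) (hd : casimirOne β f = d • f)
    (hc : casimirTwo β f = c • f) {J : Finset (Fin N)} (hJ : J.card = l) :
    casimirTwo β (term β f J)
      = (c + 2 * (d - β * ((N - l).choose 2 : ℕ)) + l) • term β f J := by
  have hg : casimirOne β (DJ β 1 J f) = d • DJ β 1 J f :=
    Dlist_of_commute (casimirOne_dop β) hd _ _
  have hg2 : casimirTwo β (DJ β 1 J f) = c • DJ β 1 J f :=
    Dlist_of_commute (casimirTwo_dop β) hc _ _
  rw [← sum_cherednik_eq β (rankAfter_injective J), ← Finset.sum_add_sum_compl J,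
    Finset.sum_congr (s₁ := Jᶜ) rfl fun i hi => h.cherednik_DJ hf hJ (Finset.mem_compl.1 hi),
    ← Finset.sum_smul, ← mul_sum, ← Nat.cast_sum, sum_card_lt_eq_choose, Finset.card_compl, hJ,
    Fintype.card_fin] at hg
  rw [← sum_cherednik_sq_eq β (rankAfter_injective J), ← Finset.sum_add_sum_compl J,
    Finset.sum_congr (s₁ := Jᶜ) rfl fun i hi => by
      rw [h.cherednik_DJ hf hJ (Finset.mem_compl.1 hi), map_smul,
        h.cherednik_DJ hf hJ (Finset.mem_compl.1 hi), smul_smul]] at hg2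
  rw [← sum_cherednik_sq_eq β (rankBefore_injective J), ← Finset.sum_add_sum_compl J,
    Finset.sum_congr (s₁ := Jᶜ) rfl fun i hi => by
      rw [h.cherednik_term hf hJ (Finset.mem_compl.1 hi), map_smul,
        h.cherednik_term hf hJ (Finset.mem_compl.1 hi), smul_smul],
    term, Finset.sum_congr rfl fun i hi => by
      rw [cherednik_zJ_of_mem β hi, cherednik_zJ_of_mem β hi, map_add]]
  simp only [← mul_smul_comm, ← mul_sum, ← mul_add, Finset.sum_add_distrib]
  congr 1
  rw [Finset.sum_const, hJ, ← Nat.cast_smul_eq_nsmul F]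
  simp only [smul_eq_C_mul, map_add, map_mul, map_sub, map_ofNat] at hg hg2 ⊢
  linear_combination hg2 + 2 * hg

lemma Vanish.isEigen_bplus [CharZero F] {β : F} {l : ℕ} {f : MvPolynomial (Fin N) F}
    (hf : ∀ σ, perm σ f = f) (h : Vanish β l f) (he : IsEigen β f) :
    IsEigen β (Bplus β l univ f) := by
  obtain ⟨d, c, hd, hc⟩ := he
  refine ⟨d + l, c + 2 * (d - β * ((N - l).choose 2 : ℕ)) + l, ?_, ?_⟩
  · rw [Bplus_eq_sum, map_sum, smul_sum]
    exact Finset.sum_congr rfl fun J hJ =>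
      h.casimirOne_term hf hd (Finset.mem_powersetCard.1 hJ).2
  · rw [Bplus_eq_sum, map_sum, smul_sum]
    exact Finset.sum_congr rfl fun J hJ =>
      h.casimirTwo_term hf hd hc (Finset.mem_powersetCard.1 hJ).2

lemma cherednik_of_symm (β : F) (r : Fin N → ℕ) {f : MvPolynomial (Fin N) F}
    (hf : ∀ σ, perm σ f = f) (i : Fin N) :
    cherednik β r i f = dop β i f + (β * ((univ.filter fun j => r j < r i).card : F)) • f := by
  rw [cherednik_apply, Finset.sum_congr rfl fun j _ => hf _, Finset.sum_const,
    ← Nat.cast_smul_eq_nsmul F, smul_smul]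

lemma isEigen_one (β : F) : IsEigen β (1 : MvPolynomial (Fin N) F) := by
  have h1 : ∀ σ, perm σ (1 : MvPolynomial (Fin N) F) = 1 := fun j => map_one (rename _)
  have hd : ∀ i, dop β i (1 : MvPolynomial (Fin N) F) = 0 := fun i => by
    rw [dop_of_swap_fixed β i fun j => h1 _, pderiv_one, mul_zero]
  set n : Fin N → F := fun i => β * ((univ.filter fun j : Fin N => (j : ℕ) < i).card : F)
  have hY : ∀ i, cherednik β (fun k => (k : ℕ)) i (1 : MvPolynomial (Fin N) F) = n i • 1 :=
    fun i => by rw [cherednik_of_symm β _ h1, hd, zero_add]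
  refine ⟨∑ i, n i, ∑ i, n i * n i, ?_, ?_⟩
  · rw [casimirOne, LinearMap.sum_apply, Finset.sum_smul]
    exact Finset.sum_congr rfl fun i _ => hY i
  · rw [casimirTwo, LinearMap.sum_apply, Finset.sum_smul]
    exact Finset.sum_congr rfl fun i _ => by
      rw [Module.End.mul_apply, hY, map_smul, hY, smul_smul]

lemma IsEigen.sum_dop_sq [CharZero F] {β : F} {f : MvPolynomial (Fin N) F}
    (hf : ∀ σ, perm σ f = f) (he : IsEigen β f) :
    ∃ e : F, ∑ i, dop β i (dop β i f) = e • f := by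
  obtain ⟨d, c, hd, hc⟩ := he
  have h1 : ∃ d' : F, ∑ i, dop β i f = d' • f := by
    rw [casimirOne, LinearMap.sum_apply] at hd
    simp only [cherednik_of_symm β _ hf, Finset.sum_add_distrib] at hd
    rw [← Finset.sum_smul] at hd
    exact ⟨_, (eq_sub_of_add_eq hd).trans (sub_smul _ _ _).symm⟩
  obtain ⟨d', hd'⟩ := h1
  rw [← sum_cherednik_sq_eq β Fin.val_injective, sum_cherednik_sq] at hc
  simp only [hf, Finset.sum_const, ← Nat.cast_smul_eq_nsmul F] at hc
  have h2 : ∃ e : F, ∑ i : Fin N, ∑ j with Fin.val j < Fin.val i, (dop β i f + dop β j f)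
      = e • f := by
    have h3 := two_nsmul_sum_lt Fin.val_injective (fun i j => dop β i f + dop β j f)
      fun i j => add_comm _ _
    have h4 : ∀ i : Fin N, ∑ j with j ≠ i, (dop β i f + dop β j f)
        = ((N : F) - 2) • dop β i f + d' • f := by
      intro i
      rw [Finset.filter_ne', ← hd', ← Finset.add_sum_erase _ _ (Finset.mem_univ i)]
      have h5 := Finset.add_sum_erase univ (fun j => dop β i f + dop β j f) (Finset.mem_univ i)
      rw [← add_right_inj (dop β i f + dop β i f), h5, Finset.sum_add_distrib, Finset.sum_const,
        Finset.card_univ, Fintype.card_fin, ← Nat.cast_smul_eq_nsmul F,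
        ← Finset.add_sum_erase _ _ (Finset.mem_univ i)]
      module
    rw [Finset.sum_congr rfl fun i _ => h4 i, Finset.sum_add_distrib, ← smul_sum, hd',
      Finset.sum_const, ← Nat.cast_smul_eq_nsmul F, ← Nat.cast_smul_eq_nsmul F] at h3
    refine ⟨((2 : ℕ) : F)⁻¹ * (((N : F) - 2) * d' + ((univ : Finset (Fin N)).card : F) * d'), ?_⟩
    rw [mul_smul, add_smul, mul_smul, mul_smul, ← h3, smul_smul, inv_mul_cancel₀, one_smul]
    exact Nat.cast_ne_zero.2 two_ne_zero
  obtain ⟨e, h2⟩ := h2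
  rw [h2] at hc
  simp only [smul_smul, ← Finset.sum_smul] at hc
  exact ⟨_, by rw [eq_sub_of_add_eq (eq_sub_of_add_eq hc), ← sub_smul, ← sub_smul]⟩

/-- The squared Euclidean length of an exponent vector. -/
def sqLength (v : Fin N →₀ ℕ) : ℕ := ∑ k, v k ^ 2

/-- The multiset of entries of an exponent vector. -/
def entries (v : Fin N →₀ ℕ) : Multiset ℕ := univ.val.map v

lemma degree_eq_of_entries {v w : Fin N →₀ ℕ} (h : entries v = entries w) :
    ∑ k, v k = ∑ k, w k := congrArg Multiset.sum h

lemma sqLength_eq_of_entries {v w : Fin N →₀ ℕ} (h : entries v = entries w) :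
    sqLength v = sqLength w := by
  have := congrArg (fun s : Multiset ℕ => (s.map (· ^ 2)).sum) h
  simp only [entries, Multiset.map_map] at this
  exact this

lemma exists_perm_of_entries {v w : Fin N →₀ ℕ} (h : entries v = entries w) :
    ∃ σ : Equiv.Perm (Fin N), ∀ k, w (σ k) = v k := by
  have hc : ∀ a, Nonempty ({k // v k = a} ≃ {k // w k = a}) := fun a => by
    refine Fintype.card_eq.1 ?_
    have := congrArg (Multiset.count a) h
    rw [entries, entries, Multiset.count_map, Multiset.count_map] at this
    rw [Fintype.card_subtype, Fintype.card_subtype]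
    simp only [eq_comm (a := a)] at this
    exact this
  exact ⟨Equiv.ofFiberEquiv fun a => (hc a).some, fun k => Equiv.ofFiberEquiv_map _ k⟩

lemma coeff_perm (σ : Equiv.Perm (Fin N)) (f : MvPolynomial (Fin N) F) (w : Fin N →₀ ℕ) :
    coeff (w.mapDomain σ) (perm σ f) = coeff w f :=
  coeff_rename_mapDomain _ σ.injective _ _

lemma coeff_perm_swap (i j : Fin N) (f : MvPolynomial (Fin N) F) (w : Fin N →₀ ℕ) :
    coeff w (perm (Equiv.swap i j) f) = coeff (w.mapDomain (Equiv.swap i j)) f := by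
  rw [← coeff_perm (Equiv.swap i j) f, ← Finsupp.mapDomain_comp, ← Equiv.coe_trans,
    ← Equiv.Perm.mul_def, Equiv.swap_mul_self, Equiv.Perm.coe_one, Finsupp.mapDomain_id]

lemma coeff_eq_of_entries {f : MvPolynomial (Fin N) F} (hf : ∀ σ, perm σ f = f)
    {v w : Fin N →₀ ℕ} (h : entries v = entries w) : coeff v f = coeff w f := by
  obtain ⟨σ, hσ⟩ := exists_perm_of_entries h
  have : v.mapDomain σ = w := by
    ext k
    rw [Finsupp.mapDomain_equiv_apply, ← hσ, Equiv.apply_symm_apply]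
  rw [← this, ← coeff_perm σ f v, hf]

lemma entries_mapDomain (σ : Equiv.Perm (Fin N)) (v : Fin N →₀ ℕ) :
    entries (v.mapDomain σ) = entries v := by
  have h : (univ : Finset (Fin N)).val.map σ.symm = univ.val :=
    congrArg Finset.val (Finset.map_univ_equiv σ.symm)
  have h2 : (v.mapDomain σ : Fin N → ℕ) = v ∘ σ.symm :=
    funext fun k => Finsupp.mapDomain_equiv_apply v k
  rw [entries, entries, h2, ← Multiset.map_map, h]

lemma coeff_X_mul_pderiv (i : Fin N) (f : MvPolynomial (Fin N) F) (w : Fin N →₀ ℕ) :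
    coeff w (X i * pderiv i f) = (w i : F) * coeff w f := by
  rw [coeff_X_mul']
  split_ifs with h
  · have h1 : 1 ≤ w i := Nat.one_le_iff_ne_zero.2 (Finsupp.mem_support_iff.1 h)
    rw [coeff_pderiv, tsub_add_cancel_of_le (Finsupp.single_le_iff.2 h1), mul_comm]
    simp [Finsupp.tsub_apply, Nat.cast_sub h1]
  · rw [Finsupp.notMem_support_iff.1 h, Nat.cast_zero, zero_mul]

lemma coeff_X_mul_divDiff_of_le {i j : Fin N} (hij : i ≠ j) {f : MvPolynomial (Fin N) F}
    (n : ℕ) : ∀ w : Fin N →₀ ℕ, w i = n → w i ≤ w j →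
      (∀ v : Fin N →₀ ℕ, ∑ k, v k = ∑ k, w k → sqLength w < sqLength v → coeff v f = 0) →
      coeff w (X i * divDiff i j f) = 0 := by
  induction n with
  | zero =>
    intro w hw _ _
    rw [coeff_X_mul', if_neg (Finsupp.notMem_support_iff.2 hw)]
  | succ n ih =>
    intro w hw hle hf
    obtain ⟨v, rfl⟩ : ∃ v, w = Finsupp.single i 1 + v :=
      ⟨w - Finsupp.single i 1,
        (add_tsub_cancel_of_le (Finsupp.single_le_iff.2 (by omega))).symm⟩
    set w' := Finsupp.single j 1 + v with hw'
    have hvi : v i = n := by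
      simp only [Finsupp.add_apply, Finsupp.single_eq_same] at hw
      omega
    have hvj : n + 1 ≤ v j := by
      simpa [Finsupp.single_eq_of_ne hij.symm, hvi, add_comm] using hle
    have hi : w' i = n := by simp [hw', Finsupp.single_eq_of_ne hij, hvi]
    have hj : w' j = v j + 1 := by simp [hw', add_comm]
    have hdeg : ∑ k, w' k = ∑ k, (Finsupp.single i 1 + v : Fin N →₀ ℕ) k := by
      simp [hw', Finset.sum_add_distrib, Finsupp.single_apply]
    have hsq : sqLength (Finsupp.single i 1 + v) < sqLength w' := by
      rw [sqLength, sqLength, ← Finset.add_sum_erase _ _ (Finset.mem_univ i),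
        ← Finset.add_sum_erase _ _ (Finset.mem_erase.2 ⟨hij.symm, Finset.mem_univ j⟩),
        ← Finset.add_sum_erase univ _ (Finset.mem_univ i),
        ← Finset.add_sum_erase (univ.erase i) (fun k => w' k ^ 2)
          (Finset.mem_erase.2 ⟨hij.symm, Finset.mem_univ j⟩), hi, hj]
      have hrest : ∑ k ∈ (univ.erase i).erase j, (Finsupp.single i 1 + v : Fin N →₀ ℕ) k ^ 2
          = ∑ k ∈ (univ.erase i).erase j, w' k ^ 2 := by
        refine Finset.sum_congr rfl fun k hk => ?_
        rw [Finset.mem_erase, Finset.mem_erase] at hk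
        simp [hw', Finsupp.single_eq_of_ne hk.1, Finsupp.single_eq_of_ne hk.2.1]
      rw [hrest, hw]
      simp only [Finsupp.add_apply, Finsupp.single_eq_of_ne hij.symm, zero_add]
      nlinarith
    have hf' : ∀ u : Fin N →₀ ℕ, ∑ k, u k = ∑ k, w' k → sqLength w' ≤ sqLength u →
        coeff u f = 0 := fun u h1 h2 => hf u (h1.trans hdeg) (hsq.trans_le h2)
    have key := congrArg (coeff w') (mul_divDiff i j f)
    have hsw := entries_mapDomain (Equiv.swap i j) w'
    rw [sub_mul, coeff_sub, coeff_sub, coeff_perm_swap, hf' w' rfl le_rfl,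
      hf' _ (degree_eq_of_entries hsw) (sqLength_eq_of_entries hsw).ge,
      ih w' hi (by omega) fun u h1 h2 => hf' u h1 h2.le, hw', coeff_X_mul] at key
    rw [coeff_X_mul]
    simpa using key

lemma divDiff_swap (i j : Fin N) (f : MvPolynomial (Fin N) F) :
    divDiff j i f = - divDiff i j f := by
  rcases eq_or_ne i j with rfl | hij
  · simp [divDiff_self]
  · refine divDiff_eq hij.symm ?_
    rw [Equiv.swap_comm]
    linear_combination - mul_divDiff i j f

lemma coeff_X_mul_divDiff_of_lt {i j : Fin N} {f : MvPolynomial (Fin N) F}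
    {w : Fin N →₀ ℕ} (hlt : w j < w i)
    (hf : ∀ v : Fin N →₀ ℕ, ∑ k, v k = ∑ k, w k → sqLength w < sqLength v → coeff v f = 0) :
    coeff w (X i * divDiff i j f)
      = coeff w f - coeff (w.mapDomain (Equiv.swap i j)) f := by
  have hij : j ≠ i := by rintro rfl; exact lt_irrefl _ hlt
  have h := coeff_X_mul_divDiff_of_le hij _ w rfl hlt.le hf
  rw [divDiff_swap, mul_neg, coeff_neg, neg_eq_zero] at h
  have key := congrArg (coeff w) (mul_divDiff i j f)
  rwa [sub_mul, coeff_sub, coeff_sub, coeff_perm_swap, h, sub_zero] at key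

lemma coeff_dop (β : F) (i : Fin N) (f : MvPolynomial (Fin N) F) (w : Fin N →₀ ℕ) :
    coeff w (dop β i f)
      = (w i : F) * coeff w f + β * ∑ j, coeff w (X i * divDiff i j f) := by
  rw [dop_apply, dunkl_apply, mul_add, coeff_add, coeff_X_mul_pderiv, mul_smul_comm, coeff_smul,
    mul_sum, coeff_sum, smul_eq_mul]

/-- All exponents of `f` have the degree of `μ`, and are either shorter than `μ` or
rearrangements of `μ`. -/
def Below (μ : Fin N →₀ ℕ) (f : MvPolynomial (Fin N) F) : Prop :=
  ∀ v, coeff v f ≠ 0 →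
    ∑ k, v k = ∑ k, μ k ∧ (sqLength v < sqLength μ ∨ entries v = entries μ)

lemma Below.add {μ : Fin N →₀ ℕ} {f g : MvPolynomial (Fin N) F} (hf : Below μ f)
    (hg : Below μ g) : Below μ (f + g) := by
  intro v hv
  by_cases h : coeff v f = 0
  · exact hg v (by simpa [h] using hv)
  · exact hf v h

lemma Below.smul {μ : Fin N →₀ ℕ} {f : MvPolynomial (Fin N) F} (hf : Below μ f) (c : F) :
    Below μ (c • f) := by
  intro v hv
  exact hf v fun h => hv (by simp [h])

lemma Below.coeff_eq_zero {μ : Fin N →₀ ℕ} {f : MvPolynomial (Fin N) F} (hf : Below μ f)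
    {w v : Fin N →₀ ℕ} (hw : ∑ k, w k = ∑ k, μ k → sqLength μ ≤ sqLength w)
    (hd : ∑ k, v k = ∑ k, w k) (hv : sqLength w < sqLength v) : coeff v f = 0 := by
  by_contra h
  obtain ⟨h1, h2 | h2⟩ := hf v h
  · have := hw (hd.symm.trans h1)
    omega
  · have := hw (hd.symm.trans h1)
    have := sqLength_eq_of_entries h2
    omega

lemma Below.dop {μ : Fin N →₀ ℕ} {f : MvPolynomial (Fin N) F} (hf : Below μ f) (β : F)
    (i : Fin N) : Below μ (dop β i f) := by
  intro w hw
  by_contra hcon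
  have hw' : ∀ v, entries v = entries w → coeff v f = 0 := by
    intro v hv
    by_contra h
    have := hf v h
    rw [degree_eq_of_entries hv, sqLength_eq_of_entries hv, hv] at this
    exact hcon this
  have hle : ∑ k, w k = ∑ k, μ k → sqLength μ ≤ sqLength w := by
    intro h
    by_contra h'
    exact hcon ⟨h, Or.inl (not_le.1 h')⟩
  refine hw ?_
  rw [coeff_dop, hw' w rfl, mul_zero, zero_add, Finset.sum_eq_zero, mul_zero]
  intro j _
  rcases eq_or_ne i j with rfl | hij
  · rw [divDiff_self, mul_zero, coeff_zero]
  rcases le_or_gt (w i) (w j) with h | h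
  · exact coeff_X_mul_divDiff_of_le hij _ w rfl h fun v => hf.coeff_eq_zero hle
  · rw [coeff_X_mul_divDiff_of_lt h fun v => hf.coeff_eq_zero hle, hw' w rfl,
      hw' _ (entries_mapDomain _ _), sub_zero]

lemma Below.Dlist {μ : Fin N →₀ ℕ} {f : MvPolynomial (Fin N) F} (hf : Below μ f) (β : F)
    (L : List (Fin N)) (k : ℕ) : Below μ (Dlist β k L f) := by
  induction L generalizing k with
  | nil => rwa [Dlist_nil]
  | cons i L ih =>
    rw [Dlist_cons]
    exact ((ih _).dop β i).add ((ih _).smul _)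

/-- The exponent vector of a squarefree monomial. -/
noncomputable def ind (J : Finset (Fin N)) : Fin N →₀ ℕ := ∑ i ∈ J, Finsupp.single i 1

lemma ind_apply (J : Finset (Fin N)) (k : Fin N) : ind J k = if k ∈ J then 1 else 0 := by
  simp [ind, Finsupp.finsetSum_apply, Finsupp.single_apply]

lemma zJ_eq_monomial (J : Finset (Fin N)) :
    (zJ J : MvPolynomial (Fin N) F) = monomial (ind J) 1 := by
  rw [ind, monomial_sum_one]
  rfl

lemma sum_add_ind (v : Fin N →₀ ℕ) (J : Finset (Fin N)) :
    ∑ k, (v + ind J) k = ∑ k, v k + J.card := by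
  simp [Finset.sum_add_distrib, ind_apply]

lemma sqLength_add_ind (v : Fin N →₀ ℕ) (J : Finset (Fin N)) :
    sqLength (v + ind J) = sqLength v + 2 * ∑ k ∈ J, v k + J.card := by
  have h : ∀ k, (v + ind J) k ^ 2
      = v k ^ 2 + 2 * (if k ∈ J then v k else 0) + if k ∈ J then 1 else 0 := fun k => by
    rw [Finsupp.add_apply, ind_apply]
    split_ifs <;> ring
  simp only [sqLength, h, Finset.sum_add_distrib, ← mul_sum]
  simp

lemma entries_add_ind {v : Fin N →₀ ℕ} {J : Finset (Fin N)} (hv : ∀ k ∉ J, v k = 0) (a : ℕ) :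
    entries (v + a • ind J)
      = (J.val.map v).map (· + a) + Multiset.replicate Jᶜ.card 0 := by
  have hu : (univ : Finset (Fin N)).val = J.val + Jᶜ.val := by
    rw [← Finset.union_compl J, Finset.union_val,
      ← Multiset.add_eq_union_iff_disjoint.2 (Finset.disjoint_val.2 disjoint_compl_right)]
  rw [entries, hu, Multiset.map_add, Multiset.map_map]
  congr 1
  · refine Multiset.map_congr rfl fun k hk => ?_
    simp [ind_apply, show k ∈ J from hk]
  · rw [Finset.card_def, ← Multiset.map_const']
    refine Multiset.map_congr rfl fun k hk => ?_
    have hk : k ∉ J := Finset.mem_compl.1 hk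
    simp [ind_apply, hk, hv k hk]

lemma Below.bplus {μ : Fin N →₀ ℕ} {f : MvPolynomial (Fin N) F} (hf : Below μ f) (β : F)
    {I : Finset (Fin N)} (hI : ∀ k ∉ I, μ k = 0) :
    Below (μ + ind I) (Bplus β I.card univ f) := by
  intro w hw
  rw [Bplus_eq_sum, coeff_sum] at hw
  obtain ⟨J, hJ, hne⟩ := Finset.exists_ne_zero_of_sum_ne_zero hw
  have hJc : J.card = I.card := (Finset.mem_powersetCard.1 hJ).2
  rw [term, zJ_eq_monomial, coeff_monomial_mul', one_mul] at hne
  obtain ⟨hle, hne⟩ := ite_ne_right_iff.1 hne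
  obtain ⟨v, rfl⟩ : ∃ v, w = v + ind J := ⟨w - ind J, (tsub_add_cancel_of_le hle).symm⟩
  rw [add_tsub_cancel_right] at hne
  obtain ⟨hdeg, hlen⟩ := hf.Dlist β _ 1 v hne
  rw [sum_add_ind, sum_add_ind, sqLength_add_ind, sqLength_add_ind, hdeg, hJc]
  refine ⟨rfl, ?_⟩
  have hμ : ∑ k ∈ I, μ k = ∑ k, μ k :=
    Finset.sum_subset (Finset.subset_univ _) fun k _ hk => hI k hk
  have hv : ∑ k ∈ J, v k + ∑ k ∈ Jᶜ, v k = ∑ k, v k := Finset.sum_add_sum_compl _ _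
  rcases Nat.eq_zero_or_pos (∑ k ∈ Jᶜ, v k) with h0 | hpos
  · rcases hlen with hlt | heq
    · left; omega
    · right
      have hv0 : ∀ k ∉ J, v k = 0 := fun k hk =>
        Finset.sum_eq_zero_iff.1 h0 k (Finset.mem_compl.2 hk)
      have hcc : Jᶜ.card = Iᶜ.card := by rw [Finset.card_compl, Finset.card_compl, hJc]
      have e0 := entries_add_ind hv0 0
      rw [zero_smul, add_zero, heq, ← add_zero μ, ← zero_smul ℕ (ind I), entries_add_ind hI,
        hcc, add_left_inj] at e0
      simp only [add_zero, Multiset.map_id'] at e0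
      rw [← one_smul ℕ (ind J), ← one_smul ℕ (ind I), entries_add_ind hv0, entries_add_ind hI, hcc,
        e0]
  · left
    have : sqLength v ≤ sqLength μ := hlen.elim le_of_lt fun h => (sqLength_eq_of_entries h).le
    omega

lemma coeff_bplus (β : F) (f : MvPolynomial (Fin N) F) {μ : Fin N →₀ ℕ} {I : Finset (Fin N)}
    (hI : ∀ k ∉ I, μ k = 0) :
    coeff (μ + ind I) (Bplus β I.card univ f) = coeff μ (DJ β 1 I f) := by
  rw [Bplus_eq_sum, coeff_sum, Finset.sum_eq_single_of_mem I (by simp)]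
  · rw [term, zJ_eq_monomial, coeff_monomial_mul', one_mul, if_pos le_add_self,
      add_tsub_cancel_right]
  · intro J hJ hne
    rw [term, zJ_eq_monomial, coeff_monomial_mul', if_neg]
    intro hle
    refine hne (Finset.eq_of_subset_of_card_le (fun k hk => ?_) (Finset.mem_powersetCard.1 hJ).2.ge)
    by_contra hkI
    have := hle k
    simp [ind_apply, hk, hkI, hI k hkI] at this

/-- The exponent vector with entries given by the initial values of a sequence. -/
noncomputable def vec (N : ℕ) (m : ℕ → ℕ) : Fin N →₀ ℕ :=
  Finsupp.equivFunOnFinite.symm fun k => m k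

lemma vec_apply (m : ℕ → ℕ) (k : Fin N) : vec N m k = m k := rfl

lemma vec_zero : vec N (fun _ => 0) = 0 := Finsupp.ext fun _ => rfl

lemma exists_coeff_Dlist (β : F) {f : MvPolynomial (Fin N) F} (hf : ∀ σ, perm σ f = f)
    {m : ℕ → ℕ} (hm : Antitone m) (hb : Below (vec N m) f) (n : ℕ) (hn : n ≤ N) :
    ∃ L : List (Fin N), L.Nodup ∧ (∀ j : Fin N, j ∈ L ↔ (j : ℕ) < n) ∧
      ∀ k : ℕ, coeff (vec N m) (Dlist β k L f)
        = (∏ t ∈ range n, (((k + t : ℕ) : F) * β + (m (n - 1 - t) : F)))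
          * coeff (vec N m) f := by
  induction n with
  | zero => exact ⟨[], List.nodup_nil, by simp, fun k => by simp [Dlist_nil]⟩
  | succ n ih =>
    obtain ⟨L, hL, hmem, hc⟩ := ih (by omega)
    have hnL : (⟨n, hn⟩ : Fin N) ∉ L := by simp [hmem]
    refine ⟨⟨n, hn⟩ :: L, List.nodup_cons.2 ⟨hnL, hL⟩, fun j => ?_, fun k => ?_⟩
    · rw [List.mem_cons, hmem, Fin.ext_iff]
      simp only
      omega
    · rw [Dlist_cons, coeff_add, coeff_smul, coeff_dop, Finset.sum_eq_zero, hc,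
        Finset.prod_range_succ', vec_apply, smul_eq_mul]
      · have h : ∏ t ∈ range n, (((k + (t + 1) : ℕ) : F) * β + (m (n + 1 - 1 - (t + 1)) : F))
            = ∏ t ∈ range n, (((k + 1 + t : ℕ) : F) * β + (m (n - 1 - t) : F)) :=
          Finset.prod_congr rfl fun t _ => by
            rw [show k + (t + 1) = k + 1 + t by ring,
              show n + 1 - 1 - (t + 1) = n - 1 - t by omega]
        rw [h, add_zero, Nat.add_sub_cancel, Nat.sub_zero]
        ring
      · intro j _
        by_cases hj : j ∈ L
        · refine coeff_X_mul_divDiff_of_le ?_ _ _ rfl ?_ fun v =>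
            (hb.Dlist β L _).coeff_eq_zero fun _ => le_rfl
          · rintro rfl
            exact hnL hj
          · exact hm ((hmem j).1 hj).le
        · rw [divDiff_eq_zero (swap_Dlist_of_notMem β hf hnL hj _), mul_zero, coeff_zero]

/-- The properties propagated by the creation operators: symmetry, vanishing, being an eigenvector,
and having `c` as coefficient at the leading exponent `m`, which has at most `l` parts. -/
structure Leading (β : F) (l : ℕ) (m : ℕ → ℕ) (c : F) (f : MvPolynomial (Fin N) F) : Prop where
  symm : ∀ σ, perm σ f = f
  vanish : Vanish β l f
  isEigen : IsEigen β f
  antitone : Antitone m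
  eq_zero : ∀ j, l ≤ j → m j = 0
  below : Below (vec N m) f
  coeff_eq : coeff (vec N m) f = c

lemma Leading.succ {β : F} {l : ℕ} {m : ℕ → ℕ} {c : F} {f : MvPolynomial (Fin N) F}
    (h : Leading β l m c f) : Leading β (l + 1) m c f :=
  { h with
    vanish := h.vanish.succ h.symm
    eq_zero := fun j hj => h.eq_zero j (by omega) }

lemma leading_one (β : F) : Leading β 0 (fun _ => 0) 1 (1 : MvPolynomial (Fin N) F) where
  symm σ := map_one (rename σ)
  vanish := vanish_one β
  isEigen := isEigen_one β
  antitone := antitone_const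
  eq_zero _ _ := rfl
  below v hv := by
    rw [coeff_one] at hv
    obtain ⟨rfl, -⟩ := ite_ne_right_iff.1 hv
    exact ⟨by rw [vec_zero], Or.inr (by rw [vec_zero])⟩
  coeff_eq := by rw [vec_zero, coeff_zero_one]

lemma Leading.bplus [CharZero F] {β : F} {l : ℕ} {m : ℕ → ℕ} {c : F} {f : MvPolynomial (Fin N) F}
    (h : Leading β l m c f) (hl : l ≤ N) :
    Leading β l (fun j => m j + if j < l then 1 else 0)
      ((∏ t ∈ range l, (((1 + t : ℕ) : F) * β + (m (l - 1 - t) : F))) * c)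
      (Bplus β l univ f) := by
  set I : Finset (Fin N) := univ.filter fun k => (k : ℕ) < l with hI
  have hIc : I.card = l := by
    rw [hI, Fin.card_filter_val_lt, min_eq_right hl]
  have hI0 : ∀ k ∉ I, vec N m k = 0 := fun k hk => h.eq_zero k (by simpa [hI] using hk)
  have hv : vec N (fun j => m j + if j < l then 1 else 0) = vec N m + ind I := by
    ext k
    simp [vec_apply, ind_apply, hI]
  refine ⟨perm_Bplus β l h.symm, h.vanish.bplus h.symm, h.vanish.isEigen_bplus h.symm h.isEigen,
    fun a b hab => add_le_add (h.antitone hab) ?_, fun j hj => ?_, ?_, ?_⟩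
  · split_ifs <;> omega
  · rw [h.eq_zero j hj, if_neg (by omega)]
  · rw [hv]
    simpa only [hIc] using h.below.bplus β hI0
  · rw [hv]
    obtain ⟨L, hL, hmem, hc⟩ := exists_coeff_Dlist β h.symm h.antitone h.below l hl
    have hLI : L.toFinset = I := by ext j; simp [hI, hmem]
    have := coeff_bplus β f hI0
    rwa [hIc, DJ_eq_Dlist β h.symm 1 hL hLI, hc, h.coeff_eq] at this

lemma Leading.iterate_bplus [CharZero F] {β : F} {l : ℕ} {m : ℕ → ℕ} {c : F}
    {f : MvPolynomial (Fin N) F} (h : Leading β l m c f) (hl : l ≤ N) (s : ℕ) :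
    Leading β l (fun j => m j + if j < l then s else 0)
      ((∏ t ∈ range l, (ascPochhammer F s).eval (((1 + t : ℕ) : F) * β + (m (l - 1 - t) : F))) * c)
      ((fun f => Bplus β l univ f)^[s] f) := by
  induction s with
  | zero => simpa using h
  | succ s ih =>
    rw [Function.iterate_succ_apply']
    convert ih.bplus hl using 1
    · funext j
      split_ifs <;> rfl
    · rw [← mul_assoc, ← Finset.prod_mul_distrib]
      congr 1
      refine Finset.prod_congr rfl fun t ht => ?_
      have : l - 1 - t < l := by have := Finset.mem_range.1 ht; omega
      rw [ascPochhammer_succ_eval, if_pos this, Nat.cast_add (m (l - 1 - t))]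
      ring

lemma leading_phiCS [CharZero F] (β : F) {lam : ℕ → ℕ} (hmono : Antitone lam) (i : ℕ) (hi : i ≤ N) :
    Leading β i (fun j => lam j - lam i)
      (∏ k ∈ Finset.Icc 1 i, ∏ m ∈ Finset.Icc 1 k,
        (ascPochhammer F (lam (k - 1) - lam k)).eval
          ((m : F) * β + ((lam (k - m) : F) - (lam (k - 1) : F))))
      (phiCS β N lam i) := by
  induction i with
  | zero =>
    have : (fun j => lam j - lam 0) = fun _ => 0 :=
      funext fun j => Nat.sub_eq_zero_of_le (hmono (Nat.zero_le j))
    simpa [this, phiCS] using leading_one (N := N) β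
  | succ i ih =>
    rw [phiCS]
    convert (ih (by omega)).succ.iterate_bplus hi (lam i - lam (i + 1)) using 1
    · funext j
      split_ifs with h
      · have := hmono (Nat.lt_succ_iff.1 h)
        have := hmono (show i ≤ i + 1 by omega)
        omega
      · have := hmono (not_lt.1 h)
        have := hmono (show i ≤ j by omega)
        omega
    · rw [Finset.prod_Icc_succ_top (by omega), mul_comm]
      congr 1
      rw [← Finset.Ico_add_one_right_eq_Icc, Finset.prod_Ico_eq_prod_range]
      refine Finset.prod_congr (by simp) fun t ht => ?_
      rw [show i + 1 - (1 + t) = i + 1 - 1 - t by omega, Nat.add_sub_cancel,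
        Nat.cast_sub (hmono (by omega))]

lemma Aop_eq {i j : Fin N} (hij : i ≠ j) {f : MvPolynomial (Fin N) F}
    (hf : perm (Equiv.swap i j) f = f) :
    Aop i j f = (X i + X j) * divDiff i j (X i * pderiv i f) := by
  refine divExact_eq (X_sub_X_ne_zero hij) ?_
  have h := mul_divDiff i j (X i * pderiv i f)
  rw [perm_mul, perm_X, perm_pderiv, Equiv.swap_apply_left, hf] at h
  linear_combination - (X i + X j) * h

lemma divDiff_symm {i j : Fin N} {f : MvPolynomial (Fin N) F}
    (hf : perm (Equiv.swap i j) f = f) :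
    divDiff j i (X j * pderiv j f) = divDiff i j (X i * pderiv i f) := by
  rcases eq_or_ne i j with rfl | hij
  · rfl
  refine divDiff_eq hij.symm ?_
  have h := mul_divDiff i j (X i * pderiv i f)
  rw [perm_mul, perm_X, perm_pderiv, Equiv.swap_apply_left, hf] at h
  rw [Equiv.swap_comm, perm_mul, perm_X, perm_pderiv, Equiv.swap_apply_right, hf]
  linear_combination h

lemma sum_sum_eq_sum_lt {M : Type*} [AddCommMonoid M] (ψ : Fin N → Fin N → M)
    (h : ∀ i, ψ i i = 0) :
    ∑ i, ∑ j, ψ i j = ∑ i, ∑ j with i < j, (ψ i j + ψ j i) := by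
  have hc : ∑ i, ∑ j with i < j, ψ j i = ∑ i, ∑ j with j < i, ψ i j :=
    Finset.sum_comm' (by simp)
  simp only [Finset.sum_add_distrib]
  rw [hc, ← Finset.sum_add_distrib]
  refine Finset.sum_congr rfl fun i _ => ?_
  rw [← Finset.sum_filter_add_sum_filter_not univ (fun j => i < j)]
  congr 1
  symm
  refine Finset.sum_subset (fun j hj => by simpa using (Finset.mem_filter.1 hj).2.le)
    fun j hj hj' => ?_
  have : j = i := le_antisymm (by simpa using hj) (by simpa using hj')
  rw [this, h]

lemma Hop_eq_sum_dop_sq (β : F) {f : MvPolynomial (Fin N) F} (hf : ∀ σ, perm σ f = f) :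
    Hop β univ f = ∑ i, dop β i (dop β i f) := by
  simp only [dop_of_swap_fixed β _ fun j => hf _]
  simp only [dop_apply, dunkl_apply, mul_add, mul_smul_comm, Finset.sum_add_distrib, ← smul_sum,
    mul_sum]
  rw [Hop, sum_sum_eq_sum_lt _ fun i => by rw [divDiff_self, mul_zero]]
  congr 2
  refine Finset.sum_congr rfl fun i _ => Finset.sum_congr rfl fun j hj => ?_
  rw [Aop_eq (Finset.mem_filter.1 hj).2.ne (hf _), divDiff_symm (hf _), add_mul]

lemma coeff_sum_dop_sq (β : F) {u : MvPolynomial (Fin N) F} (hu : ∀ σ, perm σ u = u)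
    {ν : Fin N →₀ ℕ} (hν : ∀ v, coeff v u ≠ 0 → sqLength v ≤ sqLength ν) :
    coeff ν (∑ i, dop β i (dop β i u))
      = (((sqLength ν : ℕ) : F) + ((∑ i, ∑ j, (ν i - ν j) : ℕ) : F) * β) * coeff ν u := by
  have hd : ∀ i, dop β i u = X i * pderiv i u := fun i => dop_of_swap_fixed β i fun j => hu _
  have hz : ∀ i v, sqLength ν < sqLength v → coeff v (X i * pderiv i u) = 0 := by
    intro i v hv
    rw [coeff_X_mul_pderiv]
    by_contra h
    exact hv.not_ge (hν v (right_ne_zero_of_mul h))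
  have hc : ∀ i j, coeff ν (X i * divDiff i j (X i * pderiv i u))
      = ((ν i - ν j : ℕ) : F) * coeff ν u := by
    intro i j
    rcases eq_or_ne i j with rfl | hij
    · rw [divDiff_self, mul_zero, coeff_zero, Nat.sub_self, Nat.cast_zero, zero_mul]
    rcases le_or_gt (ν i) (ν j) with h | h
    · rw [coeff_X_mul_divDiff_of_le hij _ ν rfl h fun v _ => hz i v, Nat.sub_eq_zero_of_le h,
        Nat.cast_zero, zero_mul]
    · rw [coeff_X_mul_divDiff_of_lt h fun v _ => hz i v, coeff_X_mul_pderiv, coeff_X_mul_pderiv,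
        Finsupp.mapDomain_equiv_apply, Equiv.symm_swap, Equiv.swap_apply_left,
        coeff_eq_of_entries hu (entries_mapDomain (Equiv.swap i j) ν), Nat.cast_sub h.le]
      ring
  simp only [coeff_sum, hd, coeff_dop, coeff_X_mul_pderiv, hc, Finset.sum_add_distrib, ← mul_sum,
    ← Finset.sum_mul, sqLength, Nat.cast_sum, Nat.cast_pow]
  simp only [← mul_assoc, ← sq, ← Finset.sum_mul]
  ring

lemma eigenvalue_eq (β : F) {u : MvPolynomial (Fin N) F} (hu : ∀ σ, perm σ u = u) {e : F}
    (he : ∑ i, dop β i (dop β i u) = e • u) {ν : Fin N →₀ ℕ}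
    (hν : ∀ v, coeff v u ≠ 0 → sqLength v ≤ sqLength ν) (h0 : coeff ν u ≠ 0) :
    e = ((sqLength ν : ℕ) : F) + ((∑ i, ∑ j, (ν i - ν j) : ℕ) : F) * β := by
  have h := congrArg (coeff ν) he
  rw [coeff_sum_dop_sq β hu hν, coeff_smul, smul_eq_mul] at h
  exact (mul_right_cancel₀ h0 h).symm

lemma coeff_msym (mu : Fin N → ℕ) (w : Fin N →₀ ℕ) [Decidable (∃ σ : Equiv.Perm (Fin N),
    (fun i => mu (σ i)) = w)] :
    coeff w (msym N mu : MvPolynomial (Fin N) F)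
      = if ∃ σ : Equiv.Perm (Fin N), (fun i => mu (σ i)) = w then 1 else 0 := by
  have hm : ∀ v : Fin N → ℕ, (∏ i, X i ^ v i : MvPolynomial (Fin N) F)
      = monomial (Finsupp.equivFunOnFinite.symm v) 1 := fun v => by
    rw [monomial_eq, C_1, one_mul, Finsupp.prod_fintype _ _ fun i => pow_zero _]
    rfl
  have hv : ∀ v : Fin N → ℕ, Finsupp.equivFunOnFinite.symm v = w ↔ v = w := fun v =>
    ⟨fun h => by rw [← h]; rfl, fun h => by rw [h]; ext; rfl⟩
  simp only [msym, hm, coeff_sum, coeff_monomial, hv]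
  rw [Finset.sum_ite_eq']
  simp only [Finset.mem_image, Finset.mem_univ, true_and]

lemma coeff_msym_of_entries {mu : Fin N → ℕ} {w : Fin N →₀ ℕ}
    (h : entries w = entries (Finsupp.equivFunOnFinite.symm mu)) :
    coeff w (msym N mu : MvPolynomial (Fin N) F) = 1 := by
  classical
  obtain ⟨σ, hσ⟩ := exists_perm_of_entries h
  rw [coeff_msym, if_pos ⟨σ, funext hσ⟩]

lemma entries_of_coeff_msym {mu : Fin N → ℕ} {w : Fin N →₀ ℕ}
    (h : coeff w (msym N mu : MvPolynomial (Fin N) F) ≠ 0) :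
    entries w = entries (Finsupp.equivFunOnFinite.symm mu) := by
  classical
  rw [coeff_msym] at h
  obtain ⟨⟨σ, hσ⟩, -⟩ := ite_ne_right_iff.1 h
  rw [← entries_mapDomain σ]
  congr 1
  ext k
  rw [Finsupp.mapDomain_equiv_apply, ← congrFun hσ, Equiv.apply_symm_apply]
  rfl

lemma mul_sum_le_sum_mul {a d : ℕ → ℤ} (ha : Antitone a) (n : ℕ)
    (hd : ∀ k ≤ n, 0 ≤ ∑ i ∈ range k, d i) :
    a n * ∑ i ∈ range n, d i ≤ ∑ i ∈ range n, a i * d i := by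
  induction n with
  | zero => simp
  | succ n ih =>
    have h1 := ih fun k hk => hd k (by omega)
    have h2 := mul_le_mul_of_nonneg_right (ha (Nat.le_succ n)) (hd (n + 1) le_rfl)
    rw [Finset.sum_range_succ (fun i => a i * d i)]
    rw [Finset.sum_range_succ] at h2 ⊢
    linarith

lemma sum_sq_lt_of_dominated {mu : Fin N → ℕ} {lam : ℕ → ℕ} (hmu : ∀ a b, a ≤ b → mu b ≤ mu a)
    (hdom : ∀ k : ℕ, ∑ i ∈ univ.filter (fun i : Fin N => (i : ℕ) < k), mu i
      ≤ ∑ i ∈ univ.filter (fun i : Fin N => (i : ℕ) < k), lam i)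
    (hne : mu ≠ fun i : Fin N => lam i) :
    ∑ i, mu i ^ 2 < ∑ i : Fin N, lam i ^ 2 := by
  set a : ℕ → ℤ := fun k => if h : k < N then (mu ⟨k, h⟩ : ℤ) else 0 with ha
  have haN : ∀ i : Fin N, a i = mu i := fun i => by simp [ha]
  have hanti : Antitone a := by
    intro k l hkl
    simp only [ha]
    split_ifs with h1 h2
    · exact_mod_cast hmu _ _ (show (⟨k, h2⟩ : Fin N) ≤ ⟨l, h1⟩ from hkl)
    · omega
    · positivity
    · rfl
  have hsum : ∀ k ≤ N, 0 ≤ ∑ i ∈ range k, ((lam i : ℤ) - a i) := by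
    intro k hk
    have h : ∑ i ∈ range k, ((lam i : ℤ) - a i)
        = ∑ i ∈ univ.filter (fun i : Fin N => (i : ℕ) < k), ((lam i : ℤ) - mu i) := by
      rw [Finset.sum_filter]
      simp only [← haN]
      rw [Fin.sum_univ_eq_sum_range (fun i => if i < k then (lam i : ℤ) - a i else 0),
        ← Finset.sum_filter]
      refine Finset.sum_congr ?_ fun _ _ => rfl
      ext i
      simp only [Finset.mem_range, Finset.mem_filter]
      omega
    rw [h, Finset.sum_sub_distrib, sub_nonneg]
    exact_mod_cast hdom k
  have hab := mul_sum_le_sum_mul hanti N hsum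
  rw [show a N = 0 by simp [ha], zero_mul,
    ← Fin.sum_univ_eq_sum_range (fun i => a i * ((lam i : ℤ) - a i))] at hab
  simp only [haN] at hab
  obtain ⟨i, hi⟩ := Function.ne_iff.1 hne
  have hpos : 0 < ∑ i : Fin N, ((lam i : ℤ) - mu i) ^ 2 :=
    Finset.sum_pos' (fun _ _ => sq_nonneg _) ⟨i, Finset.mem_univ i, by
      have : (lam i : ℤ) - mu i ≠ 0 := sub_ne_zero.2 fun h => hi (by exact_mod_cast h.symm)
      positivity⟩
  have hexp : ∑ i : Fin N, (lam i : ℤ) ^ 2 = ∑ i, (mu i : ℤ) ^ 2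
      + 2 * ∑ i : Fin N, (mu i : ℤ) * ((lam i : ℤ) - mu i)
      + ∑ i : Fin N, ((lam i : ℤ) - mu i) ^ 2 := by
    rw [mul_sum, ← Finset.sum_add_distrib, ← Finset.sum_add_distrib]
    exact Finset.sum_congr rfl fun i _ => by ring
  have : ∑ i, (mu i : ℤ) ^ 2 < ∑ i : Fin N, (lam i : ℤ) ^ 2 := by linarith
  exact_mod_cast this

lemma eq_zero_of_transcendental [CharZero F] {β : F} (hβ : Transcendental ℚ β) {a b : ℤ}
    (h : (b : F) * β + a = 0) : a = 0 ∧ b = 0 := by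
  have h0 := transcendental_iff.1 hβ (Polynomial.C (b : ℚ) * Polynomial.X + Polynomial.C (a : ℚ))
    (by simpa using h)
  have h1 := congrArg (Polynomial.coeff · 0) h0
  have h2 := congrArg (Polynomial.coeff · 1) h0
  simp only [Polynomial.coeff_add, Polynomial.coeff_C_mul, Polynomial.coeff_X_zero,
    Polynomial.coeff_C_zero, Polynomial.coeff_zero, mul_zero, zero_add, Polynomial.coeff_X_one,
    mul_one, Polynomial.coeff_C_succ, add_zero, Int.cast_eq_zero] at h1 h2
  exact ⟨h1, h2⟩

lemma eval_ascPochhammer_ne_zero {x : F} (hx : ∀ s : ℕ, x + s ≠ 0) (n : ℕ) :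
    (ascPochhammer F n).eval x ≠ 0 := by
  induction n with
  | zero => simp
  | succ n ih =>
    rw [ascPochhammer_succ_eval]
    exact mul_ne_zero ih (hx n)

lemma prod_ascPochhammer_ne_zero [CharZero F] {β : F} (hβ : Transcendental ℚ β) (lam : ℕ → ℕ)
    (n : ℕ) :
    ∏ k ∈ Finset.Icc 1 n, ∏ m ∈ Finset.Icc 1 k,
        (ascPochhammer F (lam (k - 1) - lam k)).eval
          ((m : F) * β + ((lam (k - m) : F) - (lam (k - 1) : F))) ≠ 0 := by
  refine Finset.prod_ne_zero_iff.2 fun k _ => Finset.prod_ne_zero_iff.2 fun m hm =>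
    eval_ascPochhammer_ne_zero (fun s h => ?_) _
  have := (eq_zero_of_transcendental hβ (b := m) (a := lam (k - m) - lam (k - 1) + s)
    (by push_cast; linear_combination h)).2
  have := (Finset.mem_Icc.1 hm).1
  omega

lemma sqLength_lt_of_mem_span {lam : ℕ → ℕ} {g : MvPolynomial (Fin N) F}
    (hg : g ∈ Submodule.span F {p : MvPolynomial (Fin N) F |
      ∃ mu : Fin N → ℕ,
        (∀ a b : Fin N, a ≤ b → mu b ≤ mu a) ∧
        (∑ i, mu i = ∑ i : Fin N, lam (i : ℕ)) ∧
        (∀ k : ℕ, ∑ i ∈ Finset.univ.filter (fun i : Fin N => (i : ℕ) < k), mu i ≤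
          ∑ i ∈ Finset.univ.filter (fun i : Fin N => (i : ℕ) < k), lam (i : ℕ)) ∧
        mu ≠ (fun i : Fin N => lam (i : ℕ)) ∧
        p = msym N mu}) (v : Fin N →₀ ℕ) (hv : coeff v g ≠ 0) :
    sqLength v < sqLength (vec N lam) := by
  induction hg using Submodule.span_induction with
  | mem p hp =>
    obtain ⟨mu, hmu, -, hdom, hne, rfl⟩ := hp
    rw [sqLength_eq_of_entries (entries_of_coeff_msym hv)]
    exact sum_sq_lt_of_dominated hmu hdom hne
  | zero => exact absurd (coeff_zero v) hv
  | add p q _ _ hp hq =>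
    by_cases h : coeff v p = 0
    · exact hq (by simpa [h] using hv)
    · exact hp h
  | smul c p _ hp => exact hp fun h => hv (by simp [h])

end RodriguesJack

/-- Rodrigues formula for Jack polynomials: for a generic `β` and any
partition `λ = (λ_1 ≥ … ≥ λ_{N-1} ≥ 0)` (`lam` 0-indexed, `lam (k-1) = λ_k`, `λ_N = 0`),
the Jack polynomial `J_λ(z; 1/β)` — i.e. the symmetric polynomial of the form
`m_λ + ∑_{μ < λ} v_{λμ} m_μ` that is an eigenfunction of `H` — equals
`c_λ⁻¹ (B⁺_{N-1})^{λ_{N-1}} ⋯ (B⁺_1)^{λ_1-λ_2} · 1` where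
`c_λ = ∏_{k=1}^{N-1} ∏_{m=1}^{k} (mβ + λ_{k+1-m} - λ_k)_{λ_k - λ_{k+1}}`. -/
theorem statement_1 {F : Type*} [Field F] [CharZero F] {N : ℕ} (β : F)
    (hβ : Transcendental ℚ β)
    (lam : ℕ → ℕ) (hmono : ∀ a b : ℕ, a ≤ b → lam b ≤ lam a)
    (hzero : ∀ j, N - 1 ≤ j → lam j = 0)
    (Jlam g : MvPolynomial (Fin N) F) (hSym : Jlam.IsSymmetric)
    (hg : g ∈ Submodule.span F {p : MvPolynomial (Fin N) F |
      ∃ mu : Fin N → ℕ,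
        (∀ a b : Fin N, a ≤ b → mu b ≤ mu a) ∧
        (∑ i, mu i = ∑ i : Fin N, lam (i : ℕ)) ∧
        (∀ k : ℕ, ∑ i ∈ Finset.univ.filter (fun i : Fin N => (i : ℕ) < k), mu i ≤
          ∑ i ∈ Finset.univ.filter (fun i : Fin N => (i : ℕ) < k), lam (i : ℕ)) ∧
        mu ≠ (fun i : Fin N => lam (i : ℕ)) ∧
        p = msym N mu})
    (hJ : Jlam = msym N (fun i : Fin N => lam (i : ℕ)) + g)
    (e : F) (hEig : Hop β Finset.univ Jlam = e • Jlam) :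
    Jlam = (∏ k ∈ Finset.Icc 1 (N - 1), ∏ m ∈ Finset.Icc 1 k,
        (ascPochhammer F (lam (k - 1) - lam k)).eval
          ((m : F) * β + ((lam (k - m) : F) - (lam (k - 1) : F))))⁻¹
      • phiCS β N lam (N - 1) := by
  set c := ∏ k ∈ Finset.Icc 1 (N - 1), ∏ m ∈ Finset.Icc 1 k,
        (ascPochhammer F (lam (k - 1) - lam k)).eval
          ((m : F) * β + ((lam (k - m) : F) - (lam (k - 1) : F))) with hc
  have hc0 : c ≠ 0 := RodriguesJack.prod_ascPochhammer_ne_zero hβ lam (N - 1)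
  have hlead := RodriguesJack.leading_phiCS β hmono (N - 1) (Nat.sub_le N 1)
  rw [← hc] at hlead
  simp only [hzero (N - 1) le_rfl, Nat.sub_zero] at hlead
  set φ := phiCS β N lam (N - 1)
  set μ := RodriguesJack.vec N lam with hμ
  have hJsymm : ∀ σ, RodriguesJack.perm σ Jlam = Jlam := hSym
  have hgt : ∀ v, coeff v g ≠ 0 → RodriguesJack.sqLength v < RodriguesJack.sqLength μ :=
    RodriguesJack.sqLength_lt_of_mem_span hg
  have hJorbit : ∀ v, RodriguesJack.entries v = RodriguesJack.entries μ → coeff v Jlam = 1 := by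
    intro v hv
    rw [hJ, coeff_add, RodriguesJack.coeff_msym_of_entries hv, add_eq_left]
    by_contra h
    exact (hgt v h).ne (RodriguesJack.sqLength_eq_of_entries hv)
  have hJbelow : ∀ v, coeff v Jlam ≠ 0 → RodriguesJack.sqLength v < RodriguesJack.sqLength μ ∨
      RodriguesJack.entries v = RodriguesJack.entries μ := by
    intro v hv
    by_cases h : coeff v g = 0
    · rw [hJ, coeff_add, h, add_zero] at hv
      exact Or.inr (RodriguesJack.entries_of_coeff_msym hv)
    · exact Or.inl (hgt v h)
  have hle : ∀ v, RodriguesJack.sqLength v < RodriguesJack.sqLength μ ∨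
      RodriguesJack.entries v = RodriguesJack.entries μ →
      RodriguesJack.sqLength v ≤ RodriguesJack.sqLength μ := fun v h =>
    h.elim le_of_lt fun h => (RodriguesJack.sqLength_eq_of_entries h).le
  rw [RodriguesJack.Hop_eq_sum_dop_sq β hJsymm] at hEig
  obtain ⟨e', he'⟩ := hlead.isEigen.sum_dop_sq hlead.symm
  have hφe := RodriguesJack.eigenvalue_eq β hlead.symm he'
    (fun v hv => hle v (hlead.below v hv).2) (by rwa [hlead.coeff_eq])
  have hJe := RodriguesJack.eigenvalue_eq β hJsymm hEig
    (fun v hv => hle v (hJbelow v hv)) (by rw [hJorbit _ rfl]; exact one_ne_zero)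
  have hδ : φ - c • Jlam = 0 := by
    by_contra hne
    obtain ⟨ν, hν, hmax⟩ := Finset.exists_max_image (φ - c • Jlam).support
      RodriguesJack.sqLength (support_nonempty.2 hne)
    have hν0 := mem_support_iff.1 hν
    have hδsymm : ∀ σ, RodriguesJack.perm σ (φ - c • Jlam) = φ - c • Jlam := fun σ => by
      rw [map_sub, map_smul, hlead.symm, hJsymm]
    have hδe : ∑ i, RodriguesJack.dop β i (RodriguesJack.dop β i (φ - c • Jlam))
        = e • (φ - c • Jlam) := by
      simp only [map_sub, map_smul, Finset.sum_sub_distrib, ← smul_sum]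
      rw [he', hEig, hφe, ← hJe, smul_sub, smul_comm]
    have hνe := RodriguesJack.eigenvalue_eq β hδsymm hδe
      (fun v hv => hmax v (mem_support_iff.2 hv)) hν0
    have hlen : RodriguesJack.sqLength ν = RodriguesJack.sqLength μ := by
      have := (RodriguesJack.eq_zero_of_transcendental hβ
        (a := RodriguesJack.sqLength ν - RodriguesJack.sqLength μ)
        (b := (∑ i, ∑ j, (ν i - ν j) : ℕ) - (∑ i, ∑ j, (μ i - μ j) : ℕ))
        (by
          rw [Int.cast_sub, Int.cast_sub, Int.cast_natCast, Int.cast_natCast, Int.cast_natCast,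
            Int.cast_natCast]
          linear_combination hJe - hνe)).1
      omega
    have horbit : RodriguesJack.entries ν ≠ RodriguesJack.entries μ := fun h => hν0 <| by
      rw [coeff_sub, coeff_smul, hJorbit ν h, RodriguesJack.coeff_eq_of_entries hlead.symm h,
        hlead.coeff_eq, smul_eq_mul, mul_one, sub_self]
    rw [coeff_sub, coeff_smul] at hν0
    by_cases h : coeff ν φ = 0
    · refine (hJbelow ν fun h' => hν0 ?_).elim hlen.not_lt horbit
      rw [h, h', smul_zero, sub_zero]
    · exact (hlead.below ν h).2.elim hlen.not_lt horbit
  rw [sub_eq_zero.1 hδ, smul_smul, inv_mul_cancel₀ hc0, one_smul]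
end

section
/- For every partition λ = (λ_1 ≥ … ≥ λ_{N−1} ≥ 0), the polynomial φ_λ = (B⁺_{N−1})^{λ_{N−1}} (B⁺_{N−2})^{λ_{N−2}−λ_{N−1}} ⋯ (B⁺_1)^{λ_1−λ_2} · 1 satisfies H φ_λ = ( Σ_{j=1}^{N−1} ( λ_j² + β(N+1−2j) λ_j ) ) φ_λ. -/
open MvPolynomial Finset

/-- Operators `D k` and `M J` on a representation `ρ` of the permutation group that satisfy the
relations of the Dunkl operators `z_k ∇_k` and of multiplication by `z_J`. -/
structure IsDunklSystem {F V ι : Type*} [Field F] [AddCommGroup V] [Module F V] [Fintype ι]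
    [DecidableEq ι] (β : F) (ρ : Equiv.Perm ι →* Module.End F V) (D : ι → Module.End F V)
    (M : Finset ι → Module.End F V) : Prop where
  perm_mul_op : ∀ σ k, ρ σ * D k = D (σ k) * ρ σ
  op_comm : ∀ i j, i ≠ j →
    D i * D j = D j * D i + β • ((D j - D i) * ρ (Equiv.swap i j))
  perm_mul_mult : ∀ σ J, ρ σ * M J = M (J.map σ.toEmbedding) * ρ σ
  op_mul_mult_of_mem : ∀ J, ∀ k ∈ J,
    D k * M J = M J * (D k + 1 + β • ∑ l ∈ Jᶜ, ρ (Equiv.swap k l))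
  op_mul_mult_of_notMem : ∀ J, ∀ k ∉ J,
    D k * M J = M J * D k - β • ∑ l ∈ J, ρ (Equiv.swap k l) * M J

namespace IsDunklSystem

section Operators

variable {F V ι : Type*} [Field F] [AddCommGroup V] [Module F V] [Fintype ι] [DecidableEq ι]

/-- The product `(D j₁ + kβ)(D j₂ + (k+1)β) ⋯` along a list. -/
def listProd (β : F) (D : ι → Module.End F V) : ℕ → List ι → Module.End F V
  | _, [] => 1
  | k, j :: l => (D j + ((k : F) * β) • 1) * listProd β D (k + 1) l

/-- The Cherednik-type operator `D j + β ∑_{m ∉ S} K_{jm}`. -/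
def hat (β : F) (ρ : Equiv.Perm ι →* Module.End F V) (D : ι → Module.End F V) (S : Finset ι)
    (j : ι) : Module.End F V :=
  D j + β • ∑ m ∈ Sᶜ, ρ (Equiv.swap j m)

/-- The Cherednik operators attached to the suffixes of a list. -/
def hats (β : F) (ρ : Equiv.Perm ι →* Module.End F V) (D : ι → Module.End F V) :
    List ι → List (Module.End F V)
  | [] => []
  | j :: l => hat β ρ D (j :: l).toFinset j :: hats β ρ D l

/-- The product of `Y - c` over the Cherednik operators `Y` attached to a list. -/
def hatProd (β : F) (ρ : Equiv.Perm ι →* Module.End F V) (D : ι → Module.End F V) (c : F)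
    (l : List ι) : Module.End F V :=
  ((hats β ρ D l).map (fun Y => Y - c • 1)).prod

end Operators

variable {F V ι : Type*} [Field F] [AddCommGroup V] [Module F V] [Fintype ι] [DecidableEq ι]
  {β : F} {ρ : Equiv.Perm ι →* Module.End F V} {D : ι → Module.End F V}
  {M : Finset ι → Module.End F V}

theorem perm_op (h : IsDunklSystem β ρ D M) (σ : Equiv.Perm ι) (k : ι) (x : V) :
    ρ σ (D k x) = D (σ k) (ρ σ x) :=
  LinearMap.congr_fun (h.perm_mul_op σ k) x

theorem perm_listProd (h : IsDunklSystem β ρ D M) (σ : Equiv.Perm ι) (k : ℕ) (l : List ι) (x : V) :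
    ρ σ (listProd β D k l x) = listProd β D k (l.map σ) (ρ σ x) := by
  induction l generalizing k with
  | nil => rfl
  | cons j l ih => simp [listProd, h.perm_op, ih]

omit [Fintype ι] in
theorem map_swap_eq {l : List ι} {a b : ι} (ha : a ∉ l) (hb : b ∉ l) :
    l.map (Equiv.swap a b) = l := by
  conv_rhs => rw [← List.map_id l]
  refine List.map_congr_left fun m hm => Equiv.swap_apply_of_ne_of_ne ?_ ?_
  · rintro rfl; exact ha hm
  · rintro rfl; exact hb hm

theorem swap_listProd (h : IsDunklSystem β ρ D M) {f : V} (hf : ∀ σ, ρ σ f = f) {a b : ι}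
    {l : List ι} (ha : a ∉ l) (hb : b ∉ l) (k : ℕ) :
    ρ (Equiv.swap a b) (listProd β D k l f) = listProd β D k l f := by
  rw [h.perm_listProd, map_swap_eq ha hb, hf]

theorem op_comm_apply (h : IsDunklSystem β ρ D M) {i j : ι} (hij : i ≠ j) (x : V) :
    D i (D j x) = D j (D i x) + β • (D j (ρ (Equiv.swap i j) x) - D i (ρ (Equiv.swap i j) x)) :=
  LinearMap.congr_fun (h.op_comm i j hij) x

theorem listProd_perm (h : IsDunklSystem β ρ D M) {f : V} (hf : ∀ σ, ρ σ f = f) {l l' : List ι}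
    (hl : l.Perm l') (hn : l.Nodup) (k : ℕ) : listProd β D k l f = listProd β D k l' f := by
  induction hl generalizing k with
  | nil => rfl
  | cons x _ ih => simp [listProd, ih hn.of_cons]
  | swap a b l =>
    simp only [List.nodup_cons, List.mem_cons, not_or] at hn
    obtain ⟨⟨hab, hb⟩, ha, -⟩ := hn
    have hG := h.swap_listProd hf hb ha (k + 1 + 1)
    have := h.op_comm_apply hab (listProd β D (k + 1 + 1) l f)
    rw [hG] at this
    simp only [listProd, Module.End.mul_apply, LinearMap.add_apply, LinearMap.smul_apply,
      Module.End.one_apply, map_add, map_smul, this]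
    push_cast
    module
  | trans h1 h2 ih1 ih2 => rw [ih1 hn, ih2 (h1.nodup_iff.1 hn)]

theorem listProd_concat (h : IsDunklSystem β ρ D M) {f : V} (hf : ∀ σ, ρ σ f = f) {l : List ι}
    {b : ι} (hn : (b :: l).Nodup) (k : ℕ) :
    listProd β D k (l ++ [b]) f = D b (listProd β D k l f) +
      β • (l.map fun m => ρ (Equiv.swap b m) (listProd β D k l f)).sum +
      ((k : F) * β) • listProd β D k l f := by
  induction l generalizing k with
  | nil => simp [listProd]
  | cons a l ih =>
    simp only [List.nodup_cons, List.mem_cons, not_or] at hn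
    obtain ⟨⟨hba, hb⟩, ha, hl⟩ := hn
    have hG := h.swap_listProd hf ha hb (k + 1)
    have hc := h.op_comm_apply (Ne.symm hba) (listProd β D (k + 1) l f)
    have hG' : ρ (Equiv.swap b a) (listProd β D (k + 1) l f) = listProd β D (k + 1) l f := by
      rwa [Equiv.swap_comm]
    have e1 : (l.map fun m => ρ (Equiv.swap b m) (listProd β D k (a :: l) f)).sum =
        D a (l.map fun m => ρ (Equiv.swap b m) (listProd β D (k + 1) l f)).sum +
        ((k : F) * β) • (l.map fun m => ρ (Equiv.swap b m) (listProd β D (k + 1) l f)).sum := by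
      rw [map_list_sum, List.smul_sum, List.map_map, List.map_map, ← List.sum_map_add]
      refine congrArg List.sum (List.map_congr_left fun m hm => ?_)
      have : Equiv.swap b m a = a :=
        Equiv.swap_apply_of_ne_of_ne (Ne.symm hba) (by rintro rfl; exact ha hm)
      simp [listProd, h.perm_op, this]
    have e2 : ρ (Equiv.swap b a) (listProd β D k (a :: l) f) =
        D b (listProd β D (k + 1) l f) + ((k : F) * β) • listProd β D (k + 1) l f := by
      simp [listProd, h.perm_op, hG']
    rw [List.map_cons, List.sum_cons, e1, e2, List.cons_append]
    simp only [listProd, Module.End.mul_apply, LinearMap.add_apply, LinearMap.smul_apply,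
      Module.End.one_apply, map_add, map_smul, hc, hG, ih (List.nodup_cons.2 ⟨hb, hl⟩)]
    push_cast
    module

theorem listProd_eq_zero_of_length_eq (h : IsDunklSystem β ρ D M) {f : V} (hf : ∀ σ, ρ σ f = f)
    {n : ℕ} (h0 : ∀ l : List ι, l.Nodup → l.length = n → listProd β D 0 l f = 0) (l : List ι)
    (hn : l.Nodup) (hl : l.length = n + 1) : listProd β D 0 l f = 0 := by
  obtain rfl | ⟨l', b, rfl⟩ := l.eq_nil_or_concat'
  · simp at hl
  · have hn' : (b :: l').Nodup := by
      rwa [← List.concat_eq_append, List.nodup_concat, ← List.nodup_cons] at hn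
    rw [h.listProd_concat hf hn', h0 l' hn'.of_cons (by simpa using hl)]
    simp

theorem hat_apply (S : Finset ι) (j : ι) (x : V) :
    hat β ρ D S j x = D j x + β • ∑ m ∈ Sᶜ, ρ (Equiv.swap j m) x := by
  simp [hat, LinearMap.sum_apply]

omit [Fintype ι] in
theorem perm_swap_apply (σ : Equiv.Perm ι) (a b : ι) (x : V) :
    ρ σ (ρ (Equiv.swap a b) x) = ρ (Equiv.swap (σ a) (σ b)) (ρ σ x) := by
  rw [← Module.End.mul_apply, ← map_mul, ← Module.End.mul_apply, ← map_mul]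
  congr 2
  ext m
  simp [Equiv.swap_apply_def, apply_ite σ]

theorem perm_hat (h : IsDunklSystem β ρ D M) (σ : Equiv.Perm ι) (S : Finset ι) (j : ι) (x : V) :
    ρ σ (hat β ρ D S j x) = hat β ρ D (S.map σ.toEmbedding) (σ j) (ρ σ x) := by
  have : (S.map σ.toEmbedding)ᶜ = Sᶜ.map σ.toEmbedding := by
    ext m
    simp
  simp [hat_apply, h.perm_op, this, perm_swap_apply]

omit [Fintype ι] in
theorem map_swap_finset_eq {S : Finset ι} {a b : ι} (hab : a ∈ S ↔ b ∈ S) :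
    S.map (Equiv.swap a b).toEmbedding = S := by
  ext m
  rw [Finset.mem_map_equiv, Equiv.symm_swap, Equiv.swap_apply_def]
  split_ifs with h1 h2 <;> simp_all

theorem commute_hat_op (h : IsDunklSystem β ρ D M) {S : Finset ι} {j k : ι} (hj : j ∈ S)
    (hk : k ∉ S) : Commute (D k) (hat β ρ D S j) := by
  have hkj : k ≠ j := by rintro rfl; exact hk hj
  rw [commute_iff_eq, hat, ← Finset.add_sum_erase _ _ (Finset.mem_compl.2 hk)]
  have hs : Commute (D k) (∑ m ∈ Sᶜ.erase k, ρ (Equiv.swap j m)) := by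
    refine Commute.sum_right _ _ _ fun m hm => ?_
    have := h.perm_mul_op (Equiv.swap j m) k
    rw [Equiv.swap_apply_of_ne_of_ne hkj (Finset.ne_of_mem_erase hm).symm] at this
    exact this.symm
  have h1 := h.perm_mul_op (Equiv.swap j k) k
  have h2 := h.op_comm k j hkj
  rw [Equiv.swap_apply_right] at h1
  rw [Equiv.swap_comm] at h2
  rw [mul_add, add_mul, mul_smul_comm, smul_mul_assoc, mul_add, add_mul, hs.eq, h1, h2, sub_mul]
  module

theorem commute_hat_swap (h : IsDunklSystem β ρ D M) {S : Finset ι} {j a b : ι} (hj : j ∈ S)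
    (ha : a ∉ S) (hb : b ∉ S) : Commute (ρ (Equiv.swap a b)) (hat β ρ D S j) := by
  refine LinearMap.ext fun x => ?_
  have := h.perm_hat (Equiv.swap a b) S j x
  rw [map_swap_finset_eq (by simp [ha, hb]), Equiv.swap_apply_of_ne_of_ne] at this
  · exact this
  · rintro rfl; exact ha hj
  · rintro rfl; exact hb hj

theorem commute_hats_op (h : IsDunklSystem β ρ D M) {l : List ι} {k : ι} (hk : k ∉ l) :
    ∀ Y ∈ hats β ρ D l, Commute (D k) Y := by
  induction l with
  | nil => simp [hats]
  | cons a l ih =>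
    simp only [hats, List.mem_cons, forall_eq_or_imp]
    exact ⟨h.commute_hat_op (by simp) (by simpa using hk), ih fun h => hk (.tail _ h)⟩

theorem commute_hats_swap (h : IsDunklSystem β ρ D M) {l : List ι} {a b : ι} (ha : a ∉ l)
    (hb : b ∉ l) : ∀ Y ∈ hats β ρ D l, Commute (ρ (Equiv.swap a b)) Y := by
  induction l with
  | nil => simp [hats]
  | cons c l ih =>
    simp only [hats, List.mem_cons, forall_eq_or_imp]
    exact ⟨h.commute_hat_swap (by simp) (by simpa using ha) (by simpa using hb),
      ih (fun h => ha (.tail _ h)) fun h => hb (.tail _ h)⟩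

theorem commute_hat_hats (h : IsDunklSystem β ρ D M) {l : List ι} {a : ι} {S : Finset ι}
    (hS : ∀ m ∈ l, m ∈ S) (ha : a ∉ l) : ∀ Y ∈ hats β ρ D l, Commute (hat β ρ D S a) Y := by
  intro Y hY
  refine (h.commute_hats_op ha Y hY).add_left (Commute.smul_left ?_ _)
  refine Commute.sum_left _ _ _ fun m hm => h.commute_hats_swap ha (fun hml => ?_) Y hY
  exact Finset.mem_compl.1 hm (hS m hml)

theorem commute_hats (h : IsDunklSystem β ρ D M) {l : List ι} (hl : l.Nodup) :
    ∀ Y ∈ hats β ρ D l, ∀ Z ∈ hats β ρ D l, Commute Y Z := by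
  induction l with
  | nil => simp [hats]
  | cons a l ih =>
    rw [List.nodup_cons] at hl
    have hc := h.commute_hat_hats (S := (a :: l).toFinset) (a := a) (l := l)
      (fun m hm => by simp [hm]) hl.1
    simp only [hats, List.mem_cons, forall_eq_or_imp]
    exact ⟨⟨Commute.refl _, hc⟩, fun Y hY => ⟨(hc Y hY).symm, ih hl.2 Y hY⟩⟩

theorem hats_subset_append (l l' : List ι) : hats β ρ D l' ⊆ hats β ρ D (l ++ l') := by
  induction l with
  | nil => simp
  | cons a l ih => exact fun Y hY => List.mem_cons_of_mem _ (ih hY)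

theorem commute_hatProd {X : Module.End F V} {l : List ι} (hX : ∀ Y ∈ hats β ρ D l, Commute X Y)
    (c : F) : Commute X (hatProd β ρ D c l) := by
  refine Commute.list_prod_right _ _ fun Y hY => ?_
  obtain ⟨Z, hZ, rfl⟩ := List.mem_map.1 hY
  exact (hX Z hZ).sub_right ((Commute.one_right X).smul_right c)

theorem hatProd_cons (c : F) (a : ι) (l : List ι) :
    hatProd β ρ D c (a :: l) =
      (hat β ρ D (a :: l).toFinset a - c • 1) * hatProd β ρ D c l := by
  simp [hatProd, hats]

theorem swap_hat_singleton (h : IsDunklSystem β ρ D M) (a b : ι) (x : V) :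
    ρ (Equiv.swap a b) (hat β ρ D {a} a x) = hat β ρ D {b} b (ρ (Equiv.swap a b) x) := by
  simp [h.perm_hat]

theorem hat_apply_of_subset {S J : Finset ι} (hS : S ⊆ J) (j : ι) (x : V) :
    hat β ρ D S j x = hat β ρ D J j x + β • ∑ m ∈ J \ S, ρ (Equiv.swap j m) x := by
  have : Sᶜ = Jᶜ ∪ J \ S := by
    ext m
    have := @hS m
    simp only [Finset.mem_union, Finset.mem_compl, Finset.mem_sdiff]
    tauto
  rw [hat_apply, hat_apply, this, Finset.sum_union, smul_add, add_assoc]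
  rw [Finset.disjoint_left]
  simp +contextual

theorem hat_singleton_apply {a : ι} {l : List ι} (hl : (a :: l).Nodup) (x : V) :
    hat β ρ D {a} a x = hat β ρ D (a :: l).toFinset a x +
      β • ∑ m ∈ l.toFinset, ρ (Equiv.swap a m) x := by
  have ha : a ∉ l.toFinset := by simpa using (List.nodup_cons.1 hl).1
  rw [hat_apply_of_subset (J := (a :: l).toFinset) (by simp), List.toFinset_cons,
    Finset.sdiff_singleton_eq_erase, Finset.erase_insert ha]

theorem hatProd_eq_zero (h : IsDunklSystem β ρ D M) {c : F} {l : List ι} (hl : l.Nodup) {j : ι}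
    (hj : j ∈ l) {x : V} (hx : hat β ρ D {j} j x = c • x) : hatProd β ρ D c l x = 0 := by
  induction l generalizing j x with
  | nil => simp at hj
  | cons a l ih =>
    have hal := List.nodup_cons.1 hl
    rw [hatProd_cons, Module.End.mul_apply]
    by_cases hjl : j ∈ l
    · rw [ih hal.2 hjl hx, map_zero]
    · obtain rfl : j = a := by simpa [hjl] using hj
      have hc := commute_hatProd (h.commute_hat_hats (S := (j :: l).toFinset) (a := j) (l := l)
        (fun m hm => by simp [hm]) hal.1) c
      have hc' := hc.sub_left ((Commute.one_left (hatProd β ρ D c l)).smul_left c)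
      rw [← Module.End.mul_apply, hc'.eq, Module.End.mul_apply]
      rw [hat_singleton_apply hl] at hx
      have : (hat β ρ D (j :: l).toFinset j - c • (1 : Module.End F V)) x =
          -(β • ∑ m ∈ l.toFinset, ρ (Equiv.swap j m) x) := by
        simp [← hx]
      rw [this, map_neg, map_smul, map_sum, Finset.sum_eq_zero, smul_zero, neg_zero]
      intro m hm
      refine ih hal.2 (List.mem_toFinset.1 hm) ?_
      rw [← h.swap_hat_singleton, hat_singleton_apply hl, hx, map_smul]

theorem hatProd_eq_listProd (h : IsDunklSystem β ρ D M) {f : V} (hf : ∀ σ, ρ σ f = f) {c : F}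
    {l : List ι} (hl : l.Nodup) (k : ℕ)
    (hc : c = ((Fintype.card ι : F) - (l.length : F) - (k : F)) * β) :
    hatProd β ρ D c l f = listProd β D k l f := by
  induction l generalizing k with
  | nil => rfl
  | cons a l ih =>
    have hal := List.nodup_cons.1 hl
    rw [hatProd_cons, Module.End.mul_apply,
      ih hal.2 (k + 1) (by rw [hc]; push_cast [List.length_cons]; ring)]
    have hs : ∑ m ∈ (a :: l).toFinsetᶜ, ρ (Equiv.swap a m) (listProd β D (k + 1) l f) =
        ((Fintype.card ι : F) - ((l.length : F) + 1)) • listProd β D (k + 1) l f := by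
      rw [Finset.sum_congr rfl fun m hm => h.swap_listProd hf hal.1 (b := m) (by simp_all) (k + 1),
        Finset.sum_const, Finset.card_compl, List.toFinset_card_of_nodup hl, ← Nat.cast_smul_eq_nsmul F,
        Nat.cast_sub, List.length_cons, Nat.cast_succ]
      rw [← List.toFinset_card_of_nodup hl]
      exact Finset.card_le_univ _
    rw [listProd, LinearMap.sub_apply, hat_apply, hs, hc]
    simp only [Module.End.mul_apply, LinearMap.add_apply, LinearMap.smul_apply,
      Module.End.one_apply]
    push_cast [List.length_cons]
    module

theorem swap_hat_block (h : IsDunklSystem β ρ D M) {J : Finset ι} {a b : ι} (ha : a ∈ J)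
    (hb : b ∈ J) (x : V) :
    ρ (Equiv.swap a b) (hat β ρ D J a x) = hat β ρ D J b (ρ (Equiv.swap a b) x) := by
  rw [h.perm_hat, map_swap_finset_eq (by simp [ha, hb]), Equiv.swap_apply_left]

theorem hat_cons_apply {J : Finset ι} {g : V}
    (hg : ∀ a ∈ J, ∀ b ∈ J, ρ (Equiv.swap a b) g = g) {a : ι} {l : List ι} (hl : (a :: l).Nodup)
    (hJ : ∀ m ∈ a :: l, m ∈ J) :
    hat β ρ D (a :: l).toFinset a g =
      hat β ρ D J a g + (β * ((J.card : F) - 1 - (l.length : F))) • g := by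
  have hsub : (a :: l).toFinset ⊆ J := fun m hm => hJ m (by simpa using hm)
  rw [hat_apply_of_subset hsub, Finset.sum_congr rfl fun m hm =>
    hg a (hJ a (by simp)) m (Finset.mem_sdiff.1 hm).1, Finset.sum_const,
    Finset.card_sdiff_of_subset hsub, ← Nat.cast_smul_eq_nsmul F,
    Nat.cast_sub (Finset.card_le_card hsub), List.toFinset_card_of_nodup hl, List.length_cons]
  push_cast
  module

theorem sum_hats_apply {J : Finset ι} {g : V}
    (hg : ∀ a ∈ J, ∀ b ∈ J, ρ (Equiv.swap a b) g = g) {l : List ι} (hl : l.Nodup)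
    (hJ : ∀ m ∈ l, m ∈ J) :
    (hats β ρ D l).sum g = ∑ j ∈ l.toFinset, hat β ρ D J j g +
      (β * ∑ r ∈ range l.length, ((J.card : F) - 1 - (r : F))) • g := by
  induction l with
  | nil => simp [hats]
  | cons a l ih =>
    have ha : a ∉ l.toFinset := by simpa using (List.nodup_cons.1 hl).1
    rw [hats, List.sum_cons, LinearMap.add_apply, hat_cons_apply hg hl hJ,
      ih hl.of_cons fun m hm => hJ m (.tail _ hm), List.toFinset_cons, Finset.sum_insert ha,
      List.length_cons, Finset.sum_range_succ]
    module

theorem sum_sq_hats_apply (h : IsDunklSystem β ρ D M) {J : Finset ι} {g : V}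
    (hg : ∀ a ∈ J, ∀ b ∈ J, ρ (Equiv.swap a b) g = g) {d : F}
    (hd : ∑ j ∈ J, hat β ρ D J j g = d • g) {l : List ι} (hl : l.Nodup)
    (hJ : ∀ m ∈ l, m ∈ J) :
    ((hats β ρ D l).map fun Y => Y * Y).sum g =
      ∑ j ∈ l.toFinset, hat β ρ D J j (hat β ρ D J j g) +
      (β * ((J.card : F) - 1 - (l.length : F))) • ∑ j ∈ l.toFinset, hat β ρ D J j g +
      (β * (l.length : F) * d +
        β ^ 2 * ∑ r ∈ range l.length, ((J.card : F) - 1 - (r : F)) ^ 2) • g := by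
  induction l with
  | nil => simp [hats]
  | cons a l ih =>
    have ha : a ∉ l.toFinset := by simpa using (List.nodup_cons.1 hl).1
    have hsub : (a :: l).toFinset ⊆ J := fun m hm => hJ m (by simpa using hm)
    have hsw : ∑ m ∈ J \ (a :: l).toFinset, ρ (Equiv.swap a m) (hat β ρ D J a g) =
        d • g - hat β ρ D J a g - ∑ j ∈ l.toFinset, hat β ρ D J j g := by
      rw [Finset.sum_congr rfl fun m hm => h.swap_hat_block (hJ a (by simp))
        (Finset.mem_sdiff.1 hm).1 g, Finset.sum_congr rfl fun m hm => by
          rw [hg a (hJ a (by simp)) m (Finset.mem_sdiff.1 hm).1], ← hd,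
        ← Finset.sum_sdiff hsub, List.toFinset_cons, Finset.sum_insert ha]
      abel
    rw [hats, List.map_cons, List.sum_cons, LinearMap.add_apply, Module.End.mul_apply,
      hat_cons_apply hg hl hJ, map_add, map_smul, hat_cons_apply hg hl hJ,
      hat_apply_of_subset hsub a (hat β ρ D J a g), hsw,
      ih hl.of_cons fun m hm => hJ m (.tail _ hm), List.toFinset_cons, Finset.sum_insert ha,
      Finset.sum_insert ha, List.length_cons, Finset.sum_range_succ]
    push_cast
    module

theorem hat_append_apply {l l' : List ι} {g : V} (hn : (l ++ l').Nodup)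
    (hg : ∀ a ∉ l', ∀ b ∉ l', ρ (Equiv.swap a b) g = g) {a : ι} (hD : D a g = 0)
    (ha : a ∉ l ++ l') :
    hat β ρ D (a :: (l ++ l')).toFinset a g =
      (β * ((Fintype.card ι : F) - (l'.length : F) - 1 - (l.length : F))) • g := by
  have hn' : (a :: (l ++ l')).Nodup := List.nodup_cons.2 ⟨ha, hn⟩
  have hle := (a :: (l ++ l')).toFinset.card_le_univ
  rw [hat_apply, hD, Finset.sum_congr rfl fun m hm => hg a (by simp_all) m (by simp_all),
    Finset.sum_const, Finset.card_compl, ← Nat.cast_smul_eq_nsmul F, Nat.cast_sub hle,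
    List.toFinset_card_of_nodup hn', List.length_cons, List.length_append]
  push_cast
  module

theorem sum_hats_append_apply {l l' : List ι} {g : V} (hn : (l ++ l').Nodup)
    (hg : ∀ a ∉ l', ∀ b ∉ l', ρ (Equiv.swap a b) g = g) (hD : ∀ a ∈ l, D a g = 0) :
    (hats β ρ D (l ++ l')).sum g = (hats β ρ D l').sum g +
      (β * ∑ r ∈ range l.length, ((Fintype.card ι : F) - (l'.length : F) - 1 - (r : F))) • g := by
  induction l with
  | nil => simp
  | cons a l ih =>
    rw [List.cons_append, List.nodup_cons] at hn
    rw [List.cons_append, hats, List.sum_cons, LinearMap.add_apply,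
      hat_append_apply hn.2 hg (hD a (by simp)) hn.1, ih hn.2 fun b hb => hD b (.tail _ hb),
      List.length_cons, Finset.sum_range_succ]
    module

theorem sum_sq_hats_append_apply {l l' : List ι} {g : V} (hn : (l ++ l').Nodup)
    (hg : ∀ a ∉ l', ∀ b ∉ l', ρ (Equiv.swap a b) g = g) (hD : ∀ a ∈ l, D a g = 0) :
    ((hats β ρ D (l ++ l')).map fun Y => Y * Y).sum g = ((hats β ρ D l').map fun Y => Y * Y).sum g +
      (β ^ 2 * ∑ r ∈ range l.length,
        ((Fintype.card ι : F) - (l'.length : F) - 1 - (r : F)) ^ 2) • g := by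
  induction l with
  | nil => simp
  | cons a l ih =>
    rw [List.cons_append, List.nodup_cons] at hn
    rw [List.cons_append, hats, List.map_cons, List.sum_cons, LinearMap.add_apply,
      Module.End.mul_apply, hat_append_apply hn.2 hg (hD a (by simp)) hn.1, map_smul,
      hat_append_apply hn.2 hg (hD a (by simp)) hn.1, ih hn.2 fun b hb => hD b (.tail _ hb),
      List.length_cons, Finset.sum_range_succ]
    module

theorem two_mul_sum_range_sub {R : Type*} [CommRing R] (x : R) (n : ℕ) :
    2 * ∑ r ∈ range n, (x - (r : R)) = 2 * n * x - n * (n - 1) := by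
  induction n with
  | zero => simp
  | succ n ih => rw [Finset.sum_range_succ, mul_add, ih]; push_cast; ring

theorem sum_range_add_sub {R : Type*} [CommRing R] (m n : ℕ) :
    ∑ r ∈ range (m + n), ((m : R) + n - 1 - r) =
      ∑ r ∈ range m, ((m : R) - 1 - r) + ∑ r ∈ range n, ((n : R) - 1 - r) + m * n := by
  have h1 : ∑ r ∈ range m, ((m : R) + n - 1 - r) = ∑ r ∈ range m, ((m : R) - 1 - r) + m * n := by
    rw [Finset.sum_congr rfl fun (r : ℕ) _ => show (m : R) + n - 1 - (r : R) = (m - 1 - r) + n by ring,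
      Finset.sum_add_distrib]
    simp
  rw [Finset.sum_range_add, add_right_comm, h1]
  congr 1
  exact Finset.sum_congr rfl fun r _ => by push_cast; ring

theorem sum_range_add_sub_sq {R : Type*} [CommRing R] (m n : ℕ) :
    ∑ r ∈ range (m + n), ((m : R) + n - 1 - r) ^ 2 =
      ∑ r ∈ range m, ((m : R) - 1 - r) ^ 2 + ∑ r ∈ range n, ((n : R) - 1 - r) ^ 2 +
        (m : R) * n * (m + n - 1) := by
  have h2 := two_mul_sum_range_sub ((m : R) - 1) m
  have h1 : ∑ r ∈ range m, ((m : R) + n - 1 - r) ^ 2 =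
      ∑ r ∈ range m, ((m : R) - 1 - r) ^ 2 + (m : R) * n * (m + n - 1) := by
    rw [Finset.sum_congr rfl fun (r : ℕ) _ => show ((m : R) + n - 1 - (r : R)) ^ 2 =
      (m - 1 - r) ^ 2 + (n * (2 * (m - 1 - r)) + n ^ 2) by ring,
      Finset.sum_add_distrib, Finset.sum_add_distrib, ← Finset.mul_sum, ← Finset.mul_sum, h2]
    simp
    ring
  rw [Finset.sum_range_add, add_right_comm, h1]
  congr 1
  exact Finset.sum_congr rfl fun r _ => by push_cast; ring

section Raising

variable (β D M)

/-- `D_{1,J}` as an operator. -/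
noncomputable def setProd (J : Finset ι) : Module.End F V :=
  listProd β D 1 J.toList

/-- The creation operator `∑_{|J| = i} M J ∘ D_{1,J}`. -/
noncomputable def raise (i : ℕ) : Module.End F V :=
  ∑ J ∈ (univ : Finset ι).powersetCard i, M J * setProd β D J

end Raising

theorem perm_setProd (h : IsDunklSystem β ρ D M) {f : V} (hf : ∀ σ, ρ σ f = f)
    (σ : Equiv.Perm ι) (J : Finset ι) :
    ρ σ (setProd β D J f) = setProd β D (J.map σ.toEmbedding) f := by
  rw [setProd, setProd, h.perm_listProd, hf]
  refine h.listProd_perm hf ?_ (J.nodup_toList.map σ.injective) 1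
  refine List.perm_of_nodup_nodup_toFinset_eq (J.nodup_toList.map σ.injective)
    (Finset.nodup_toList _) ?_
  ext m
  simp [Finset.mem_map_equiv, ← Equiv.eq_symm_apply]

theorem swap_setProd (h : IsDunklSystem β ρ D M) {f : V} (hf : ∀ σ, ρ σ f = f) {J : Finset ι}
    {a b : ι} (hab : a ∈ J ↔ b ∈ J) :
    ρ (Equiv.swap a b) (setProd β D J f) = setProd β D J f := by
  rw [h.perm_setProd hf, map_swap_finset_eq hab]

theorem perm_mult_setProd (h : IsDunklSystem β ρ D M) {f : V} (hf : ∀ σ, ρ σ f = f)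
    (σ : Equiv.Perm ι) (J : Finset ι) :
    ρ σ (M J (setProd β D J f)) =
      M (J.map σ.toEmbedding) (setProd β D (J.map σ.toEmbedding) f) := by
  rw [← h.perm_setProd hf]
  exact LinearMap.congr_fun (h.perm_mul_mult σ J) _

omit [Fintype ι] [DecidableEq ι] in
theorem op_setProd {f : V} {i : ℕ}
    (h0 : ∀ l : List ι, l.Nodup → l.length = i + 1 → listProd β D 0 l f = 0) {J : Finset ι}
    (hJ : J.card = i) {k : ι} (hk : k ∉ J) : D k (setProd β D J f) = 0 := by
  have := h0 (k :: J.toList) (List.nodup_cons.2 ⟨by simpa using hk, J.nodup_toList⟩) (by simp [hJ])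
  simpa [listProd, setProd] using this

omit [DecidableEq ι] in
theorem raise_apply (i : ℕ) (f : V) :
    raise β D M i f = ∑ J ∈ (univ : Finset ι).powersetCard i, M J (setProd β D J f) := by
  simp [raise, LinearMap.sum_apply]

theorem perm_raise (h : IsDunklSystem β ρ D M) {f : V} (hf : ∀ σ, ρ σ f = f) (i : ℕ)
    (σ : Equiv.Perm ι) : ρ σ (raise β D M i f) = raise β D M i f := by
  rw [raise_apply, map_sum, Finset.sum_congr rfl fun J _ => h.perm_mult_setProd hf σ J]
  refine Finset.sum_nbij' (fun J => J.map σ.toEmbedding) (fun J => J.map σ.symm.toEmbedding)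
    ?_ ?_ ?_ ?_ ?_
  · simp [Finset.mem_powersetCard]
  · simp [Finset.mem_powersetCard]
  · intro J _; ext m; simp
  · intro J _; ext m; simp
  · intro J _; rfl

theorem op_mult_of_mem (h : IsDunklSystem β ρ D M) {J : Finset ι} {k : ι} (hk : k ∈ J) (g : V) :
    D k (M J g) = M J (hat β ρ D J k g + g) := by
  have := LinearMap.congr_fun (h.op_mul_mult_of_mem J k hk) g
  simp only [Module.End.mul_apply] at this
  rw [this, hat]
  congr 1
  simp only [LinearMap.add_apply, Module.End.one_apply]
  abel

theorem hat_compl_mult (h : IsDunklSystem β ρ D M) {J : Finset ι} {k : ι} (hk : k ∉ J) {g : V}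
    (hg : D k g = 0) : hat β ρ D Jᶜ k (M J g) = 0 := by
  have := LinearMap.congr_fun (h.op_mul_mult_of_notMem J k hk) g
  simp only [Module.End.mul_apply, LinearMap.sub_apply, hg, LinearMap.smul_apply,
    LinearMap.sum_apply, map_zero, zero_sub] at this
  rw [hat_apply, compl_compl, this, neg_add_cancel]

theorem hat_singleton_mult (h : IsDunklSystem β ρ D M) {f : V} (hf : ∀ σ, ρ σ f = f) {i : ℕ}
    (h0 : ∀ l : List ι, l.Nodup → l.length = i + 1 → listProd β D 0 l f = 0) {J : Finset ι}
    (hJ : J.card = i) {k : ι} (hk : k ∉ J) :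
    hat β ρ D {k} k (M J (setProd β D J f)) =
      (((Fintype.card ι : F) - (i : F) - 1) * β) • M J (setProd β D J f) := by
  have hsub : {k} ⊆ Jᶜ := by simpa using hk
  have hle := Finset.card_le_card hsub
  rw [hat_apply_of_subset hsub, h.hat_compl_mult hk (op_setProd h0 hJ hk), zero_add,
    Finset.sum_congr rfl fun m hm => by
      rw [h.perm_mult_setProd hf, map_swap_finset_eq (by simp_all)],
    Finset.sum_const, Finset.card_sdiff_of_subset hsub, ← Nat.cast_smul_eq_nsmul F,
    Nat.cast_sub hle, Finset.card_compl, Nat.cast_sub J.card_le_univ, hJ, Finset.card_singleton]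
  push_cast
  module

theorem sum_sum_swap_mult (h : IsDunklSystem β ρ D M) {f : V} (hf : ∀ σ, ρ σ f = f) (i : ℕ)
    (k : ι) :
    ∑ J ∈ (univ : Finset ι).powersetCard i with k ∉ J,
        ∑ l ∈ J, ρ (Equiv.swap k l) (M J (setProd β D J f)) =
      ((Fintype.card ι : F) - (i : F)) •
        ∑ J ∈ (univ : Finset ι).powersetCard i with k ∈ J, M J (setProd β D J f) := by
  have e : ∀ J ∈ ((univ : Finset ι).powersetCard i).filter (k ∈ ·),
      ((Fintype.card ι : F) - (i : F)) • M J (setProd β D J f) =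
        ∑ _l ∈ Jᶜ, M J (setProd β D J f) := by
    intro J hJ
    have hJ' : J.card = i := by simp_all [Finset.mem_powersetCard]
    rw [Finset.sum_const, Finset.card_compl, ← Nat.cast_smul_eq_nsmul F,
      Nat.cast_sub J.card_le_univ, hJ']
  rw [Finset.smul_sum, Finset.sum_congr rfl e, Finset.sum_sigma', Finset.sum_sigma']
  have inv : ∀ (J : Finset ι) (l : ι), (J.map (Equiv.swap k l).toEmbedding).map
      (Equiv.swap k l).toEmbedding = J := by
    intro J l
    rw [Finset.map_map]
    ext m
    simp
  refine Finset.sum_nbij' (fun p => ⟨p.1.map (Equiv.swap k p.2).toEmbedding, p.2⟩)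
    (fun p => ⟨p.1.map (Equiv.swap k p.2).toEmbedding, p.2⟩) ?_ ?_ ?_ ?_ ?_
  · rintro ⟨J, l⟩
    simp +contextual [Finset.mem_powersetCard, Finset.mem_map_equiv]
  · rintro ⟨J, l⟩
    simp +contextual [Finset.mem_powersetCard, Finset.mem_map_equiv]
  · rintro ⟨J, l⟩ _
    simp only [inv]
  · rintro ⟨J, l⟩ _
    simp only [inv]
  · rintro ⟨J, l⟩ _
    exact h.perm_mult_setProd hf _ _

theorem op_raise (h : IsDunklSystem β ρ D M) {f : V} (hf : ∀ σ, ρ σ f = f) {i : ℕ}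
    (h0 : ∀ l : List ι, l.Nodup → l.length = i + 1 → listProd β D 0 l f = 0) (k : ι) :
    D k (raise β D M i f) = ∑ J ∈ (univ : Finset ι).powersetCard i with k ∈ J,
      (D k (M J (setProd β D J f)) -
        (((Fintype.card ι : F) - (i : F)) * β) • M J (setProd β D J f)) := by
  have e : ∀ J ∈ ((univ : Finset ι).powersetCard i).filter (k ∉ ·),
      D k (M J (setProd β D J f)) =
        -(β • ∑ l ∈ J, ρ (Equiv.swap k l) (M J (setProd β D J f))) := by
    intro J hJ
    obtain ⟨hJ, hk⟩ := Finset.mem_filter.1 hJ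
    have := h.hat_compl_mult hk (op_setProd h0 (Finset.mem_powersetCard.1 hJ).2 hk)
    rw [hat_apply, compl_compl] at this
    exact eq_neg_of_add_eq_zero_left this
  rw [raise_apply, map_sum, ← Finset.sum_filter_add_sum_filter_not _ (k ∈ ·),
    Finset.sum_congr rfl e, Finset.sum_neg_distrib, ← Finset.smul_sum, h.sum_sum_swap_mult hf,
    Finset.sum_sub_distrib, ← Finset.smul_sum]
  module

theorem listProd_raise_eq_zero (h : IsDunklSystem β ρ D M) {f : V} (hf : ∀ σ, ρ σ f = f) {i : ℕ}
    (h0 : ∀ l : List ι, l.Nodup → l.length = i + 1 → listProd β D 0 l f = 0) (l : List ι)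
    (hl : l.Nodup) (hi : l.length = i + 1) : listProd β D 0 l (raise β D M i f) = 0 := by
  obtain - | ⟨k, l⟩ := l
  · simp at hi
  obtain ⟨hk, hl⟩ := List.nodup_cons.1 hl
  have hi : l.length = i := by simpa using hi
  have hP := h.hatProd_eq_listProd (h.perm_raise hf i)
    (c := ((Fintype.card ι : F) - (i : F) - 1) * β) hl 1 (by simp [hi])
  have hc := commute_hatProd (h.commute_hats_op hk) (((Fintype.card ι : F) - (i : F) - 1) * β)
  simp only [listProd, Nat.cast_zero, zero_mul, zero_smul, add_zero, zero_add]
  rw [Module.End.mul_apply, ← hP, ← Module.End.mul_apply, hc.eq, Module.End.mul_apply,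
    h.op_raise hf h0, map_sum]
  refine Finset.sum_eq_zero fun J hJ => ?_
  obtain ⟨hJ, hkJ⟩ := Finset.mem_filter.1 hJ
  have hJc : J.card = i := (Finset.mem_powersetCard.1 hJ).2
  obtain ⟨j, hjl, hjJ⟩ : ∃ j ∈ l, j ∉ J := by
    by_contra! hcon
    have hsub : l.toFinset ⊆ J := fun m hm => hcon m (List.mem_toFinset.1 hm)
    have := Finset.eq_of_subset_of_card_le hsub
      (by rw [List.toFinset_card_of_nodup hl, hJc, hi])
    rw [← this, List.mem_toFinset] at hkJ
    exact hk hkJ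
  refine h.hatProd_eq_zero hl hjl ?_
  have hcomm : Commute (D k) (hat β ρ D {j} j) :=
    h.commute_hat_op (by simp) (by rw [Finset.mem_singleton]; rintro rfl; exact hk hjl)
  have hs := h.hat_singleton_mult hf h0 hJc hjJ
  rw [map_sub, map_smul, ← Module.End.mul_apply, ← hcomm.eq, Module.End.mul_apply, hs, map_smul]
  module

theorem commute_sum_hats_hatProd (h : IsDunklSystem β ρ D M) {l l' : List ι}
    (hl : (l ++ l').Nodup) (c : F) :
    Commute (hats β ρ D (l ++ l')).sum (hatProd β ρ D c l') := by
  refine commute_hatProd (fun Y hY => ?_) c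
  have key : ∀ Z ∈ hats β ρ D (l ++ l'), Commute Z Y :=
    fun Z hZ => h.commute_hats hl Z hZ Y (hats_subset_append l l' hY)
  exact Commute.list_sum_left Y _ key

theorem commute_sum_sq_hats_hatProd (h : IsDunklSystem β ρ D M) {l l' : List ι}
    (hl : (l ++ l').Nodup) (c : F) :
    Commute ((hats β ρ D (l ++ l')).map fun Y => Y * Y).sum (hatProd β ρ D c l') := by
  refine commute_hatProd (fun Y hY => ?_) c
  have key : ∀ Z ∈ (hats β ρ D (l ++ l')).map fun Y => Y * Y, Commute Z Y := by
    intro Z hZ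
    obtain ⟨X, hX, rfl⟩ := List.mem_map.1 hZ
    have := h.commute_hats hl X hX Y (hats_subset_append l l' hY)
    exact this.mul_left this
  exact Commute.list_sum_left Y _ key

theorem hatProd_toList (h : IsDunklSystem β ρ D M) {f : V} (hf : ∀ σ, ρ σ f = f) {i : ℕ}
    {J : Finset ι} (hJ : J.card = i) :
    hatProd β ρ D (((Fintype.card ι : F) - (i : F) - 1) * β) J.toList f = setProd β D J f :=
  h.hatProd_eq_listProd hf J.nodup_toList 1 (by simp [hJ])

theorem nodup_compl_append (J : Finset ι) : (Jᶜ.toList ++ J.toList).Nodup := by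
  refine List.nodup_append'.2 ⟨Finset.nodup_toList _, Finset.nodup_toList _, ?_⟩
  intro m hm hm'
  simp_all

theorem toFinset_compl_append (J : Finset ι) : (Jᶜ.toList ++ J.toList).toFinset = univ := by
  ext m
  simp [em']

theorem hat_univ (j : ι) : hat β ρ D univ j = D j := by
  simp [hat]

theorem card_eq_compl_add {J : Finset ι} {i : ℕ} (hJ : J.card = i) :
    Fintype.card ι = Jᶜ.card + i := by
  rw [← hJ, add_comm, Finset.card_add_card_compl]

theorem swap_setProd_of_mem (h : IsDunklSystem β ρ D M) {f : V} (hf : ∀ σ, ρ σ f = f)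
    (J : Finset ι) : ∀ a ∈ J, ∀ b ∈ J,
      ρ (Equiv.swap a b) (setProd β D J f) = setProd β D J f :=
  fun _ ha _ hb => h.swap_setProd hf (by simp [ha, hb])

theorem swap_setProd_of_notMem (h : IsDunklSystem β ρ D M) {f : V} (hf : ∀ σ, ρ σ f = f)
    (J : Finset ι) : ∀ a ∉ J.toList, ∀ b ∉ J.toList,
      ρ (Equiv.swap a b) (setProd β D J f) = setProd β D J f :=
  fun _ ha _ hb => h.swap_setProd hf (by simp_all)

theorem sum_hat_setProd (h : IsDunklSystem β ρ D M) {f : V} (hf : ∀ σ, ρ σ f = f) {i : ℕ}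
    (h0 : ∀ l : List ι, l.Nodup → l.length = i + 1 → listProd β D 0 l f = 0) {d : F}
    (hd : ∑ k, D k f = d • f) {J : Finset ι} (hJ : J.card = i) :
    ∑ j ∈ J, hat β ρ D J j (setProd β D J f) =
      (d + β * i * ((Fintype.card ι : F) - i)) • setProd β D J f := by
  have f1 := sum_hats_apply (β := β) (ρ := ρ) (D := D) (J := univ) (g := f)
    (fun a _ b _ => hf (Equiv.swap a b)) (nodup_compl_append J) fun _ _ => Finset.mem_univ _
  have c1 := LinearMap.congr_fun (h.commute_sum_hats_hatProd (nodup_compl_append J)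
    (((Fintype.card ι : F) - (i : F) - 1) * β)).eq f
  have g1 := sum_hats_append_apply (β := β) (D := D) (nodup_compl_append J) (h.swap_setProd_of_notMem hf J)
    fun a ha => op_setProd h0 hJ (by simpa using ha)
  have g3 := sum_hats_apply (β := β) (D := D) (h.swap_setProd_of_mem hf J) J.nodup_toList
    fun _ => Finset.mem_toList.1
  simp only [hat_univ, toFinset_compl_append, hd] at f1
  rw [Module.End.mul_apply, Module.End.mul_apply, h.hatProd_toList hf hJ, f1, g1, g3, map_add,
    map_smul, map_smul, h.hatProd_toList hf hJ, Finset.toList_toFinset] at c1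
  rw [card_eq_compl_add hJ]
  simp only [Finset.length_toList, List.length_append, hJ, Finset.card_univ, card_eq_compl_add hJ,
    Nat.cast_add, add_sub_cancel_right, sum_range_add_sub] at c1 ⊢
  generalize ∑ j ∈ J, hat β ρ D J j (setProd β D J f) = x at c1 ⊢
  rw [add_assoc, ← eq_sub_iff_add_eq] at c1
  rw [c1]
  module

theorem sum_sq_hat_setProd (h : IsDunklSystem β ρ D M) {f : V} (hf : ∀ σ, ρ σ f = f) {i : ℕ}
    (h0 : ∀ l : List ι, l.Nodup → l.length = i + 1 → listProd β D 0 l f = 0) {d e : F}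
    (hd : ∑ k, D k f = d • f) (he : ∑ k, D k (D k f) = e • f) {J : Finset ι} (hJ : J.card = i) :
    ∑ j ∈ J, hat β ρ D J j (hat β ρ D J j (setProd β D J f)) =
      (e + β * ((Fintype.card ι : F) - i) * d + β ^ 2 * i * ((Fintype.card ι : F) - i) ^ 2) •
        setProd β D J f := by
  have key := h.sum_hat_setProd hf h0 hd hJ
  have f1 := h.sum_sq_hats_apply (J := univ) (g := f)
    (fun a _ b _ => hf (Equiv.swap a b)) (d := d) (by simpa only [hat_univ] using hd)
    (nodup_compl_append J) fun _ _ => Finset.mem_univ _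
  have c1 := LinearMap.congr_fun (h.commute_sum_sq_hats_hatProd (nodup_compl_append J)
    (((Fintype.card ι : F) - (i : F) - 1) * β)).eq f
  have g1 := sum_sq_hats_append_apply (β := β) (D := D) (nodup_compl_append J) (h.swap_setProd_of_notMem hf J)
    fun a ha => op_setProd h0 hJ (by simpa using ha)
  have g3 := h.sum_sq_hats_apply (h.swap_setProd_of_mem hf J) key J.nodup_toList
    fun _ => Finset.mem_toList.1
  simp only [hat_univ, toFinset_compl_append, hd, he] at f1
  rw [Module.End.mul_apply, Module.End.mul_apply, h.hatProd_toList hf hJ, f1, g1, g3,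
    Finset.toList_toFinset, key] at c1
  simp only [map_add, map_smul, h.hatProd_toList hf hJ] at c1
  rw [card_eq_compl_add hJ] at c1 ⊢
  simp only [Finset.length_toList, List.length_append, hJ, Finset.card_univ, card_eq_compl_add hJ,
    Nat.cast_add, add_sub_cancel_right, sum_range_add_sub_sq] at c1 ⊢
  generalize ∑ j ∈ J, hat β ρ D J j (hat β ρ D J j (setProd β D J f)) = x at c1 ⊢
  rw [add_assoc, add_assoc, ← eq_sub_iff_add_eq] at c1
  rw [c1]
  module

theorem sum_op_mult_setProd (h : IsDunklSystem β ρ D M) {f : V} (hf : ∀ σ, ρ σ f = f) {i : ℕ}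
    (h0 : ∀ l : List ι, l.Nodup → l.length = i + 1 → listProd β D 0 l f = 0) {d : F}
    (hd : ∑ k, D k f = d • f) {J : Finset ι} (hJ : J.card = i) :
    ∑ k ∈ J, D k (M J (setProd β D J f)) =
      (d + β * i * ((Fintype.card ι : F) - i) + i) • M J (setProd β D J f) := by
  rw [Finset.sum_congr rfl fun k hk => h.op_mult_of_mem hk _, ← map_sum,
    Finset.sum_add_distrib, h.sum_hat_setProd hf h0 hd hJ, Finset.sum_const, hJ,
    ← Nat.cast_smul_eq_nsmul F, ← add_smul, map_smul]

theorem sum_sq_op_mult_setProd (h : IsDunklSystem β ρ D M) {f : V} (hf : ∀ σ, ρ σ f = f) {i : ℕ}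
    (h0 : ∀ l : List ι, l.Nodup → l.length = i + 1 → listProd β D 0 l f = 0) {d e : F}
    (hd : ∑ k, D k f = d • f) (he : ∑ k, D k (D k f) = e • f) {J : Finset ι} (hJ : J.card = i) :
    ∑ k ∈ J, D k (D k (M J (setProd β D J f))) =
      (e + β * ((Fintype.card ι : F) - i) * d + β ^ 2 * i * ((Fintype.card ι : F) - i) ^ 2 +
        2 * (d + β * i * ((Fintype.card ι : F) - i)) + i) • M J (setProd β D J f) := by
  rw [Finset.sum_congr rfl fun k hk => by
    rw [h.op_mult_of_mem hk, h.op_mult_of_mem hk, map_add (hat β ρ D J k)], ← map_sum,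
    Finset.sum_add_distrib, Finset.sum_add_distrib, Finset.sum_add_distrib,
    h.sum_hat_setProd hf h0 hd hJ, h.sum_sq_hat_setProd hf h0 hd he hJ,
    Finset.sum_const, hJ, ← Nat.cast_smul_eq_nsmul F, ← map_smul (M J)]
  refine congrArg (M J) ?_
  module

omit [Module F V] in
theorem sum_sum_filter_mem (S : Finset (Finset ι)) (φ : ι → Finset ι → V) :
    ∑ k, ∑ J ∈ S with k ∈ J, φ k J = ∑ J ∈ S, ∑ k ∈ J, φ k J :=
  Finset.sum_comm' fun k J => by simp [and_comm]

theorem sum_op_raise (h : IsDunklSystem β ρ D M) {f : V} (hf : ∀ σ, ρ σ f = f) {i : ℕ}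
    (h0 : ∀ l : List ι, l.Nodup → l.length = i + 1 → listProd β D 0 l f = 0) {d : F}
    (hd : ∑ k, D k f = d • f) :
    ∑ k, D k (raise β D M i f) = (d + i) • raise β D M i f := by
  simp only [h.op_raise hf h0, sum_sum_filter_mem]
  rw [raise_apply, Finset.smul_sum]
  refine Finset.sum_congr rfl fun J hJ => ?_
  have hJ := (Finset.mem_powersetCard.1 hJ).2
  rw [Finset.sum_sub_distrib, h.sum_op_mult_setProd hf h0 hd hJ, Finset.sum_const, hJ,
    ← Nat.cast_smul_eq_nsmul F]
  module

theorem sum_sq_op_raise (h : IsDunklSystem β ρ D M) {f : V} (hf : ∀ σ, ρ σ f = f) {i : ℕ}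
    (h0 : ∀ l : List ι, l.Nodup → l.length = i + 1 → listProd β D 0 l f = 0) {d e : F}
    (hd : ∑ k, D k f = d • f) (he : ∑ k, D k (D k f) = e • f) :
    ∑ k, D k (D k (raise β D M i f)) =
      (e + 2 * d + i + β * i * ((Fintype.card ι : F) - i)) • raise β D M i f := by
  simp only [h.op_raise hf h0, map_sum, map_sub, map_smul, sum_sum_filter_mem]
  rw [raise_apply, Finset.smul_sum]
  refine Finset.sum_congr rfl fun J hJ => ?_
  have hJ := (Finset.mem_powersetCard.1 hJ).2
  rw [Finset.sum_sub_distrib, ← Finset.smul_sum, h.sum_op_mult_setProd hf h0 hd hJ,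
    h.sum_sq_op_mult_setProd hf h0 hd he hJ]
  module

/-- An invariant vector killed by products of `i + 1` operators and on which the power sums of
degree one and two of the operators act through the parameters `μ 0, …, μ (i - 1)`. -/
structure IsRaised (β : F) (ρ : Equiv.Perm ι →* Module.End F V) (D : ι → Module.End F V) (i : ℕ)
    (μ : ℕ → F) (f : V) : Prop where
  perm_eq : ∀ σ, ρ σ f = f
  listProd_eq_zero : ∀ l : List ι, l.Nodup → l.length = i + 1 → listProd β D 0 l f = 0
  sum_op : ∑ k, D k f = (∑ j ∈ range i, μ j) • f
  sum_sq_op : ∑ k, D k (D k f) =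
    (∑ j ∈ range i, (μ j ^ 2 + β * ((Fintype.card ι : F) - 1 - 2 * j) * μ j)) • f

namespace IsRaised

variable {i : ℕ} {μ : ℕ → F} {f : V}

theorem raise (hf : IsRaised β ρ D i μ f) (h : IsDunklSystem β ρ D M) :
    IsRaised β ρ D i (fun j => μ j + 1) (IsDunklSystem.raise β D M i f) where
  perm_eq := h.perm_raise hf.perm_eq i
  listProd_eq_zero := h.listProd_raise_eq_zero hf.perm_eq hf.listProd_eq_zero
  sum_op := by
    rw [h.sum_op_raise hf.perm_eq hf.listProd_eq_zero hf.sum_op, Finset.sum_add_distrib]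
    simp
  sum_sq_op := by
    rw [h.sum_sq_op_raise hf.perm_eq hf.listProd_eq_zero hf.sum_op hf.sum_sq_op]
    congr 1
    clear hf
    induction i with
    | zero => simp
    | succ i ih =>
      rw [Finset.sum_range_succ, Finset.sum_range_succ, Finset.sum_range_succ, ← ih]
      push_cast
      ring

theorem succ (hf : IsRaised β ρ D i μ f) (h : IsDunklSystem β ρ D M) (hμ : μ i = 0) :
    IsRaised β ρ D (i + 1) μ f where
  perm_eq := hf.perm_eq
  listProd_eq_zero := h.listProd_eq_zero_of_length_eq hf.perm_eq hf.listProd_eq_zero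
  sum_op := by rw [hf.sum_op, Finset.sum_range_succ, hμ, add_zero]
  sum_sq_op := by simp [hf.sum_sq_op, Finset.sum_range_succ, hμ]

end IsRaised

end IsDunklSystem

namespace DunklPolynomial

variable {F : Type*} [Field F] {N : ℕ}

theorem mul_divExact {σ : Type*} {d f : MvPolynomial σ F} (h : d ∣ f) :
    d * divExact d f = f := by
  have h' : ∃ c, f = d * c := h
  rw [divExact, dif_pos h']
  exact h'.choose_spec.symm

theorem X_sub_X_ne_zero {i j : Fin N} (hij : i ≠ j) :
    (X i - X j : MvPolynomial (Fin N) F) ≠ 0 :=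
  sub_ne_zero.2 fun h => hij (X_injective h)

theorem X_sub_X_dvd (i j : Fin N) (f : MvPolynomial (Fin N) F) :
    X i - X j ∣ f - rename (Equiv.swap i j) f := by
  induction f using MvPolynomial.induction_on with
  | C a => simp
  | add p q hp hq =>
    rw [map_add, add_sub_add_comm]
    exact dvd_add hp hq
  | mul_X p k hp =>
    have hk : (X i - X j : MvPolynomial (Fin N) F) ∣ X k - X (Equiv.swap i j k) := by
      rw [Equiv.swap_apply_def]
      split_ifs with h1 h2
      · rw [h1]
      · rw [h2, ← neg_sub (X i), dvd_neg]
      · simp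
    rw [map_mul, rename_X, show p * X k - rename (Equiv.swap i j) p * X (Equiv.swap i j k) =
      (p - rename (Equiv.swap i j) p) * X k +
        rename (Equiv.swap i j) p * (X k - X (Equiv.swap i j k)) by ring]
    exact dvd_add (hp.mul_right _) (hk.mul_left _)

/-- The divided difference `(z_i - z_j)⁻¹ (1 - K_{ij})`, taken to be zero when `i = j`. -/
noncomputable def divDiff (i j : Fin N) : Module.End F (MvPolynomial (Fin N) F) where
  toFun f := if i = j then 0 else divExact (X i - X j) (f - rename (Equiv.swap i j) f)
  map_add' f g := by
    split_ifs with hij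
    · simp
    · refine mul_left_cancel₀ (X_sub_X_ne_zero hij) ?_
      rw [mul_add, mul_divExact (X_sub_X_dvd i j _), mul_divExact (X_sub_X_dvd i j _),
        mul_divExact (X_sub_X_dvd i j _), map_add]
      ring
  map_smul' c f := by
    split_ifs with hij
    · simp
    · refine mul_left_cancel₀ (X_sub_X_ne_zero hij) ?_
      rw [RingHom.id_apply, mul_smul_comm, mul_divExact (X_sub_X_dvd i j _),
        mul_divExact (X_sub_X_dvd i j _), map_smul, smul_sub]

theorem divDiff_of_ne {i j : Fin N} (hij : i ≠ j) (f : MvPolynomial (Fin N) F) :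
    divDiff i j f = divExact (X i - X j) (f - rename (Equiv.swap i j) f) :=
  if_neg hij

theorem divDiff_self (i : Fin N) : divDiff i i = (0 : Module.End F (MvPolynomial (Fin N) F)) :=
  LinearMap.ext fun _ => if_pos rfl

theorem sub_mul_divDiff (i j : Fin N) (f : MvPolynomial (Fin N) F) :
    (X i - X j) * divDiff i j f = f - rename (Equiv.swap i j) f := by
  obtain rfl | hij := eq_or_ne i j
  · simp
  · rw [divDiff_of_ne hij, mul_divExact (X_sub_X_dvd i j f)]

theorem rename_rename_swap (σ : Equiv.Perm (Fin N)) (a b : Fin N) (f : MvPolynomial (Fin N) F) :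
    rename σ (rename (Equiv.swap a b) f) = rename (Equiv.swap (σ a) (σ b)) (rename σ f) := by
  rw [rename_rename, rename_rename]
  congr 2
  ext m
  simp [Equiv.swap_apply_def, apply_ite σ]

theorem rename_swap_rename_swap (a b : Fin N) (f : MvPolynomial (Fin N) F) :
    rename (Equiv.swap a b) (rename (Equiv.swap a b) f) = f := by
  rw [rename_rename, ← Equiv.coe_trans]
  simp

theorem rename_divDiff (σ : Equiv.Perm (Fin N)) (i j : Fin N) (f : MvPolynomial (Fin N) F) :
    rename σ (divDiff i j f) = divDiff (σ i) (σ j) (rename σ f) := by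
  obtain rfl | hij := eq_or_ne i j
  · simp [divDiff_self]
  · refine mul_left_cancel₀ (X_sub_X_ne_zero (σ.injective.ne hij)) ?_
    rw [sub_mul_divDiff, ← rename_rename_swap, ← map_sub, ← sub_mul_divDiff]
    simp

/-- The Euler operator `z_i ∂_i`. -/
noncomputable def euler (i : Fin N) : Module.End F (MvPolynomial (Fin N) F) :=
  LinearMap.mulLeft F (X i) * (pderiv i).toLinearMap

theorem euler_apply (i : Fin N) (f : MvPolynomial (Fin N) F) : euler i f = X i * pderiv i f := rfl

/-- The operator `z_i (z_i - z_j)⁻¹ (1 - K_{ij})`. -/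
noncomputable def mulDiff (i j : Fin N) : Module.End F (MvPolynomial (Fin N) F) :=
  LinearMap.mulLeft F (X i) * divDiff i j

theorem mulDiff_apply (i j : Fin N) (f : MvPolynomial (Fin N) F) :
    mulDiff i j f = X i * divDiff i j f := rfl

theorem mulDiff_self (i : Fin N) :
    mulDiff i i = (0 : Module.End F (MvPolynomial (Fin N) F)) := by
  rw [mulDiff, divDiff_self, mul_zero]

theorem sub_mul_mulDiff (i j : Fin N) (f : MvPolynomial (Fin N) F) :
    (X i - X j) * mulDiff i j f = X i * (f - rename (Equiv.swap i j) f) := by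
  rw [mulDiff_apply, mul_left_comm, sub_mul_divDiff]

theorem rename_mulDiff (σ : Equiv.Perm (Fin N)) (i j : Fin N) (f : MvPolynomial (Fin N) F) :
    rename σ (mulDiff i j f) = mulDiff (σ i) (σ j) (rename σ f) := by
  simp [mulDiff_apply, rename_divDiff]

theorem rename_euler (σ : Equiv.Perm (Fin N)) (i : Fin N) (f : MvPolynomial (Fin N) F) :
    rename σ (euler i f) = euler (σ i) (rename σ f) := by
  simp [euler_apply, pderiv_rename σ.injective]

/-- Composition of two operators `mulDiff`, with the denominators cleared. -/
theorem denom_mul_mulDiff_mulDiff (a b c d : Fin N) (f : MvPolynomial (Fin N) F) :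
    (X a - X b) * (X c - X d) * (X (Equiv.swap a b c) - X (Equiv.swap a b d)) *
        mulDiff a b (mulDiff c d f) =
      X a * ((X (Equiv.swap a b c) - X (Equiv.swap a b d)) * X c *
          (f - rename (Equiv.swap c d) f) -
        (X c - X d) * X (Equiv.swap a b c) * (rename (Equiv.swap a b) f -
          rename (Equiv.swap (Equiv.swap a b c) (Equiv.swap a b d)) (rename (Equiv.swap a b) f))) := by
  have h1 := sub_mul_mulDiff a b (mulDiff c d f)
  have h2 := sub_mul_mulDiff c d f
  have h3 := sub_mul_mulDiff (Equiv.swap a b c) (Equiv.swap a b d) (rename (Equiv.swap a b) f)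
  rw [← rename_mulDiff] at h3
  linear_combination (X c - X d) * (X (Equiv.swap a b c) - X (Equiv.swap a b d)) * h1 +
    X a * (X (Equiv.swap a b c) - X (Equiv.swap a b d)) * h2 - X a * (X c - X d) * h3

theorem euler_mulDiff_comm {i j l : Fin N} (hij : i ≠ j) (hil : i ≠ l)
    (f : MvPolynomial (Fin N) F) : euler i (mulDiff j l f) = mulDiff j l (euler i f) := by
  obtain rfl | hjl := eq_or_ne j l
  · simp [mulDiff_self]
  · refine mul_left_cancel₀ (X_sub_X_ne_zero hjl) ?_
    have h1 := congrArg (pderiv i) (sub_mul_mulDiff j l f)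
    have h2 := sub_mul_mulDiff j l (euler i f)
    have h3 := rename_euler (Equiv.swap j l) i f
    rw [Equiv.swap_apply_of_ne_of_ne hij hil] at h3
    simp only [Derivation.leibniz, map_sub, pderiv_X_of_ne hij.symm, pderiv_X_of_ne hil.symm,
      smul_eq_mul] at h1
    rw [h2, h3]
    simp only [euler_apply]
    linear_combination X i * h1

theorem euler_mulDiff_swap {i j : Fin N} (hij : i ≠ j) (f : MvPolynomial (Fin N) F) :
    euler i (mulDiff j i f) + mulDiff i j (euler j f) =
      mulDiff j i (euler i f) + euler j (mulDiff i j f) +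
        (euler j (rename (Equiv.swap i j) f) - euler i (rename (Equiv.swap i j) f)) := by
  refine mul_left_cancel₀ (X_sub_X_ne_zero hij) (mul_left_cancel₀ (X_sub_X_ne_zero hij) ?_)
  have a0 := sub_mul_mulDiff j i f
  have b0 := sub_mul_mulDiff i j f
  have a1 := congrArg (pderiv i) a0
  have b1 := congrArg (pderiv j) b0
  have a2 := sub_mul_mulDiff j i (euler i f)
  have b2 := sub_mul_mulDiff i j (euler j f)
  rw [rename_euler, Equiv.swap_apply_right, Equiv.swap_comm] at a2
  rw [rename_euler, Equiv.swap_apply_right] at b2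
  rw [Equiv.swap_comm] at a0 a1
  simp only [Derivation.leibniz, map_sub, pderiv_X_of_ne hij, pderiv_X_of_ne hij.symm,
    smul_eq_mul, pderiv_X_self] at a1 b1
  simp only [euler_apply] at *
  linear_combination -(X i - X j) * X i * a1 + X i * a0 + (X i - X j) * (a2 + b2) -
    (X i - X j) * X j * b1 - X j * b0

theorem mulDiff_mulDiff_comm {i j l m : Fin N} (hij : i ≠ j) (him : i ≠ m) (hlj : l ≠ j)
    (hlm : l ≠ m) (f : MvPolynomial (Fin N) F) :
    mulDiff i l (mulDiff j m f) = mulDiff j m (mulDiff i l f) := by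
  obtain rfl | hil := eq_or_ne i l
  · simp [mulDiff_self]
  obtain rfl | hjm := eq_or_ne j m
  · simp [mulDiff_self]
  have h1 := denom_mul_mulDiff_mulDiff i l j m f
  have h2 := denom_mul_mulDiff_mulDiff j m i l f
  rw [Equiv.swap_apply_of_ne_of_ne hij.symm hlj.symm,
    Equiv.swap_apply_of_ne_of_ne him.symm hlm.symm] at h1
  rw [Equiv.swap_apply_of_ne_of_ne hij him, Equiv.swap_apply_of_ne_of_ne hlj hlm,
    rename_rename_swap, Equiv.swap_apply_of_ne_of_ne hij.symm hlj.symm,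
    Equiv.swap_apply_of_ne_of_ne him.symm hlm.symm] at h2
  refine mul_left_cancel₀ (X_sub_X_ne_zero hil) (mul_left_cancel₀ (X_sub_X_ne_zero hjm)
    (mul_left_cancel₀ (X_sub_X_ne_zero hil) (mul_left_cancel₀ (X_sub_X_ne_zero hjm) ?_)))
  linear_combination (X i - X l) * h1 - (X j - X m) * h2

theorem mulDiff_mulDiff_swap {i j : Fin N} (hij : i ≠ j) (f : MvPolynomial (Fin N) F) :
    mulDiff i j (mulDiff j i f) = mulDiff j i (mulDiff i j f) +
      (mulDiff j i (rename (Equiv.swap i j) f) - mulDiff i j (rename (Equiv.swap i j) f)) := by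
  have h1 := denom_mul_mulDiff_mulDiff i j j i f
  have h2 := denom_mul_mulDiff_mulDiff j i i j f
  have h3 := sub_mul_mulDiff j i (rename (Equiv.swap i j) f)
  have h4 := sub_mul_mulDiff i j (rename (Equiv.swap i j) f)
  rw [Equiv.swap_comm j i] at h1 h2 h3
  simp only [Equiv.swap_apply_left, Equiv.swap_apply_right, rename_swap_rename_swap,
    Equiv.swap_comm j i] at h1 h2 h3 h4
  have hn := X_sub_X_ne_zero (F := F) hij
  refine mul_left_cancel₀ hn (mul_left_cancel₀ hn (mul_left_cancel₀ hn ?_))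
  linear_combination -h1 - h2 + (X i - X j) ^ 2 * (h3 + h4)

theorem mulDiff_mulDiff_triple {i j m : Fin N} (hij : i ≠ j) (him : i ≠ m) (hjm : j ≠ m)
    (f : MvPolynomial (Fin N) F) :
    mulDiff i j (mulDiff j m f) + mulDiff i m (mulDiff j i f) + mulDiff i m (mulDiff j m f) =
      mulDiff j m (mulDiff i j f) + mulDiff j i (mulDiff i m f) + mulDiff j m (mulDiff i m f) +
      (mulDiff j m (rename (Equiv.swap i j) f) - mulDiff i m (rename (Equiv.swap i j) f)) := by
  have a1 := denom_mul_mulDiff_mulDiff i j j m f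
  have a2 := denom_mul_mulDiff_mulDiff i m j i f
  have a3 := denom_mul_mulDiff_mulDiff i m j m f
  have b1 := denom_mul_mulDiff_mulDiff j m i j f
  have b2 := denom_mul_mulDiff_mulDiff j i i m f
  have b3 := denom_mul_mulDiff_mulDiff j m i m f
  have c1 := sub_mul_mulDiff j m (rename (Equiv.swap i j) f)
  have c2 := sub_mul_mulDiff i m (rename (Equiv.swap i j) f)
  have e1 := rename_rename_swap (Equiv.swap j m) i j f
  have e2 := rename_rename_swap (Equiv.swap i m) i j f
  have e3 := rename_rename_swap (Equiv.swap i j) i m f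
  have e4 := rename_rename_swap (Equiv.swap i j) j m f
  simp only [Equiv.swap_comm j i, Equiv.swap_apply_left, Equiv.swap_apply_right,
    Equiv.swap_apply_of_ne_of_ne hij.symm hjm, Equiv.swap_apply_of_ne_of_ne him.symm hjm.symm,
    Equiv.swap_apply_of_ne_of_ne hij him, Equiv.swap_comm m j]
    at a1 a2 a3 b1 b2 b3 e1 e2 e3 e4
  refine mul_left_cancel₀ (X_sub_X_ne_zero hij) (mul_left_cancel₀ (X_sub_X_ne_zero him)
    (mul_left_cancel₀ (X_sub_X_ne_zero hjm) ?_))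
  rw [e2] at a1 c2
  rw [e4, e2] at b3
  rw [← e3] at b2 c1
  rw [← e1, ← e3] at b1
  linear_combination a1 - a2 - a3 - b1 + b2 - b3 - (X i - X j) * (X i - X m) * c1 +
    (X i - X j) * (X j - X m) * c2

theorem euler_comm (i j : Fin N) (f : MvPolynomial (Fin N) F) :
    euler i (euler j f) = euler j (euler i f) := by
  induction f using MvPolynomial.induction_on' with
  | monomial m r =>
    simp only [euler_apply, X_mul_pderiv_monomial, map_nsmul]
    exact smul_comm _ _ _
  | add p q hp hq => simp only [map_add, hp, hq]

/-- The operator `D_i = z_i ∇_i` as a linear map. -/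
noncomputable def dunkl (β : F) (i : Fin N) : Module.End F (MvPolynomial (Fin N) F) :=
  euler i + β • ∑ l, mulDiff i l

/-- The permutation action on polynomials by renaming variables. -/
noncomputable def perm (F : Type*) [Field F] (N : ℕ) :
    Equiv.Perm (Fin N) →* Module.End F (MvPolynomial (Fin N) F) where
  toFun σ := (rename σ).toLinearMap
  map_one' := LinearMap.ext fun f => rename_id_apply f
  map_mul' σ τ := LinearMap.ext fun f => (rename_rename τ σ f).symm

/-- Multiplication by `z_J`. -/
noncomputable def mulSet (J : Finset (Fin N)) : Module.End F (MvPolynomial (Fin N) F) :=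
  LinearMap.mulLeft F (zJ J)

theorem dunkl_apply (β : F) (i : Fin N) (f : MvPolynomial (Fin N) F) :
    dunkl β i f = euler i f + β • ∑ l, mulDiff i l f := by
  simp [dunkl, LinearMap.sum_apply]

theorem perm_apply (σ : Equiv.Perm (Fin N)) (f : MvPolynomial (Fin N) F) :
    perm F N σ f = rename σ f := rfl

theorem mulSet_apply (J : Finset (Fin N)) (f : MvPolynomial (Fin N) F) :
    mulSet J f = zJ J * f := rfl

theorem dunkl_eq_Dop (β : F) (i : Fin N) (f : MvPolynomial (Fin N) F) :
    dunkl β i f = Dop β i f := by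
  rw [dunkl_apply, Dop, nabla, mul_add, mul_smul_comm, Finset.mul_sum, euler_apply,
    ← Finset.add_sum_erase _ _ (Finset.mem_univ i), mulDiff_self, LinearMap.zero_apply, zero_add]
  congr 2
  refine Finset.sum_congr rfl fun j hj => ?_
  rw [mulDiff_apply, divDiff_of_ne (Finset.ne_of_mem_erase hj).symm, Kswap]

theorem rename_dunkl (β : F) (σ : Equiv.Perm (Fin N)) (i : Fin N) (f : MvPolynomial (Fin N) F) :
    rename σ (dunkl β i f) = dunkl β (σ i) (rename σ f) := by
  simp only [dunkl_apply, map_add, map_smul, map_sum, rename_euler, rename_mulDiff]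
  rw [Equiv.sum_comp σ fun l => mulDiff (σ i) l (rename σ f)]

theorem sum_euler_mulDiff_comm {i j : Fin N} (hij : i ≠ j) (f : MvPolynomial (Fin N) F) :
    ∑ l, euler i (mulDiff j l f) + ∑ l, mulDiff i l (euler j f) =
      ∑ l, euler j (mulDiff i l f) + ∑ l, mulDiff j l (euler i f) +
        (euler j (rename (Equiv.swap i j) f) - euler i (rename (Equiv.swap i j) f)) := by
  have h1 : ∑ l, (euler i (mulDiff j l f) - mulDiff j l (euler i f)) =
      euler i (mulDiff j i f) - mulDiff j i (euler i f) :=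
    Finset.sum_eq_single i
      (fun l _ hl => sub_eq_zero.2 (euler_mulDiff_comm hij hl.symm f)) (by simp)
  have h2 : ∑ l, (mulDiff i l (euler j f) - euler j (mulDiff i l f)) =
      mulDiff i j (euler j f) - euler j (mulDiff i j f) :=
    Finset.sum_eq_single j
      (fun l _ hl => sub_eq_zero.2 (euler_mulDiff_comm hij.symm hl.symm f).symm) (by simp)
  rw [Finset.sum_sub_distrib] at h1 h2
  linear_combination h1 + h2 + euler_mulDiff_swap hij f

theorem sum_univ_eq {i j : Fin N} {A : Type*} [AddCommMonoid A] (hij : i ≠ j) (φ : Fin N → A) :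
    ∑ l, φ l = φ i + φ j + ∑ l ∈ (univ.erase i).erase j, φ l := by
  rw [add_assoc, Finset.add_sum_erase _ _ (by simp [hij.symm]),
    Finset.add_sum_erase _ _ (Finset.mem_univ i)]

theorem sum_mulDiff_mulDiff_comm {i j : Fin N} (hij : i ≠ j) (f : MvPolynomial (Fin N) F) :
    ∑ l, ∑ m, mulDiff i l (mulDiff j m f) = ∑ l, ∑ m, mulDiff j m (mulDiff i l f) +
      ∑ m, (mulDiff j m (rename (Equiv.swap i j) f) - mulDiff i m (rename (Equiv.swap i j) f)) := by
  rw [← sub_eq_iff_eq_add', ← Finset.sum_sub_distrib]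
  simp only [← Finset.sum_sub_distrib]
  have hdiag : ∀ l ∈ (univ.erase i).erase j, ∑ m ∈ (univ.erase i).erase j,
      (mulDiff i l (mulDiff j m f) - mulDiff j m (mulDiff i l f)) =
        mulDiff i l (mulDiff j l f) - mulDiff j l (mulDiff i l f) := by
    intro l hl
    refine Finset.sum_eq_single l (fun m hm hml => ?_) fun h => absurd hl h
    simp only [Finset.mem_erase, Finset.mem_univ, and_true] at hl hm
    exact sub_eq_zero.2 (mulDiff_mulDiff_comm hij hm.2.symm hl.1 hml.symm f)
  rw [sum_univ_eq hij, sum_univ_eq hij, sum_univ_eq hij, sum_univ_eq hij]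
  simp only [sum_univ_eq hij (fun m => mulDiff i _ (mulDiff j m f) - _), mulDiff_self,
    LinearMap.zero_apply, map_zero, sub_zero, zero_sub, Finset.sum_const_zero, add_zero, zero_add]
  rw [Finset.sum_add_distrib, Finset.sum_congr rfl hdiag, mulDiff_mulDiff_swap hij]
  have htriple : ∑ m ∈ (univ.erase i).erase j,
      (mulDiff i j (mulDiff j m f) - mulDiff j m (mulDiff i j f) +
        (mulDiff i m (mulDiff j i f) - mulDiff j i (mulDiff i m f)) +
        (mulDiff i m (mulDiff j m f) - mulDiff j m (mulDiff i m f))) =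
      ∑ m ∈ (univ.erase i).erase j,
        (mulDiff j m (rename (Equiv.swap i j) f) - mulDiff i m (rename (Equiv.swap i j) f)) := by
    refine Finset.sum_congr rfl fun m hm => ?_
    simp only [Finset.mem_erase, Finset.mem_univ, and_true] at hm
    linear_combination mulDiff_mulDiff_triple hij hm.2.symm hm.1.symm f
  rw [← htriple, Finset.sum_add_distrib, Finset.sum_add_distrib]
  ring

theorem dunkl_dunkl (β : F) (i j : Fin N) (f : MvPolynomial (Fin N) F) :
    dunkl β i (dunkl β j f) = euler i (euler j f) +
      β • (∑ l, euler i (mulDiff j l f) + ∑ l, mulDiff i l (euler j f)) +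
      (β * β) • ∑ l, ∑ m, mulDiff i l (mulDiff j m f) := by
  simp only [dunkl_apply, map_add, map_smul, map_sum, Finset.sum_add_distrib, ← Finset.smul_sum]
  rw [Finset.sum_comm]
  module

theorem dunkl_comm (β : F) {i j : Fin N} (hij : i ≠ j) (f : MvPolynomial (Fin N) F) :
    dunkl β i (dunkl β j f) = dunkl β j (dunkl β i f) +
      β • (dunkl β j (rename (Equiv.swap i j) f) - dunkl β i (rename (Equiv.swap i j) f)) := by
  have hc : ∑ l, ∑ m, mulDiff j m (mulDiff i l f) = ∑ l, ∑ m, mulDiff j l (mulDiff i m f) :=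
    Finset.sum_comm
  have hs := Finset.sum_sub_distrib (s := univ) (fun m => mulDiff j m (rename (Equiv.swap i j) f))
    fun m => mulDiff i m (rename (Equiv.swap i j) f)
  rw [dunkl_dunkl, dunkl_dunkl, euler_comm, sum_euler_mulDiff_comm hij,
    sum_mulDiff_mulDiff_comm hij, hc, hs, dunkl_apply, dunkl_apply]
  module

theorem zJ_eq_mul_erase {J : Finset (Fin N)} {k : Fin N} (hk : k ∈ J) :
    (zJ J : MvPolynomial (Fin N) F) = X k * zJ (J.erase k) :=
  (Finset.mul_prod_erase J _ hk).symm

theorem rename_zJ (σ : Equiv.Perm (Fin N)) (J : Finset (Fin N)) :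
    rename σ (zJ J : MvPolynomial (Fin N) F) = zJ (J.map σ.toEmbedding) := by
  simp [zJ, Finset.prod_map]

theorem rename_swap_zJ {J : Finset (Fin N)} {k l : Fin N} (hkl : k ∈ J ↔ l ∈ J) :
    rename (Equiv.swap k l) (zJ J : MvPolynomial (Fin N) F) = zJ J := by
  rw [rename_zJ, IsDunklSystem.map_swap_finset_eq hkl]

theorem euler_zJ_of_notMem {J : Finset (Fin N)} {k : Fin N} (hk : k ∉ J)
    (f : MvPolynomial (Fin N) F) : euler k (zJ J * f) = zJ J * euler k f := by
  induction J using Finset.induction_on with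
  | empty => simp [zJ]
  | insert l J hl ih =>
    simp only [Finset.mem_insert, not_or] at hk
    rw [zJ_eq_mul_erase (Finset.mem_insert_self l J), Finset.erase_insert hl, mul_assoc, mul_assoc,
      ← ih hk.2, euler_apply, euler_apply, pderiv_mul, pderiv_X_of_ne (Ne.symm hk.1)]
    ring

theorem euler_zJ_of_mem {J : Finset (Fin N)} {k : Fin N} (hk : k ∈ J)
    (f : MvPolynomial (Fin N) F) : euler k (zJ J * f) = zJ J * euler k f + zJ J * f := by
  have := euler_zJ_of_notMem (Finset.notMem_erase k J) f
  rw [euler_apply] at this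
  rw [zJ_eq_mul_erase hk, mul_assoc, euler_apply, pderiv_mul, pderiv_X_self]
  linear_combination X k * this

theorem mulDiff_zJ {J : Finset (Fin N)} {k l : Fin N} (hkl : k ∈ J ↔ l ∈ J)
    (f : MvPolynomial (Fin N) F) : mulDiff k l (zJ J * f) = zJ J * mulDiff k l f := by
  obtain rfl | hne := eq_or_ne k l
  · simp [mulDiff_self]
  · refine mul_left_cancel₀ (X_sub_X_ne_zero hne) ?_
    rw [sub_mul_mulDiff, map_mul, rename_swap_zJ hkl, mul_left_comm, sub_mul_mulDiff]
    ring

theorem mulDiff_zJ_of_mem_of_notMem {J : Finset (Fin N)} {k l : Fin N} (hk : k ∈ J) (hl : l ∉ J)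
    (f : MvPolynomial (Fin N) F) :
    mulDiff k l (zJ J * f) = zJ J * (mulDiff k l f + rename (Equiv.swap k l) f) := by
  have hne : k ≠ l := by rintro rfl; exact hl hk
  refine mul_left_cancel₀ (X_sub_X_ne_zero hne) ?_
  rw [sub_mul_mulDiff, zJ_eq_mul_erase hk, map_mul, map_mul, rename_X, Equiv.swap_apply_left,
    rename_swap_zJ (by simp [hl])]
  linear_combination -X k * zJ (J.erase k) * sub_mul_mulDiff k l f

theorem mulDiff_zJ_of_notMem_of_mem {J : Finset (Fin N)} {k l : Fin N} (hk : k ∉ J) (hl : l ∈ J)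
    (f : MvPolynomial (Fin N) F) :
    mulDiff k l (zJ J * f) = zJ J * mulDiff k l f - rename (Equiv.swap k l) (zJ J * f) := by
  have hne : k ≠ l := by rintro rfl; exact hk hl
  refine mul_left_cancel₀ (X_sub_X_ne_zero hne) ?_
  rw [sub_mul_mulDiff, zJ_eq_mul_erase hl, map_mul, map_mul, rename_X, Equiv.swap_apply_right,
    rename_swap_zJ (by simp [hk])]
  linear_combination -X l * zJ (J.erase l) * sub_mul_mulDiff k l f

theorem isDunklSystem (β : F) (N : ℕ) : IsDunklSystem β (perm F N) (dunkl β) mulSet where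
  perm_mul_op σ k := LinearMap.ext fun f => rename_dunkl β σ k f
  op_comm i j hij := LinearMap.ext fun f => dunkl_comm β hij f
  perm_mul_mult σ J := LinearMap.ext fun f => by
    simp [perm_apply, mulSet_apply, rename_zJ]
  op_mul_mult_of_mem J k hk := LinearMap.ext fun f => by
    have h1 : ∀ l ∈ J, mulDiff k l (zJ J * f) = zJ J * mulDiff k l f :=
      fun l hl => mulDiff_zJ (by simp [hk, hl]) f
    have h2 : ∀ l ∈ Jᶜ, mulDiff k l (zJ J * f) =
        zJ J * mulDiff k l f + zJ J * rename (Equiv.swap k l) f := fun l hl => by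
      rw [mulDiff_zJ_of_mem_of_notMem hk (Finset.mem_compl.1 hl), mul_add]
    simp only [Module.End.mul_apply, mulSet_apply, LinearMap.add_apply, LinearMap.smul_apply,
      LinearMap.sum_apply, Module.End.one_apply, perm_apply, dunkl_apply]
    rw [euler_zJ_of_mem hk, ← Finset.sum_add_sum_compl J, Finset.sum_congr rfl h1,
      Finset.sum_congr rfl h2, Finset.sum_add_distrib, ← add_assoc,
      Finset.sum_add_sum_compl J fun l => zJ J * mulDiff k l f, ← Finset.mul_sum, ← Finset.mul_sum]
    simp only [mul_add, mul_smul_comm, smul_add]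
    abel
  op_mul_mult_of_notMem J k hk := LinearMap.ext fun f => by
    have h1 : ∀ l ∈ J, mulDiff k l (zJ J * f) =
        zJ J * mulDiff k l f - rename (Equiv.swap k l) (zJ J * f) :=
      fun l hl => mulDiff_zJ_of_notMem_of_mem hk hl f
    have h2 : ∀ l ∈ Jᶜ, mulDiff k l (zJ J * f) = zJ J * mulDiff k l f :=
      fun l hl => mulDiff_zJ (by simp [hk, Finset.mem_compl.1 hl]) f
    simp only [Module.End.mul_apply, mulSet_apply, LinearMap.sub_apply, LinearMap.smul_apply,
      LinearMap.sum_apply, perm_apply, dunkl_apply]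
    rw [euler_zJ_of_notMem hk, ← Finset.sum_add_sum_compl J, Finset.sum_congr rfl h1,
      Finset.sum_congr rfl h2, Finset.sum_sub_distrib, sub_add_eq_add_sub,
      Finset.sum_add_sum_compl J fun l => zJ J * mulDiff k l f, ← Finset.mul_sum]
    simp only [mul_add, mul_smul_comm, smul_sub]
    abel

open IsDunklSystem

theorem mulDiff_eq_zero {f : MvPolynomial (Fin N) F} (hf : ∀ σ, perm F N σ f = f) (i j : Fin N) :
    mulDiff i j f = 0 := by
  obtain rfl | hij := eq_or_ne i j
  · rw [mulDiff_self, LinearMap.zero_apply]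
  · refine mul_left_cancel₀ (X_sub_X_ne_zero hij) ?_
    rw [sub_mul_mulDiff, ← perm_apply, hf, sub_self, mul_zero, mul_zero]

theorem dunkl_eq_euler (β : F) {f : MvPolynomial (Fin N) F} (hf : ∀ σ, perm F N σ f = f)
    (k : Fin N) : dunkl β k f = euler k f := by
  simp [dunkl_apply, mulDiff_eq_zero hf]

theorem Aop_eq {f : MvPolynomial (Fin N) F} (hf : ∀ σ, perm F N σ f = f) {k l : Fin N}
    (hkl : k ≠ l) : Aop k l f = mulDiff k l (euler k f) + mulDiff l k (euler l f) := by
  have hk := sub_mul_mulDiff k l (euler k f)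
  have hl := sub_mul_mulDiff l k (euler l f)
  rw [rename_euler, Equiv.swap_apply_left, ← perm_apply, hf] at hk hl
  have key : (X k - X l) * (mulDiff k l (euler k f) + mulDiff l k (euler l f)) =
      (X k + X l) * (X k * pderiv k f - X l * pderiv l f) := by
    rw [← euler_apply, ← euler_apply]
    linear_combination hk - hl
  refine mul_left_cancel₀ (X_sub_X_ne_zero hkl) ?_
  rw [key, Aop, mul_divExact ⟨_, key.symm⟩]

theorem Hop_eq (β : F) {f : MvPolynomial (Fin N) F} (hf : ∀ σ, perm F N σ f = f) :
    Hop β univ f = ∑ k, dunkl β k (dunkl β k f) := by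
  have h1 : ∀ k : Fin N, ∑ l with k < l, Aop k l f =
      ∑ l ∈ Ioi k, (mulDiff k l (euler k f) + mulDiff l k (euler l f)) := fun k => by
    rw [Finset.filter_lt_eq_Ioi]
    exact Finset.sum_congr rfl fun l hl => Aop_eq hf (Finset.mem_Ioi.1 hl).ne
  have h2 : ∀ k : Fin N, ∑ l, mulDiff k l (euler k f) = ∑ l ∈ {k}ᶜ, mulDiff k l (euler k f) :=
    fun k => by
      rw [← Finset.sum_add_sum_compl {k}, Finset.sum_singleton, mulDiff_self,
        LinearMap.zero_apply, zero_add]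
  simp only [dunkl_eq_euler β hf, dunkl_apply, Finset.sum_add_distrib, ← Finset.smul_sum, h2]
  rw [Hop, Finset.sum_congr rfl fun k _ => h1 k,
    Finset.sum_sum_Ioi_add_eq_sum_sum_off_diag fun l k => mulDiff k l (euler k f)]
  rfl

theorem Dlist_eq (β : F) (k : ℕ) (l : List (Fin N)) (f : MvPolynomial (Fin N) F) :
    Dlist β k l f = listProd β (dunkl β) k l f := by
  induction l generalizing k with
  | nil => rfl
  | cons j l ih => simp [Dlist, listProd, ih, dunkl_eq_Dop]

theorem DJ_eq (β : F) {f : MvPolynomial (Fin N) F} (hf : ∀ σ, perm F N σ f = f)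
    (J : Finset (Fin N)) : DJ β 1 J f = setProd β (dunkl β) J f := by
  rw [DJ, Dlist_eq, setProd]
  exact (isDunklSystem β N).listProd_perm hf (Finset.sort_perm_toList _ _) (Finset.sort_nodup _ _) 1

theorem Bplus_eq (β : F) {f : MvPolynomial (Fin N) F} (hf : ∀ σ, perm F N σ f = f) (i : ℕ) :
    Bplus β i univ f = raise β (dunkl β) mulSet i f := by
  simp only [Bplus, raise_apply, mulSet_apply, DJ_eq β hf]

theorem dunkl_one (β : F) (k : Fin N) : dunkl β k 1 = 0 := by
  rw [dunkl_eq_euler β (fun σ => by simp [perm_apply]), euler_apply, pderiv_one, mul_zero]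

theorem isRaised_one (β : F) (μ : ℕ → F) : IsRaised β (perm F N) (dunkl β) 0 μ 1 where
  perm_eq σ := by simp [perm_apply]
  listProd_eq_zero l _ hl := by
    obtain ⟨k, rfl⟩ := List.length_eq_one_iff.1 hl
    simp [listProd, dunkl_one]
  sum_op := by simp [dunkl_one]
  sum_sq_op := by simp [dunkl_one]

theorem isRaised_iterate_Bplus {β : F} {i : ℕ} {μ : ℕ → F} {f : MvPolynomial (Fin N) F}
    (hf : IsRaised β (perm F N) (dunkl β) i μ f) (t : ℕ) :
    IsRaised β (perm F N) (dunkl β) i (fun j => μ j + t) ((fun f => Bplus β i univ f)^[t] f) := by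
  induction t with
  | zero => simpa using hf
  | succ t ih =>
    rw [Function.iterate_succ_apply', Bplus_eq β ih.perm_eq]
    simpa [add_assoc] using ih.raise (isDunklSystem β N)

theorem isRaised_phiCS (β : F) {lam : ℕ → ℕ} (hlam : Antitone lam) (m : ℕ) :
    IsRaised β (perm F N) (dunkl β) m (fun j => (lam j : F) - lam m) (phiCS β N lam m) := by
  induction m with
  | zero => exact isRaised_one β _
  | succ m ih =>
    have := isRaised_iterate_Bplus (ih.succ (isDunklSystem β N) (sub_self _))
      (lam m - lam (m + 1))
    simpa [phiCS, Nat.cast_sub (hlam m.le_succ)] using this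

end DunklPolynomial

/-- `H φ_λ = (∑_{j=1}^{N-1} (λ_j² + β(N+1-2j)λ_j)) φ_λ`.
Here `lam` is 0-indexed: `lam (j-1) = λ_j`, and `λ_j = 0` for `j ≥ N`. -/
theorem statement_2 {F : Type*} [Field F] [CharZero F] {N : ℕ} (β : F)
    (lam : ℕ → ℕ) (hmono : ∀ a b : ℕ, a ≤ b → lam b ≤ lam a)
    (hzero : ∀ j, N - 1 ≤ j → lam j = 0) :
    Hop β Finset.univ (phiCS β N lam (N - 1)) =
      (∑ j ∈ Finset.Icc 1 (N - 1),
        ((lam (j - 1) : F) ^ 2 + β * (((N : ℤ) + 1 - 2 * (j : ℤ) : ℤ) : F) * (lam (j - 1) : F)))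
        • phiCS β N lam (N - 1) := by
  have h := DunklPolynomial.isRaised_phiCS (N := N) β (fun a b => hmono a b) (N - 1)
  rw [DunklPolynomial.Hop_eq β h.perm_eq, h.sum_sq_op, Finset.range_eq_Ico]
  congr 1
  have hIcc : Finset.Icc 1 (N - 1) = Finset.Ico (0 + 1) (N - 1 + 1) := rfl
  rw [hIcc, ← Finset.sum_Ico_add']
  refine Finset.sum_congr rfl fun j _ => ?_
  rw [hzero _ le_rfl, Nat.add_sub_cancel, Fintype.card_fin]
  push_cast
  ring
end
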